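/- arXiv:1710.08486 — 5 statements merged into one kernel-verified Lean document; each statement's English description precedes it below -/
import Mathlib

section
/- For every ε > 0 there exists N such that for every n ≥ N, the edges of every simple graph G on n vertices can be decomposed into complete subgraphs C₁, …, C_ℓ, each of order two or three (i.e., copies of K₂ and K₃), such that |C₁| + ⋯ + |C_ℓ| ≤ (1/2 + ε)·n². Equivalently, π₃(G) ≤ (1/2 + o(1))·n² for every n-vertex graph G. -/
/-- `D = (C_1, …, C_ℓ)` is a decomposition of the edges of `G` into complete subgraphs:
each part is a clique of `G` with at least two vertices, and every edge of `G`
lies in exactly one part. -/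
def IsCliqueDecomp {V : Type*} (G : SimpleGraph V) {ℓ : ℕ} (D : Fin ℓ → Finset V) : Prop :=
  (∀ i, G.IsClique (D i : Set V) ∧ 2 ≤ (D i).card) ∧
  ∀ u v : V, G.Adj u v → ∃! i, u ∈ D i ∧ v ∈ D i

open Matrix in
/-- First-order expansion of a quadratic form along a transfer of weight between two coordinates. -/
theorem quadForm_transfer {ι : Type*} [Fintype ι] [DecidableEq ι] (A : Matrix ι ι ℝ)
    (hsymm : A.IsSymm) (x : ι → ℝ) (i j : ι) (t : ℝ) (hi : A i i = 0) (hj : A j j = 0) :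
    (x + t • (Pi.single i 1 - Pi.single j 1)) ⬝ᵥ
        A *ᵥ (x + t • (Pi.single i 1 - Pi.single j 1)) =
      x ⬝ᵥ A *ᵥ x + 2 * t * ((A *ᵥ x) i - (A *ᵥ x) j) - 2 * t ^ 2 * A i j := by
  have hx : ∀ k, x ⬝ᵥ A.col k = (A *ᵥ x) k := fun k => by
    rw [dotProduct_comm]
    simp only [dotProduct, mulVec, Matrix.col_apply]
    exact Finset.sum_congr rfl fun l _ => by rw [hsymm.apply]
  have hji : A j i = A i j := hsymm.apply i j
  simp only [mulVec_add, mulVec_smul, mulVec_sub, add_dotProduct, dotProduct_add, smul_dotProduct,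
    dotProduct_smul, sub_dotProduct, dotProduct_sub, single_dotProduct, mulVec_single_one,
    hx, one_mul, smul_eq_mul, Matrix.col_apply, hi, hj, hji]
  ring

open Matrix in
/-- A Motzkin–Straus type bound: if a symmetric matrix is supported on the edges of a graph, has
entries at most `2`, and sums to at most `3` on every triangle, then its quadratic form is at most
`1` on the standard simplex. -/
theorem quadForm_le_one_of_triangle_le {ι : Type*} [Fintype ι] [DecidableEq ι]
    (H : SimpleGraph ι) (A : Matrix ι ι ℝ) (hsymm : A.IsSymm)
    (hsupp : ∀ i j, ¬ H.Adj i j → A i j = 0) (htwo : ∀ i j, A i j ≤ 2)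
    (htri : ∀ i j k, H.Adj i j → H.Adj j k → H.Adj i k → A i j + A j k + A i k ≤ 3)
    {y : ι → ℝ} (hy : y ∈ stdSimplex ℝ ι) : y ⬝ᵥ A *ᵥ y ≤ 1 := by
  have hdiag : ∀ i, A i i = 0 := fun i => hsupp i i (H.loopless.irrefl i)
  have hcont : Continuous fun x : ι → ℝ => x ⬝ᵥ A *ᵥ x := by fun_prop
  obtain ⟨x₀, hx₀, hmax₀⟩ :=
    (isCompact_stdSimplex ℝ ι).exists_isMaxOn ⟨y, hy⟩ hcont.continuousOn
  let M : Set (ι → ℝ) :=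
    {x | x ∈ stdSimplex ℝ ι ∧ IsMaxOn (fun x => x ⬝ᵥ A *ᵥ x) (stdSimplex ℝ ι) x}
  let supp : (ι → ℝ) → Finset ι := fun x => Finset.univ.filter fun i => x i ≠ 0
  obtain ⟨x, ⟨hx, hmax⟩, hmin⟩ : ∃ x ∈ M, ∀ z ∈ M, (supp x).card ≤ (supp z).card := by
    obtain ⟨x, hxM, hx⟩ := (InvImage.wf (fun x => (supp x).card) Nat.lt_wfRel.wf).has_min M
      ⟨x₀, hx₀, hmax₀⟩
    exact ⟨x, hxM, fun z hz => not_lt.1 (hx z hz)⟩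
  refine (hmax hy).trans ?_
  have hnn : ∀ i, 0 ≤ x i := hx.1
  have htransfer : ∀ i j, i ≠ j → ∀ t, 0 ≤ x i + t → 0 ≤ x j - t →
      x + t • (Pi.single i 1 - Pi.single j 1) ∈ stdSimplex ℝ ι := by
    intro i j hij t h1 h2
    refine ⟨fun k => ?_, ?_⟩
    · rcases eq_or_ne k i with rfl | hki
      · simpa [hij] using h1
      · rcases eq_or_ne k j with rfl | hkj
        · simpa [hki, ← sub_eq_add_neg] using h2
        · simpa [hki, hkj] using hnn k
    · have h := hx.2
      simp [Finset.sum_add_distrib, ← Finset.mul_sum, h]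
  have hstat : ∀ i j, x i ≠ 0 → x j ≠ 0 → (A *ᵥ x) i = (A *ᵥ x) j := by
    have key : ∀ i j, x i ≠ 0 → x j ≠ 0 → (A *ᵥ x) i ≤ (A *ᵥ x) j := by
      intro i j hi hj
      by_contra! hlt
      have hij : i ≠ j := by rintro rfl; exact lt_irrefl _ hlt
      have hxj : 0 < x j := lt_of_le_of_ne (hnn j) (Ne.symm hj)
      set g := (A *ᵥ x) i - (A *ᵥ x) j with hg
      have hgpos : 0 < g := sub_pos.2 hlt
      set t := min (x j) (g / 4) with ht
      have htpos : 0 < t := lt_min hxj (by positivity)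
      have h := hmax (htransfer i j hij t (by linarith [hnn i])
        (by linarith [min_le_left (x j) (g/4)]))
      simp only [Set.mem_ofPred_eq] at h
      rw [quadForm_transfer A hsymm x i j t (hdiag i) (hdiag j), ← hg] at h
      have h4 : t ≤ g / 4 := min_le_right _ _
      have h2 := htwo i j
      nlinarith [mul_pos htpos hgpos, mul_nonneg htpos.le (sub_nonneg.2 h4),
        mul_nonneg (sq_nonneg t) (sub_nonneg.2 h2)]
    exact fun i j hi hj => le_antisymm (key i j hi hj) (key j i hj hi)
  have hclique : ∀ i j, x i ≠ 0 → x j ≠ 0 → i ≠ j → H.Adj i j := by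
    intro i j hi hj hij
    by_contra hadj
    have hmem := htransfer i j hij (x j) (by linarith [hnn i, hnn j]) (by simp)
    have hval := quadForm_transfer A hsymm x i j (x j) (hdiag i) (hdiag j)
    rw [hsupp i j hadj, hstat i j hi hj] at hval
    simp only [sub_self, mul_zero, add_zero, sub_zero] at hval
    refine absurd (hmin _ ⟨hmem, fun z hz => ?_⟩) (not_le.2 (Finset.card_lt_card ?_))
    · simp only [Set.mem_ofPred_eq]
      rw [hval]
      exact hmax hz
    · refine (Finset.ssubset_iff_of_subset fun k hk => ?_).2 ⟨j, ?_, ?_⟩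
      · simp only [supp, Finset.mem_filter, Finset.mem_univ, true_and] at hk ⊢
        rcases eq_or_ne k i with rfl | hki
        · exact hi
        · rcases eq_or_ne k j with rfl | hkj
          · exact hj
          · simpa [hki, hkj] using hk
      · simpa [supp] using hj
      · simp [supp, hij.symm]
  by_cases hbig : ∃ i j, x i ≠ 0 ∧ x j ≠ 0 ∧ 1 < A i j
  · obtain ⟨i, j, hi, hj, hij1⟩ := hbig
    have hij : i ≠ j := by rintro rfl; linarith [hdiag i]
    have hval : x ⬝ᵥ A *ᵥ x = (A *ᵥ x) i := by
      have : ∀ k, x k * (A *ᵥ x) k = x k * (A *ᵥ x) i := fun k => by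
        rcases eq_or_ne (x k) 0 with hk | hk
        · simp [hk]
        · rw [hstat k i hk hi]
      rw [dotProduct, Finset.sum_congr rfl fun k _ => this k, ← Finset.sum_mul, hx.2, one_mul]
    have hsum : (A *ᵥ x) i + (A *ᵥ x) j ≤ 2 := by
      have : ∑ k, (A i k + A j k) * x k ≤ ∑ k, 2 * x k := by
        refine Finset.sum_le_sum fun k _ => ?_
        rcases eq_or_ne (x k) 0 with hk | hk
        · simp [hk]
        refine mul_le_mul_of_nonneg_right ?_ (hnn k)
        rcases eq_or_ne k i with rfl | hki
        · linarith [hdiag k, htwo j k]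
        rcases eq_or_ne k j with rfl | hkj
        · linarith [hdiag k, htwo i k]
        · linarith [htri i j k (hclique i j hi hj hij) (hclique j k hj hk hkj.symm)
            (hclique i k hi hk hki.symm)]
      rw [← Finset.mul_sum, hx.2] at this
      simpa [mulVec, dotProduct, ← Finset.sum_add_distrib, add_mul] using this
    linarith [hstat i j hi hj]
  · push Not at hbig
    have hle : ∀ i, x i * (A *ᵥ x) i ≤ x i * 1 := fun i => by
      rcases eq_or_ne (x i) 0 with hi | hi
      · simp [hi]
      refine mul_le_mul_of_nonneg_left ?_ (hnn i)
      rw [← hx.2]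
      refine Finset.sum_le_sum fun j _ => ?_
      rcases eq_or_ne (x j) 0 with hj | hj
      · simp [hj]
      · exact mul_le_of_le_one_left (hnn j) (hbig i j hi hj)
    calc x ⬝ᵥ A *ᵥ x ≤ ∑ i, x i * 1 := Finset.sum_le_sum fun i _ => hle i
      _ = 1 := by simpa using hx.2

theorem sum_le_card_sq_of_triangle_le {ι : Type*} [Fintype ι] [DecidableEq ι]
    (H : SimpleGraph ι) (A : ι → ι → ℝ) (hsymm : ∀ i j, A i j = A j i)
    (hsupp : ∀ i j, ¬ H.Adj i j → A i j = 0) (htwo : ∀ i j, A i j ≤ 2)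
    (htri : ∀ i j k, H.Adj i j → H.Adj j k → H.Adj i k → A i j + A j k + A i k ≤ 3) :
    ∑ i, ∑ j, A i j ≤ (Fintype.card ι : ℝ) ^ 2 := by
  rcases isEmpty_or_nonempty ι with hι | hι
  · simp
  have hc : (0 : ℝ) < Fintype.card ι := by exact_mod_cast Fintype.card_pos
  have h := quadForm_le_one_of_triangle_le H (Matrix.of A)
    (Matrix.IsSymm.ext fun i j => hsymm j i) hsupp htwo htri
    (y := fun _ => (Fintype.card ι : ℝ)⁻¹)
    ⟨fun _ => by positivity, by simp [hc.ne']⟩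
  simp only [dotProduct, Matrix.mulVec, Matrix.of_apply, ← Finset.sum_mul, ← Finset.mul_sum] at h
  field_simp at h
  simpa using h

section

open Finset

/-- The probability that a random subset of `κ`, containing each `i` independently with
probability `p i`, equals `S`. -/
def subsetProb {κ : Type*} [Fintype κ] [DecidableEq κ] (p : κ → ℝ) (S : Finset κ) : ℝ :=
  ∏ i, if i ∈ S then p i else 1 - p i

section subsetProb

variable {κ : Type*} [Fintype κ] [DecidableEq κ] {p : κ → ℝ}

theorem subsetProb_nonneg (hp : ∀ i, p i ∈ Set.Icc 0 1) (S : Finset κ) : 0 ≤ subsetProb p S :=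
  prod_nonneg fun i _ => by
    split_ifs
    · exact (hp i).1
    · exact sub_nonneg.2 (hp i).2

theorem sum_subsetProb_mul_prod (p a b : κ → ℝ) :
    ∑ S, subsetProb p S * ∏ i, (if i ∈ S then a i else b i) =
      ∏ i, (p i * a i + (1 - p i) * b i) := by
  rw [Finset.prod_add, ← Finset.powerset_univ]
  refine sum_congr rfl fun S _ => ?_
  rw [subsetProb, ← prod_mul_distrib, ← prod_filter_mul_prod_filter_not univ (· ∈ S)]
  congr 1
  · rw [filter_mem_eq_inter, univ_inter]
    exact prod_congr rfl fun i hi => by simp [hi]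
  · rw [← sdiff_eq_filter]
    exact prod_congr rfl fun i hi => by simp [(mem_sdiff.1 hi).2]

theorem sum_subsetProb (p : κ → ℝ) : ∑ S, subsetProb p S = 1 := by
  simpa using sum_subsetProb_mul_prod p 1 1

theorem sum_subsetProb_disjoint (p : κ → ℝ) (B : Finset κ) :
    ∑ S, subsetProb p S * (if Disjoint S B then 1 else 0) = ∏ i ∈ B, (1 - p i) := by
  have h := sum_subsetProb_mul_prod p (fun i => if i ∈ B then 0 else 1) 1
  have h1 : ∀ S : Finset κ, (∏ i, if i ∈ S then (if i ∈ B then (0 : ℝ) else 1) else 1) =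
      if Disjoint S B then 1 else 0 := fun S => by
    split_ifs with hd
    · refine prod_eq_one fun i _ => ?_
      split_ifs with h1 h2
      · exact absurd h2 (disjoint_left.1 hd h1)
      all_goals rfl
    · obtain ⟨i, hiS, hiB⟩ := not_disjoint_iff.1 hd
      exact prod_eq_zero (mem_univ i) (by simp [hiS, hiB])
  simp only [Pi.one_apply, h1] at h
  rw [h, ← prod_filter_mul_prod_filter_not univ (· ∈ B)]
  rw [filter_mem_eq_inter, univ_inter]
  rw [prod_congr rfl (g := fun i => 1 - p i) fun i hi => by simp [hi]]
  rw [prod_eq_one (s := univ.filter (· ∉ B)) fun i hi => by simp [(mem_filter.1 hi).2], mul_one]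

theorem sum_subsetProb_subset (p : κ → ℝ) (B : Finset κ) :
    ∑ S, subsetProb p S * (if B ⊆ S then 1 else 0) = ∏ i ∈ B, p i := by
  have h := sum_subsetProb_mul_prod p 1 (fun i => if i ∈ B then 0 else 1)
  have h1 : ∀ S : Finset κ, (∏ i, if i ∈ S then (1 : ℝ) else (if i ∈ B then (0 : ℝ) else 1)) =
      if B ⊆ S then 1 else 0 := fun S => by
    split_ifs with hd
    · refine prod_eq_one fun i _ => ?_
      split_ifs with h1 h2
      · rfl
      · exact absurd (hd h2) h1
      · rfl
    · obtain ⟨i, hiB, hiS⟩ := not_subset.1 hd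
      exact prod_eq_zero (mem_univ i) (by simp [hiS, hiB])
  simp only [Pi.one_apply, h1] at h
  rw [h, ← prod_filter_mul_prod_filter_not univ (· ∈ B)]
  rw [filter_mem_eq_inter, univ_inter]
  rw [prod_congr rfl (g := p) fun i hi => by simp [hi]]
  rw [prod_eq_one (s := univ.filter (· ∉ B)) fun i hi => by simp [(mem_filter.1 hi).2], mul_one]

/-- Some outcome of positive probability attains at least the expected value. -/
theorem exists_le_of_le_sum_subsetProb (hp : ∀ i, p i ∈ Set.Icc 0 1) (f : Finset κ → ℝ) {c : ℝ}
    (hc : c ≤ ∑ S, subsetProb p S * f S) : ∃ S, (∀ i ∈ S, p i ≠ 0) ∧ c ≤ f S := by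
  by_contra! h
  have hlt : ∀ S, subsetProb p S ≠ 0 → f S < c := fun S hS => h S fun i hi hpi =>
    hS (prod_eq_zero (mem_univ i) (by simp [hi, hpi]))
  obtain ⟨S₀, -, hS₀⟩ : ∃ S ∈ univ, subsetProb p S ≠ 0 :=
    exists_ne_zero_of_sum_ne_zero (by rw [sum_subsetProb]; exact one_ne_zero)
  have hle : ∀ S, subsetProb p S * f S ≤ subsetProb p S * c := fun S => by
    rcases eq_or_ne (subsetProb p S) 0 with h0 | h0
    · simp [h0]
    · exact mul_le_mul_of_nonneg_left (hlt S h0).le (subsetProb_nonneg hp S)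
  have := sum_lt_sum (fun S _ => hle S) ⟨S₀, mem_univ _, mul_lt_mul_of_pos_left (hlt S₀ hS₀)
    ((subsetProb_nonneg hp S₀).lt_of_ne' hS₀)⟩
  rw [← sum_mul, sum_subsetProb, one_mul] at this
  linarith

end subsetProb

section survival

variable {κ α : Type*} [Fintype κ] [DecidableEq κ] [DecidableEq α]

/-- The indices whose sets meet `U`. -/
def touching (B : κ → Finset α) (U : Finset α) : Finset κ := univ.filter fun c => ¬ Disjoint (B c) U

/-- The indicator that no set selected by `S` meets `U`. -/
def survives (B : κ → Finset α) (S : Finset κ) (U : Finset α) : ℝ :=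
  if Disjoint S (touching B U) then 1 else 0

/-- The probability that no set of the random selection meets `U`. -/
def survivalProb (B : κ → Finset α) (p : κ → ℝ) (U : Finset α) : ℝ :=
  ∏ c ∈ touching B U, (1 - p c)

theorem survives_mul_survives (B : κ → Finset α) (S : Finset κ) (U U' : Finset α) :
    survives B S U * survives B S U' = survives B S (U ∪ U') := by
  have h : touching B (U ∪ U') = touching B U ∪ touching B U' := by
    ext c
    simp [touching, disjoint_union_right, -not_and, not_and_or]
  simp only [survives, h, disjoint_union_right]
  split_ifs <;> simp_all

theorem sum_subsetProb_mul_sum_survives {τ : Type*} (B : κ → Finset α) (p : κ → ℝ)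
    (t : Finset τ) (c : τ → ℝ) (U : τ → Finset α) :
    ∑ S, subsetProb p S * ∑ k ∈ t, c k * survives B S (U k) =
      ∑ k ∈ t, c k * survivalProb B p (U k) := by
  simp only [mul_sum]
  rw [sum_comm]
  refine sum_congr rfl fun k _ => ?_
  rw [survivalProb, ← sum_subsetProb_disjoint, mul_sum]
  exact sum_congr rfl fun S _ => by rw [survives]; ring

variable {B : κ → Finset α} {p : κ → ℝ} {q : ℝ}

omit [DecidableEq κ] in
theorem pow_card_eq_prod (hq : ∀ x, ∏ c with x ∈ B c, (1 - p c) = q) (U : Finset α) :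
    q ^ U.card = ∏ c, (1 - p c) ^ (B c ∩ U).card := by
  rw [← prod_const, ← prod_congr rfl fun x _ => hq x]
  simp only [prod_filter]
  rw [prod_comm]
  refine prod_congr rfl fun c _ => ?_
  rw [← prod_filter, prod_const, filter_mem_eq_inter, inter_comm]

omit [DecidableEq κ] in
theorem survivalProb_eq_prod (U : Finset α) :
    survivalProb B p U = ∏ c, if (B c ∩ U).card = 0 then 1 else (1 - p c) := by
  rw [survivalProb, touching, prod_filter]
  refine prod_congr rfl fun c _ => ?_
  simp only [card_eq_zero, ← disjoint_iff_inter_eq_empty]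
  split_ifs <;> simp_all

omit [DecidableEq κ] in
theorem pow_card_le_survivalProb (hp : ∀ c, p c ∈ Set.Icc 0 1)
    (hq : ∀ x, ∏ c with x ∈ B c, (1 - p c) = q) (U : Finset α) :
    q ^ U.card ≤ survivalProb B p U := by
  rw [pow_card_eq_prod hq, survivalProb_eq_prod]
  refine prod_le_prod (fun c _ => pow_nonneg (sub_nonneg.2 (hp c).2) _) fun c _ => ?_
  split_ifs with h
  · simp [h]
  · exact pow_le_of_le_one (sub_nonneg.2 (hp c).2) (by linarith [(hp c).1]) h

omit [DecidableEq κ] in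
theorem sum_card_inter_sub_one_le (hlin : ∀ c c', c ≠ c' → (B c ∩ B c').card ≤ 1)
    (U : Finset α) : ∑ c, ((B c ∩ U).card - 1) ≤ U.card ^ 2 := by
  have hdisj : (↑(univ : Finset κ) : Set κ).PairwiseDisjoint fun c => (B c ∩ U).offDiag := by
    intro c _ c' _ hcc'
    refine disjoint_left.2 fun z hz hz' => ?_
    simp only [mem_offDiag, mem_inter] at hz hz'
    exact hz.2.2 (card_le_one.1 (hlin c c' hcc') _ (mem_inter.2 ⟨hz.1.1, hz'.1.1⟩) _
      (mem_inter.2 ⟨hz.2.1.1, hz'.2.1.1⟩))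
  calc ∑ c, ((B c ∩ U).card - 1) ≤ ∑ c, (B c ∩ U).offDiag.card := by
        refine sum_le_sum fun c _ => ?_
        rw [offDiag_card]
        rcases Nat.eq_zero_or_pos (B c ∩ U).card with h | h
        · simp [h]
        · rw [← Nat.mul_sub_one]
          exact Nat.le_mul_of_pos_left _ h
    _ = (univ.biUnion fun c => (B c ∩ U).offDiag).card := (card_biUnion hdisj).symm
    _ ≤ U.offDiag.card := card_le_card fun z hz => by
        simp only [mem_biUnion, mem_offDiag, mem_inter] at hz ⊢
        obtain ⟨c, -, h1, h2, h3⟩ := hz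
        exact ⟨h1.2, h2.2, h3⟩
    _ ≤ U.card ^ 2 := by rw [offDiag_card, sq]; exact Nat.sub_le _ _

omit [DecidableEq κ] in
theorem pow_mul_survivalProb_le (hp : ∀ c, p c ∈ Set.Icc 0 1)
    (hq : ∀ x, ∏ c with x ∈ B c, (1 - p c) = q)
    (hlin : ∀ c c', c ≠ c' → (B c ∩ B c').card ≤ 1) {r : ℝ} (hr0 : 0 ≤ r) (hr1 : r ≤ 1)
    (hr : ∀ c, 1 < (B c).card → r ≤ 1 - p c) (U : Finset α) :
    r ^ (U.card ^ 2) * survivalProb B p U ≤ q ^ U.card := by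
  have hs : 0 ≤ survivalProb B p U := prod_nonneg fun c _ => sub_nonneg.2 (hp c).2
  calc r ^ (U.card ^ 2) * survivalProb B p U
      ≤ r ^ (∑ c, ((B c ∩ U).card - 1)) * survivalProb B p U :=
        mul_le_mul_of_nonneg_right
          (pow_le_pow_of_le_one hr0 hr1 (sum_card_inter_sub_one_le hlin U)) hs
    _ ≤ q ^ U.card := by
      rw [pow_card_eq_prod hq, survivalProb_eq_prod, ← prod_pow_eq_pow_sum, ← prod_mul_distrib]
      have hp' : ∀ c, 0 ≤ 1 - p c := fun c => sub_nonneg.2 (hp c).2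
      refine prod_le_prod (fun c _ => mul_nonneg (pow_nonneg hr0 _) ?_) fun c _ => ?_
      · split_ifs
        exacts [zero_le_one, hp' c]
      · split_ifs with h
        · simp [h]
        · obtain ⟨m, hm⟩ := Nat.exists_eq_succ_of_ne_zero h
          rw [hm, Nat.succ_sub_one, pow_succ]
          refine mul_le_mul_of_nonneg_right ?_ (hp' c)
          rcases Nat.eq_zero_or_pos m with rfl | hm0
          · simp
          · refine pow_le_pow_left₀ hr0 (hr c ?_) m
            have := card_le_card (inter_subset_left (s₁ := B c) (s₂ := U))
            omega

omit [DecidableEq κ] in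
theorem survivalProb_le_one (hp : ∀ c, p c ∈ Set.Icc 0 1) (U : Finset α) :
    survivalProb B p U ≤ 1 :=
  prod_le_one (fun c _ => sub_nonneg.2 (hp c).2) fun c _ => by linarith [(hp c).1]

omit [DecidableEq κ] in
theorem survivalProb_singleton (hq : ∀ x, ∏ c with x ∈ B c, (1 - p c) = q) (x : α) :
    survivalProb B p {x} = q := by
  simp [survivalProb, touching, hq]

/-- The weighted number of surviving triples through a point `x` has small mean square deviation
from its expectation, on the event that `x` survives. -/
theorem sum_subsetProb_sq_deviation_le (hp : ∀ c, p c ∈ Set.Icc 0 1)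
    (hq : ∀ x, ∏ c with x ∈ B c, (1 - p c) = q) (hq0 : 0 < q) (hq1 : q ≤ 1)
    (hlin : ∀ c c', c ≠ c' → (B c ∩ B c').card ≤ 1) {r : ℝ} (hr0 : 0 < r) (hr1 : r ≤ 1)
    (hr : ∀ c, 1 < (B c).card → r ≤ 1 - p c) {τ : Type*} [DecidableEq τ] (s : Finset τ)
    (U : τ → Finset α) (x : α) (hx : ∀ k ∈ s, x ∈ U k) (hU : ∀ k ∈ s, (U k).card = 3)
    (hUlin : ∀ k ∈ s, ∀ k' ∈ s, k ≠ k' → (U k ∩ U k').card ≤ 1) (w : τ → ℝ) {η : ℝ}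
    (hw0 : ∀ k, 0 ≤ w k) (hwη : ∀ k, w k ≤ η) (hd : ∑ k ∈ s, w k ≤ 1) (hη : 0 ≤ η) :
    ∑ S, subsetProb p S * (∑ k ∈ s, w k / q ^ 2 * survives B S (U k) -
      (∑ k ∈ s, w k) * survives B S {x}) ^ 2 ≤ (1 / r ^ 25 - 1) + η / q ^ 4 := by
  set d := ∑ k ∈ s, w k with hdd
  have hd0 : 0 ≤ d := sum_nonneg fun k _ => hw0 k
  set a : τ → ℝ := fun k => w k / q ^ 2 with ha
  have ha0 : ∀ k, 0 ≤ a k := fun k => div_nonneg (hw0 k) (by positivity)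
  have hsa : ∑ k ∈ s, a k = d / q ^ 2 := by rw [hdd, sum_div]
  clear_value d
  have hexp : ∀ S, (∑ k ∈ s, a k * survives B S (U k) - d * survives B S {x}) ^ 2 =
      ∑ z ∈ s ×ˢ s, (a z.1 * a z.2) * survives B S (U z.1 ∪ U z.2) +
      ∑ k ∈ s, (-2 * d * a k) * survives B S (U k) +
      ∑ k ∈ ({x} : Finset α), d ^ 2 * survives B S {k} := by
    intro S
    have h1 : ∑ k ∈ s, (-2 * d * a k) * survives B S (U k) =
        -2 * d * ((∑ k ∈ s, a k * survives B S (U k)) * survives B S {x}) := by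
      rw [sum_mul, mul_sum]
      refine sum_congr rfl fun k hk => ?_
      rw [mul_assoc (a k), survives_mul_survives,
        union_eq_left.2 (singleton_subset_iff.2 (hx k hk))]
      ring
    have h2 : ∑ z ∈ s ×ˢ s, (a z.1 * a z.2) * survives B S (U z.1 ∪ U z.2) =
        (∑ k ∈ s, a k * survives B S (U k)) ^ 2 := by
      rw [sq, sum_mul_sum, sum_product]
      refine sum_congr rfl fun k _ => sum_congr rfl fun k' _ => ?_
      rw [← survives_mul_survives]
      ring
    have h3 : survives B S {x} = survives B S {x} ^ 2 := by
      rw [sq, survives_mul_survives, union_idempotent]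
    rw [h1, h2, sum_singleton]
    linear_combination -d ^ 2 * h3
  change ∑ S, subsetProb p S * (∑ k ∈ s, a k * survives B S (U k) - d * survives B S {x}) ^ 2 ≤ _
  simp only [hexp, mul_add, sum_add_distrib, sum_subsetProb_mul_sum_survives]
  rw [sum_singleton, survivalProb_singleton hq]
  have hpairs : ∑ z ∈ s ×ˢ s, a z.1 * a z.2 * survivalProb B p (U z.1 ∪ U z.2) ≤
      (d / q ^ 2) ^ 2 * (q ^ 5 / r ^ 25) + η / q ^ 2 * (d / q ^ 2) := by
    calc _ ≤ ∑ z ∈ s ×ˢ s, (a z.1 * a z.2 * (q ^ 5 / r ^ 25) +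
          if z.1 = z.2 then η / q ^ 2 * a z.1 else 0) := by
          refine sum_le_sum fun z hz => ?_
          obtain ⟨hz1, hz2⟩ := mem_product.1 hz
          split_ifs with h
          · have h1 : a z.1 * a z.2 * survivalProb B p (U z.1 ∪ U z.2) ≤ a z.1 * a z.2 :=
              mul_le_of_le_one_right (mul_nonneg (ha0 _) (ha0 _)) (survivalProb_le_one hp _)
            have h2 : a z.1 * a z.2 ≤ η / q ^ 2 * a z.1 := by
              rw [mul_comm]
              exact mul_le_mul_of_nonneg_right
                (div_le_div_of_nonneg_right (hwη _) (by positivity)) (ha0 _)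
            have h3 : 0 ≤ a z.1 * a z.2 * (q ^ 5 / r ^ 25) :=
              mul_nonneg (mul_nonneg (ha0 _) (ha0 _)) (by positivity)
            linarith
          · rw [add_zero]
            refine mul_le_mul_of_nonneg_left ?_ (mul_nonneg (ha0 _) (ha0 _))
            have hcard : (U z.1 ∪ U z.2).card = 5 := by
              have h1 := card_union_add_card_inter (U z.1) (U z.2)
              have h2 := hUlin _ hz1 _ hz2 h
              have h3 : 0 < (U z.1 ∩ U z.2).card :=
                card_pos.2 ⟨x, mem_inter.2 ⟨hx _ hz1, hx _ hz2⟩⟩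
              rw [hU _ hz1, hU _ hz2] at h1
              omega
            have h := pow_mul_survivalProb_le hp hq hlin hr0.le hr1 hr (U z.1 ∪ U z.2)
            rw [hcard] at h
            rw [le_div_iff₀ (by positivity), mul_comm]
            exact h
      _ = _ := by
          rw [sum_add_distrib, ← sum_mul, ← hsa, sq (∑ k ∈ s, a k), sum_mul_sum, sum_product,
            sum_product]
          simp [mul_sum]
  have hsingle : ∑ k ∈ s, (-2 * d * a k) * survivalProb B p (U k) ≤
      -2 * d * (d / q ^ 2) * q ^ 3 := by
    rw [← hsa, mul_sum, sum_mul]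
    refine sum_le_sum fun k hk => ?_
    have h := pow_card_le_survivalProb hp hq (U k)
    rw [hU k hk] at h
    have h' : 0 ≤ 2 * d * a k := mul_nonneg (by positivity) (ha0 k)
    nlinarith [mul_le_mul_of_nonneg_left h h']
  have hr' : 1 ≤ 1 / r ^ 25 := by
    rw [one_le_div (by positivity)]
    exact pow_le_one₀ hr0.le hr1
  have e1 : (d / q ^ 2) ^ 2 * (q ^ 5 / r ^ 25) = d ^ 2 * q * (1 / r ^ 25) := by
    field_simp
  have e2 : -2 * d * (d / q ^ 2) * q ^ 3 = -2 * (d ^ 2 * q) := by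
    field_simp
  have e3 : η / q ^ 2 * (d / q ^ 2) = η / q ^ 4 * d := by
    field_simp
  have e4 : η / q ^ 4 * d ≤ η / q ^ 4 := mul_le_of_le_one_right (by positivity) hd
  have e5 : d ^ 2 * q ≤ 1 := mul_le_one₀ (pow_le_one₀ hd0 hd) hq0.le hq1
  have e6 : (d ^ 2 * q) * (1 / r ^ 25 - 1) ≤ 1 * (1 / r ^ 25 - 1) :=
    mul_le_mul_of_nonneg_right e5 (sub_nonneg.2 hr')
  rw [e1, e3] at hpairs
  rw [e2] at hsingle
  linarith

end survival

theorem sum_degree_mul {ι α : Type*} [Fintype ι] [Fintype α] [DecidableEq α]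
    (B : ι → Finset α) (v : ι → ℝ) (e : α → ℝ) :
    ∑ x, (∑ T with x ∈ B T, v T) * e x = ∑ T, v T * ∑ x ∈ B T, e x := by
  simp only [sum_mul, mul_sum, sum_filter]
  rw [sum_comm]
  refine sum_congr rfl fun T _ => ?_
  simp only [ite_mul, zero_mul]
  rw [← sum_filter, filter_mem_eq_inter, univ_inter]

/-- A nonnegative weighting can be lowered so that all degrees become at most `1`, losing at most
the total excess of the degrees over `1`. -/
theorem exists_le_of_degree_excess {ι α : Type*} [Fintype ι] [Fintype α] [DecidableEq α]
    (B : ι → Finset α) (v : ι → ℝ) (hv : ∀ T, 0 ≤ v T) :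
    ∃ w : ι → ℝ, (∀ T, 0 ≤ w T) ∧ (∀ T, w T ≤ v T) ∧ (∀ x, ∑ T with x ∈ B T, w T ≤ 1) ∧
      ∑ T, v T - ∑ x, max 0 (∑ T with x ∈ B T, v T - 1) ≤ ∑ T, w T := by
  set D : α → ℝ := fun x => ∑ T with x ∈ B T, v T with hD
  have hD0 : ∀ x, 0 ≤ D x := fun x => sum_nonneg fun T _ => hv T
  set e : α → ℝ := fun x => 1 - 1 / max 1 (D x) with he
  have hm : ∀ x, 1 ≤ max 1 (D x) := fun x => le_max_left _ _
  have he0 : ∀ x, 0 ≤ e x := fun x => by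
    rw [he, sub_nonneg]
    exact div_le_one_of_le₀ (hm x) (by linarith [hm x])
  have hDe : ∀ x, D x * (1 - e x) ≤ 1 := fun x => by
    rw [he, sub_sub_cancel, mul_one_div]
    exact div_le_one_of_le₀ (le_max_right _ _) (by linarith [hm x])
  have hDe' : ∀ x, D x * e x = max 0 (D x - 1) := fun x => by
    simp only [he]
    rcases le_total (D x) 1 with h | h
    · rw [max_eq_left h, max_eq_left (by linarith)]; simp
    · rw [max_eq_right h, max_eq_right (by linarith), mul_sub, mul_one_div_cancel (by linarith)]
      ring
  have he1 : ∀ x, e x ≤ 1 := fun x => by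
    have : 0 ≤ 1 / max 1 (D x) := by have := hm x; positivity
    simp only [he]; linarith
  refine ⟨fun T => v T * max 0 (1 - ∑ x ∈ B T, e x), fun T => mul_nonneg (hv T) (le_max_left _ _),
    fun T => mul_le_of_le_one_right (hv T) (max_le zero_le_one ?_), fun x => ?_, ?_⟩
  · linarith [sum_nonneg fun x (_ : x ∈ B T) => he0 x]
  · refine le_trans (sum_le_sum (g := fun T => v T * (1 - e x)) fun T hT => ?_) ?_
    · refine mul_le_mul_of_nonneg_left (max_le (by linarith [he1 x]) ?_) (hv T)
      linarith [single_le_sum (fun x _ => he0 x) (mem_filter.1 hT).2]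
    · rw [← sum_mul]; exact hDe x
  · calc ∑ T, v T - ∑ x, max 0 (D x - 1) = ∑ T, v T * (1 - ∑ x ∈ B T, e x) := by
          rw [← sum_congr rfl fun x _ => hDe' x, sum_degree_mul]
          simp only [mul_sub, mul_one, sum_sub_distrib]
      _ ≤ _ := sum_le_sum fun T _ => mul_le_mul_of_nonneg_left (le_max_right _ _) (hv T)

theorem one_sub_sum_le_prod {ι : Type*} (s : Finset ι) (f : ι → ℝ)
    (hf : ∀ i ∈ s, f i ∈ Set.Icc 0 1) : 1 - ∑ i ∈ s, f i ≤ ∏ i ∈ s, (1 - f i) := by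
  classical
  induction s using Finset.induction_on with
  | empty => simp
  | insert i s hi ih =>
    rw [sum_insert hi, prod_insert hi]
    have h1 := hf i (mem_insert_self i s)
    have h2 := ih fun j hj => hf j (mem_insert_of_mem hj)
    have h3 : 0 ≤ ∑ j ∈ s, f j := sum_nonneg fun j hj => (hf j (mem_insert_of_mem hj)).1
    nlinarith [mul_le_mul_of_nonneg_left h2 (sub_nonneg.2 h1.2), mul_nonneg h1.1 h3]

/-- The total weight of the sets meeting a given one is at most its cardinality. -/
theorem sum_meeting_le_card {ι α : Type*} [Fintype ι] [DecidableEq α] (B : ι → Finset α)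
    (w : ι → ℝ) (hw0 : ∀ T, 0 ≤ w T) (hd : ∀ x, ∑ T with x ∈ B T, w T ≤ 1) (U : Finset α) :
    ∑ T with ¬ Disjoint U (B T), w T ≤ U.card := by
  calc ∑ T with ¬ Disjoint U (B T), w T ≤ ∑ T, ∑ x ∈ U, if x ∈ B T then w T else 0 := by
        rw [sum_filter]
        refine sum_le_sum fun T _ => ?_
        split_ifs with h
        · exact sum_nonneg fun x _ => by split_ifs <;> simp [hw0]
        · obtain ⟨x, hx, hxT⟩ := not_disjoint_iff.1 h
          refine le_trans (by simp [hxT]) (single_le_sum (f := fun x => if x ∈ B T then w T else 0)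
            (fun x _ => by split_ifs <;> simp [hw0]) hx)
    _ = ∑ x ∈ U, ∑ T with x ∈ B T, w T := by
        rw [sum_comm]
        exact sum_congr rfl fun x _ => by rw [sum_filter]
    _ ≤ U.card := by simpa using sum_le_sum fun x (_ : x ∈ U) => hd x

/-- One round of the nibble: a small random matching is removed, and the remaining fractional
matching is rescaled to the points that survive. -/
theorem nibble_step {ι α : Type*} [Fintype ι] [DecidableEq ι] [Fintype α] [DecidableEq α]
    (B : ι → Finset α) (h3 : ∀ T, (B T).card = 3)
    (hlin : ∀ T T', T ≠ T' → (B T ∩ B T').card ≤ 1) (w : ι → ℝ) (hw0 : ∀ T, 0 ≤ w T)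
    {η : ℝ} (hη : 0 ≤ η) (hwη : ∀ T, w T ≤ η) (hd : ∀ x, ∑ T with x ∈ B T, w T ≤ 1)
    {θ : ℝ} (hθ0 : 0 ≤ θ) (hθ1 : θ < 1) (hθη : θ * η < 1) {a : ℝ} (ha : 0 ≤ a)
    {δ : ℝ} (hδ : 0 < δ) :
    ∃ (M : Finset ι) (w' : ι → ℝ), (∀ T ∈ M, w T ≠ 0) ∧
      (∀ T ∈ M, ∀ T' ∈ M, T ≠ T' → Disjoint (B T) (B T')) ∧
      (∀ T, w' T ≠ 0 → w T ≠ 0 ∧ ∀ T' ∈ M, Disjoint (B T') (B T)) ∧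
      (∀ T, 0 ≤ w' T) ∧ (∀ T, w' T ≤ η / (1 - θ) ^ 2) ∧ (∀ x, ∑ T with x ∈ B T, w' T ≤ 1) ∧
      θ * (1 - 3 * θ) * ∑ T, w T + a * ((1 - θ) * ∑ T, w T - Fintype.card α *
        (δ + (1 / (1 - θ * η) ^ 25 - 1 + η / (1 - θ) ^ 4) / (4 * δ))) ≤
        M.card + a * ∑ T, w' T := by
  obtain ⟨q, hqθ⟩ : ∃ q, q = 1 - θ := ⟨_, rfl⟩
  rw [← hqθ]
  have hq0 : 0 < q := by linarith
  have hq1 : q ≤ 1 := by linarith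
  have hw1 : ∀ T, w T ≤ 1 := fun T => by
    obtain ⟨x, hx⟩ : (B T).Nonempty := card_pos.1 (by rw [h3]; norm_num)
    exact (single_le_sum (fun T' _ => hw0 T') (mem_filter.2 ⟨mem_univ T, hx⟩)).trans (hd x)
  have hθw : ∀ T, θ * w T ∈ Set.Icc (0 : ℝ) 1 := fun T =>
    ⟨mul_nonneg hθ0 (hw0 T), mul_le_one₀ hθ1.le (hw0 T) (hw1 T)⟩
  set s : α → ℝ := fun x => ∏ T with x ∈ B T, (1 - θ * w T) with hs
  have hqs : ∀ x, q ≤ s x := fun x => by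
    refine le_trans ?_ (one_sub_sum_le_prod _ (fun T => θ * w T) fun T _ => hθw T)
    rw [← mul_sum, hqθ]
    linarith [mul_le_mul_of_nonneg_left (hd x) hθ0]
  have hs0 : ∀ x, 0 < s x := fun x => hq0.trans_le (hqs x)
  set B' : ι ⊕ α → Finset α := Sum.elim B fun x => {x} with hB'
  set p : ι ⊕ α → ℝ := Sum.elim (fun T => θ * w T) fun x => 1 - q / s x with hpdef
  have hp : ∀ c, p c ∈ Set.Icc 0 1 := by
    rintro (T | x)
    · exact hθw T
    · have h1 : q / s x ≤ 1 := div_le_one_of_le₀ (hqs x) (hs0 x).le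
      have h2 : 0 ≤ q / s x := div_nonneg hq0.le (hs0 x).le
      exact ⟨by simpa [hpdef] using h1, by simpa [hpdef] using h2⟩
  have hq : ∀ x, ∏ c with x ∈ B' c, (1 - p c) = q := fun x => by
    rw [prod_filter, Fintype.prod_sum_type]
    simp only [hB', hpdef, Sum.elim_inl, Sum.elim_inr, mem_singleton, sub_sub_cancel,
      prod_ite_eq, mem_univ, if_true]
    rw [← prod_filter]
    exact mul_div_cancel₀ q (hs0 x).ne'
  have hlin' : ∀ c c', c ≠ c' → (B' c ∩ B' c').card ≤ 1 := by
    rintro (T | x) (T' | y) h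
    · exact hlin T T' fun hT => h (by rw [hT])
    · exact (card_le_card inter_subset_right).trans (card_singleton y).le
    · exact (card_le_card inter_subset_left).trans (card_singleton x).le
    · exact (card_le_card inter_subset_left).trans (card_singleton x).le
  have hr : ∀ c, 1 < (B' c).card → 1 - θ * η ≤ 1 - p c := by
    rintro (T | x) h
    · exact sub_le_sub_left (mul_le_mul_of_nonneg_left (hwη T) hθ0) 1
    · exact absurd h (by simp [hB'])
  set V := 1 / (1 - θ * η) ^ 25 - 1 + η / q ^ 4 with hV
  let v : Finset (ι ⊕ α) → ι → ℝ := fun S T => w T / q ^ 2 * survives B' S (B T)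
  have hsurv0 : ∀ S U, 0 ≤ survives B' S U := fun S U => by
    rw [survives]; split_ifs <;> norm_num
  have hsurv1 : ∀ S U, survives B' S U ≤ 1 := fun S U => by
    rw [survives]; split_ifs <;> norm_num
  have hv0 : ∀ S T, 0 ≤ v S T := fun S T =>
    mul_nonneg (div_nonneg (hw0 T) (by positivity)) (hsurv0 _ _)
  let Z : Finset (ι ⊕ α) → α → ℝ := fun S x =>
    ∑ T with x ∈ B T, v S T - (∑ T with x ∈ B T, w T) * survives B' S {x}
  let chosen : Finset (ι ⊕ α) → ι → ℝ := fun S T => if {Sum.inl T} ⊆ S then 1 else 0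
  let clash : Finset (ι ⊕ α) → ι → ι → ℝ := fun S T T' =>
    if {Sum.inl T, Sum.inl T'} ⊆ S then 1 else 0
  let nbr : ι → Finset ι := fun T => univ.filter fun T' => T' ≠ T ∧ ¬ Disjoint (B T) (B T')
  have hchosen : ∑ S, subsetProb p S * ∑ T, chosen S T = θ * ∑ T, w T := by
    simp only [mul_sum, chosen]
    rw [sum_comm]
    refine sum_congr rfl fun T _ => ?_
    rw [sum_subsetProb_subset, prod_singleton]
    rfl
  have hclash : ∑ S, subsetProb p S * ∑ T, ∑ T' ∈ nbr T, clash S T T' ≤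
      3 * θ ^ 2 * ∑ T, w T := by
    have h1 : ∑ S, subsetProb p S * ∑ T, ∑ T' ∈ nbr T, clash S T T' =
        ∑ T, ∑ T' ∈ nbr T, (θ * w T) * (θ * w T') := by
      simp only [mul_sum, clash]
      rw [sum_comm]
      refine sum_congr rfl fun T _ => ?_
      rw [sum_comm]
      refine sum_congr rfl fun T' hT' => ?_
      have hne : (Sum.inl T : ι ⊕ α) ≠ Sum.inl T' := fun h =>
        (mem_filter.1 hT').2.1 (Sum.inl_injective h).symm
      rw [sum_subsetProb_subset, prod_pair hne]
      rfl
    rw [h1, mul_sum]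
    refine sum_le_sum fun T _ => ?_
    have h2 : ∑ T' ∈ nbr T, w T' ≤ 3 := by
      have h := sum_meeting_le_card B w hw0 hd (B T)
      rw [h3] at h
      refine le_trans (sum_le_sum_of_subset_of_nonneg (fun T' hT' => ?_) fun T' _ _ => hw0 T') h
      exact mem_filter.2 ⟨mem_univ _, (mem_filter.1 hT').2.2⟩
    rw [← mul_sum, ← mul_sum]
    have h4 : 0 ≤ θ ^ 2 * w T := mul_nonneg (sq_nonneg θ) (hw0 T)
    linarith [mul_le_mul_of_nonneg_left h2 h4]
  have hval : q * ∑ T, w T ≤ ∑ S, subsetProb p S * ∑ T, v S T := by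
    rw [sum_subsetProb_mul_sum_survives, mul_sum]
    refine sum_le_sum fun T _ => ?_
    have h := pow_card_le_survivalProb hp hq (B T)
    rw [h3] at h
    calc q * w T = w T / q ^ 2 * q ^ 3 := by field_simp
      _ ≤ _ := mul_le_mul_of_nonneg_left h (div_nonneg (hw0 T) (by positivity))
  have hdev : ∀ x, ∑ S, subsetProb p S * Z S x ^ 2 ≤ V := fun x =>
    sum_subsetProb_sq_deviation_le hp hq hq0 hq1 hlin' (sub_pos.2 hθη)
      (by linarith [mul_nonneg hθ0 hη]) hr (univ.filter fun T => x ∈ B T) B x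
      (fun T hT => (mem_filter.1 hT).2) (fun T _ => h3 T) (fun T _ T' _ => hlin T T') w hw0 hwη
      (hd x) hη
  have hexpect : θ * ∑ T, w T - 3 * θ ^ 2 * ∑ T, w T +
      a * (q * ∑ T, w T - Fintype.card α * (δ + V / (4 * δ))) ≤
      ∑ S, subsetProb p S * (∑ T, chosen S T - ∑ T, ∑ T' ∈ nbr T, clash S T T' +
        a * (∑ T, v S T - ∑ x, (δ + Z S x ^ 2 / (4 * δ)))) := by
    have hZ : ∑ S, subsetProb p S * ∑ x, (δ + Z S x ^ 2 / (4 * δ)) ≤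
        Fintype.card α * (δ + V / (4 * δ)) := by
      simp only [mul_sum]
      rw [sum_comm, ← nsmul_eq_mul, ← card_univ, ← sum_const]
      refine sum_le_sum fun x _ => ?_
      simp only [mul_add, sum_add_distrib, ← sum_mul, sum_subsetProb, one_mul, ← mul_div_assoc,
        ← sum_div]
      gcongr
      exact hdev x
    have hsplit : ∑ S, subsetProb p S * (∑ T, chosen S T - ∑ T, ∑ T' ∈ nbr T, clash S T T' +
        a * (∑ T, v S T - ∑ x, (δ + Z S x ^ 2 / (4 * δ)))) =
        ∑ S, subsetProb p S * ∑ T, chosen S T -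
        ∑ S, subsetProb p S * ∑ T, ∑ T' ∈ nbr T, clash S T T' +
        a * (∑ S, subsetProb p S * ∑ T, v S T -
          ∑ S, subsetProb p S * ∑ x, (δ + Z S x ^ 2 / (4 * δ))) := by
      rw [← sum_sub_distrib, ← sum_sub_distrib, mul_sum univ _ a, ← sum_add_distrib]
      exact sum_congr rfl fun S _ => by ring
    rw [hsplit, hchosen]
    have := mul_le_mul_of_nonneg_left (sub_le_sub hval hZ) ha
    linarith
  obtain ⟨S, hSp, hS⟩ := exists_le_of_le_sum_subsetProb hp _ hexpect
  obtain ⟨w', hw'0, hw'v, hw'd, hw'sum⟩ := exists_le_of_degree_excess B (v S) (hv0 S)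
  refine ⟨univ.filter fun T => Sum.inl T ∈ S ∧ ∀ T' ∈ nbr T, Sum.inl T' ∉ S, w',
    fun T hT hwT => ?_, fun T hT T' hT' hne => ?_, fun T hT => ?_, hw'0, fun T => ?_, hw'd, ?_⟩
  · exact hSp _ (mem_filter.1 hT).2.1 (by simp [hpdef, hwT])
  · by_contra hdis
    exact (mem_filter.1 hT).2.2 T' (mem_filter.2 ⟨mem_univ _, hne.symm, hdis⟩)
      (mem_filter.1 hT').2.1
  · have hv : v S T ≠ 0 := fun h => hT (le_antisymm (h ▸ hw'v T) (hw'0 T))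
    refine ⟨fun h => hv (by simp [v, h]), fun T' hT' => ?_⟩
    by_contra hdis
    refine hv ?_
    have hnd : ¬ Disjoint S (touching B' (B T)) :=
      not_disjoint_iff.2 ⟨Sum.inl T', (mem_filter.1 hT').2.1, by simpa [touching, hB'] using hdis⟩
    simp [v, survives, hnd]
  · refine (hw'v T).trans ((mul_le_of_le_one_right (div_nonneg (hw0 T) (by positivity))
      (hsurv1 _ _)).trans ?_)
    exact div_le_div_of_nonneg_right (hwη T) (by positivity)
  · have hcount : ∑ T, chosen S T - ∑ T, ∑ T' ∈ nbr T, clash S T T' ≤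
        ((univ.filter fun T => Sum.inl T ∈ S ∧ ∀ T' ∈ nbr T, Sum.inl T' ∉ S).card : ℝ) := by
      rw [← sum_sub_distrib, card_filter, Nat.cast_sum]
      refine sum_le_sum fun T _ => ?_
      have hclash0 : ∀ T' ∈ nbr T, 0 ≤ clash S T T' := fun T' _ => by
        simp only [clash]; split_ifs <;> norm_num
      have hsum0 := sum_nonneg hclash0
      by_cases hT : Sum.inl T ∈ S
      · by_cases hall : ∀ T' ∈ nbr T, Sum.inl T' ∉ S
        · rw [if_pos ⟨hT, hall⟩]
          simp only [chosen, singleton_subset_iff, hT, if_true, Nat.cast_one]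
          linarith
        · rw [if_neg fun h => hall h.2]
          push Not at hall
          obtain ⟨T', hT', hT'S⟩ := hall
          have h := single_le_sum hclash0 hT'
          have h' : clash S T T' = 1 := if_pos (by simp [insert_subset_iff, hT, hT'S])
          simp only [chosen, singleton_subset_iff, hT, if_true, Nat.cast_zero]
          linarith
      · rw [if_neg fun h => hT h.1]
        simp only [chosen, singleton_subset_iff, hT, if_false, Nat.cast_zero]
        linarith
    have hexcess : ∑ x, max 0 (∑ T with x ∈ B T, v S T - 1) ≤
        ∑ x, (δ + Z S x ^ 2 / (4 * δ)) := by
      refine sum_le_sum fun x _ => ?_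
      have hnn : 0 ≤ δ + Z S x ^ 2 / (4 * δ) := by positivity
      refine max_le hnn ?_
      have hZle : Z S x ≤ δ + Z S x ^ 2 / (4 * δ) := by
        rw [← sub_nonneg]
        have : δ + Z S x ^ 2 / (4 * δ) - Z S x = (Z S x - 2 * δ) ^ 2 / (4 * δ) := by
          field_simp
          ring
        rw [this]
        positivity
      by_cases hx : Disjoint S (touching B' {x})
      · refine le_trans ?_ hZle
        have : survives B' S {x} = 1 := if_pos hx
        simp only [Z, this, mul_one]
        linarith [hd x]
      · have h0 : survives B' S {x} = 0 := if_neg hx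
        have : ∑ T with x ∈ B T, v S T = 0 := sum_eq_zero fun T hT => by
          have h := survives_mul_survives B' S (B T) {x}
          rw [h0, mul_zero, union_eq_left.2 (singleton_subset_iff.2 (mem_filter.1 hT).2)] at h
          simp [v, ← h]
        linarith
    have hfin : ∑ T, v S T - ∑ x, (δ + Z S x ^ 2 / (4 * δ)) ≤ ∑ T, w' T := by linarith
    have := mul_le_mul_of_nonneg_left hfin ha
    linarith

/-- Spread fractional matchings in linear triple systems contain matchings of at least `a` times
their weight, up to an arbitrarily small proportion of the number of points. -/
def MatchingRate (a : ℝ) : Prop :=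
  ∀ ε : ℝ, 0 < ε → ∃ η : ℝ, 0 < η ∧ ∀ (ι α : Type) [Fintype ι] [DecidableEq ι] [Fintype α]
    [DecidableEq α] (B : ι → Finset α), (∀ T, (B T).card = 3) →
    (∀ T T', T ≠ T' → (B T ∩ B T').card ≤ 1) → ∀ w : ι → ℝ, (∀ T, 0 ≤ w T) → (∀ T, w T ≤ η) →
    (∀ x, ∑ T with x ∈ B T, w T ≤ 1) → ∃ M : Finset ι, (∀ T ∈ M, w T ≠ 0) ∧
      (∀ T ∈ M, ∀ T' ∈ M, T ≠ T' → Disjoint (B T) (B T')) ∧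
      a * ∑ T, w T - ε * Fintype.card α ≤ M.card

theorem matchingRate_zero : MatchingRate 0 := fun ε hε => ⟨1, one_pos, by
  intros
  refine ⟨∅, by simp, by simp, ?_⟩
  simp only [zero_mul, zero_sub, card_empty, Nat.cast_zero, Left.neg_nonpos_iff]
  positivity⟩

open Filter Topology in
theorem MatchingRate.step {a θ : ℝ} (h : MatchingRate a) (ha : 0 ≤ a) (hθ0 : 0 ≤ θ)
    (hθ1 : θ < 1) : MatchingRate (θ * (1 - 3 * θ) + (1 - θ) * a) := by
  intro ε hε
  obtain ⟨η₀, hη₀, hη₀'⟩ := h (ε / 2) (half_pos hε)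
  obtain ⟨δ, hδdef⟩ : ∃ δ, δ = ε / (4 * (a + 1)) := ⟨_, rfl⟩
  have hδ : 0 < δ := by rw [hδdef]; positivity
  have hθ : 0 < 1 - θ := sub_pos.2 hθ1
  have haδ : a * δ < ε / 2 := by
    rw [hδdef, mul_div_assoc', div_lt_div_iff₀ (by positivity) two_pos]
    nlinarith
  have h1 : ∀ᶠ η in 𝓝 (0 : ℝ), θ * η < 1 :=
    (show ContinuousAt (fun η : ℝ => θ * η) 0 by fun_prop).tendsto.eventually_lt_const (by simp)
  have h2 : ∀ᶠ η in 𝓝 (0 : ℝ), η / (1 - θ) ^ 2 < η₀ :=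
    (show ContinuousAt (fun η : ℝ => η / (1 - θ) ^ 2) 0 by fun_prop).tendsto.eventually_lt_const
      (by simpa using hη₀)
  have h3 : ∀ᶠ η in 𝓝 (0 : ℝ),
      a * (δ + (1 / (1 - θ * η) ^ 25 - 1 + η / (1 - θ) ^ 4) / (4 * δ)) < ε / 2 := by
    refine ContinuousAt.tendsto (f := fun η : ℝ => a * (δ + (1 / (1 - θ * η) ^ 25 - 1 +
      η / (1 - θ) ^ 4) / (4 * δ))) ?_ |>.eventually_lt_const (by simpa using haδ)
    have : (1 - θ * (0 : ℝ)) ^ 25 ≠ 0 := by simp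
    fun_prop (disch := assumption)
  obtain ⟨η, hη, hη0⟩ := (((h1.and (h2.and h3)).filter_mono nhdsWithin_le_nhds).and
    (self_mem_nhdsWithin (s := Set.Ioi (0 : ℝ)))).exists
  obtain ⟨hη1, hη2, hη3⟩ := hη
  refine ⟨η, hη0, ?_⟩
  intro ι α _ _ _ _ B hB hlin w hw0 hwη hd
  obtain ⟨M, w', hM, hMdis, hw', hw'0, hw'η, hw'd, hval⟩ :=
    nibble_step B hB hlin w hw0 (le_of_lt hη0) hwη hd hθ0 hθ1 hη1 ha hδ
  obtain ⟨M', hM', hM'dis, hM'card⟩ :=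
    hη₀' ι α B hB hlin w' hw'0 (fun T => (hw'η T).trans hη2.le) hw'd
  have hcross : ∀ T ∈ M, ∀ T' ∈ M', Disjoint (B T) (B T') := fun T hT T' hT' =>
    (hw' T' (hM' T' hT')).2 T hT
  have hMM' : Disjoint M M' := disjoint_left.2 fun T hT hT' => by
    have h0 := hB T
    rw [disjoint_self.1 (hcross T hT T hT')] at h0
    simp at h0
  refine ⟨M ∪ M', fun T hT => ?_, fun T hT T' hT' hne => ?_, ?_⟩
  · rcases mem_union.1 hT with hT | hT
    exacts [hM T hT, (hw' T (hM' T hT)).1]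
  · rcases mem_union.1 hT with hT | hT <;> rcases mem_union.1 hT' with hT' | hT'
    · exact hMdis T hT T' hT' hne
    · exact hcross T hT T' hT'
    · exact (hcross T' hT' T hT).symm
    · exact hM'dis T hT T' hT' hne
  · rw [card_union_of_disjoint hMM', Nat.cast_add]
    have := mul_le_mul_of_nonneg_left hη3.le (Nat.cast_nonneg (α := ℝ) (Fintype.card α))
    linarith

theorem matchingRate_iterate {θ : ℝ} (hθ0 : 0 ≤ θ) (hθ1 : 3 * θ < 1) (n : ℕ) :
    MatchingRate ((1 - 3 * θ) * (1 - (1 - θ) ^ n)) := by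
  induction n with
  | zero => simpa using matchingRate_zero
  | succ n ih =>
    have h0 : (1 - θ) ^ n ≤ 1 := pow_le_one₀ (by linarith) (by linarith)
    convert ih.step (mul_nonneg (by linarith) (sub_nonneg.2 h0)) hθ0 (by linarith) using 1
    ring

/-- A linear triple system with a spread fractional matching has a matching of almost the same
size. -/
theorem matchingRate_one : MatchingRate 1 := by
  intro ε hε
  obtain ⟨e, he, he0, he1⟩ : ∃ e, e ≤ ε ∧ 0 < e ∧ e ≤ 1 :=
    ⟨min ε 1, min_le_left _ _, lt_min hε one_pos, min_le_right _ _⟩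
  obtain ⟨n, hn⟩ := exists_pow_lt_of_lt_one (show 0 < e / 4 by positivity)
    (show 1 - e / 12 < 1 by linarith)
  obtain ⟨η, hη, h⟩ := matchingRate_iterate (θ := e / 12) (by positivity) (by linarith) n (e / 2)
    (by positivity)
  refine ⟨η, hη, ?_⟩
  intro ι α _ _ _ _ B hB hlin w hw0 hwη hd
  obtain ⟨M, hM, hdis, hcard⟩ := h ι α B hB hlin w hw0 hwη hd
  refine ⟨M, hM, hdis, le_trans ?_ hcard⟩
  have hw : 3 * ∑ T, w T ≤ Fintype.card α := by
    have h1 := sum_degree_mul B w fun _ => 1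
    simp only [mul_one, sum_const, hB, nsmul_eq_mul] at h1
    have h2 := sum_le_sum fun x (_ : x ∈ (univ : Finset α)) => hd x
    rw [h1, ← sum_mul] at h2
    simp only [sum_const, card_univ, nsmul_eq_mul, mul_one] at h2
    push_cast at h2
    linarith
  have hw' : 0 ≤ ∑ T, w T := sum_nonneg fun T _ => hw0 T
  have hp : 0 ≤ (1 - e / 12) ^ n := pow_nonneg (by linarith) n
  have hrate : 1 - e / 2 ≤ (1 - 3 * (e / 12)) * (1 - (1 - e / 12) ^ n) := by nlinarith
  nlinarith [mul_le_mul_of_nonneg_right hrate hw',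
    mul_le_mul_of_nonneg_right he (Nat.cast_nonneg (α := ℝ) (Fintype.card α))]

/-- Linear programming duality for fractional matchings with bounded weights. -/
theorem exists_fractional_matching {ι α : Type*} [Fintype ι] [Fintype α] [DecidableEq α]
    (B : ι → Finset α) {η c : ℝ} (hη : 0 ≤ η)
    (hc : ∀ y : α → ℝ, (∀ x, 0 ≤ y x) →
      c ≤ ∑ x, y x + η * ∑ T, max 0 (1 - ∑ x ∈ B T, y x)) :
    ∃ w : ι → ℝ, (∀ T, 0 ≤ w T) ∧ (∀ T, w T ≤ η) ∧ (∀ x, ∑ T with x ∈ B T, w T ≤ 1) ∧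
      c ≤ ∑ T, w T := by
  by_contra! hno
  let L : (ι → ℝ) →ₗ[ℝ] (α → ℝ) × ℝ :=
    { toFun := fun w => (fun x => ∑ T with x ∈ B T, w T, ∑ T, w T)
      map_add' := fun w w' => by
        ext <;> simp [sum_add_distrib]
      map_smul' := fun r w => by
        ext <;> simp [mul_sum] }
  have hL : Continuous L := LinearMap.continuous_of_finiteDimensional L
  set P : Set ((α → ℝ) × ℝ) := {u | u.1 ≤ 1 ∧ c ≤ u.2} with hP
  have hPconv : Convex ℝ P := (convex_Iic (𝕜 := ℝ) (1 : α → ℝ)).prod (convex_Ici (𝕜 := ℝ) c)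
  have hPclosed : IsClosed P := isClosed_Iic.prod isClosed_Ici
  have hdisj : Disjoint (L '' Set.Icc 0 fun _ => η) P := by
    rw [Set.disjoint_left]
    rintro _ ⟨w, ⟨hw0, hwη⟩, rfl⟩ ⟨hd, hle⟩
    exact absurd hle (not_le.2 (hno w hw0 hwη hd))
  obtain ⟨f, a, b, hfa, hab, hfb⟩ := geometric_hahn_banach_compact_closed
    ((convex_Icc _ _).linear_image L) (isCompact_Icc.image hL) hPconv hPclosed hdisj
  set y : α → ℝ := fun x => - f (Pi.single x 1, 0) with hy
  set s : ℝ := f (0, 1) with hs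
  have hf : ∀ u t, f (u, t) = s * t - ∑ x, y x * u x := fun u t => by
    have hu : (u, t) =
        ∑ x, u x • ((Pi.single x 1, 0) : (α → ℝ) × ℝ) + t • ((0, 1) : (α → ℝ) × ℝ) := by
      refine Prod.ext ?_ ?_
      · simp only [Prod.smul_mk, Prod.fst_add, Prod.fst_sum, smul_zero, add_zero]
        ext z
        simp [Pi.single_apply]
      · simp [Prod.snd_sum]
    rw [hu, map_add, map_sum]
    simp only [map_smul, smul_eq_mul, hy, neg_mul, sum_neg_distrib, sub_neg_eq_add]
    rw [add_comm, mul_comm t]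
    simp only [mul_comm (f _)]
    rw [mul_comm]
  have hbase : b < s * c - ∑ x, y x := by
    have := hfb (1, c) ⟨le_refl _, le_refl _⟩
    simpa [hf] using this
  have ha0 : 0 < a := by
    have := hfa (L 0) ⟨0, ⟨le_refl _, fun _ => hη⟩, rfl⟩
    simpa using this
  have hy0 : ∀ x, 0 ≤ y x := by
    intro x
    by_contra! hneg
    obtain ⟨t, ht0, ht⟩ : ∃ t : ℝ, 0 ≤ t ∧ s * c - ∑ x, y x + t * y x ≤ b :=
      ⟨(b - (s * c - ∑ x, y x)) / y x, div_nonneg_of_nonpos (by linarith) hneg.le, by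
        rw [div_mul_cancel₀ _ hneg.ne]; linarith⟩
    have := hfb (1 - Pi.single x t, c) ⟨by simpa using ht0, le_refl _⟩
    rw [hf] at this
    simp only [Pi.sub_apply, Pi.one_apply, mul_sub, mul_one, sum_sub_distrib, Pi.single_apply,
      mul_ite, mul_zero, sum_ite_eq', mem_univ, if_true] at this
    linarith
  have hs0 : 0 ≤ s := by
    by_contra! hneg
    obtain ⟨t, ht0, ht⟩ : ∃ t : ℝ, 0 ≤ t ∧ s * c - ∑ x, y x + t * s ≤ b :=
      ⟨(b - (s * c - ∑ x, y x)) / s, div_nonneg_of_nonpos (by linarith) hneg.le, by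
        rw [div_mul_cancel₀ _ hneg.ne]; linarith⟩
    have := hfb (1, c + t) ⟨le_refl _, by simpa using ht0⟩
    simp only [hf, Pi.one_apply, mul_one] at this
    linarith
  have hsum : 0 ≤ ∑ x, y x := sum_nonneg fun x _ => hy0 x
  have hspos : 0 < s := hs0.lt_of_ne fun h => by rw [← h] at hbase; linarith
  have hcs := hc (fun x => y x / s) fun x => div_nonneg (hy0 x) hs0
  let w : ι → ℝ := fun T => if ∑ x ∈ B T, y x / s ≤ 1 then η else 0
  have hw := hfa (L w) ⟨w, ⟨fun T => by simp only [w]; split_ifs <;> simp [hη],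
    fun T => by simp only [w]; split_ifs <;> simp [hη]⟩, rfl⟩
  have hLw : f (L w) = s * (η * ∑ T, max 0 (1 - ∑ x ∈ B T, y x / s)) := by
    change f (fun x => ∑ T with x ∈ B T, w T, ∑ T, w T) = _
    rw [hf]
    simp only [mul_comm (y _)]
    rw [sum_degree_mul, mul_sum, mul_sum, mul_sum, ← sum_sub_distrib]
    refine sum_congr rfl fun T _ => ?_
    have hyT : ∑ x ∈ B T, y x = s * ∑ x ∈ B T, y x / s := by
      rw [← sum_div, mul_div_cancel₀ _ hspos.ne']
    rw [hyT]
    simp only [w]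
    split_ifs with h
    · rw [max_eq_right (by linarith)]; ring
    · rw [max_eq_left (by linarith)]; ring
  rw [hLw] at hw
  rw [← sum_div] at hcs
  have := mul_le_mul_of_nonneg_left hcs hs0
  rw [mul_add, mul_div_cancel₀ _ hspos.ne'] at this
  linarith

open scoped BigOperators in
/-- Resampling one coordinate of a uniformly random function does not change expectations. -/
theorem expect_update {ι V : Type*} [Fintype ι] [DecidableEq ι] [Fintype V] [Nonempty V]
    (i : ι) (g : (ι → V) → ℝ) :
    𝔼 φ, 𝔼 v, g (Function.update φ i v) = 𝔼 φ, g φ := by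
  have hinv : Function.Involutive
      fun q : (ι → V) × V => (Function.update q.1 i q.2, q.1 i) := fun q => by simp
  calc 𝔼 φ, 𝔼 v, g (Function.update φ i v)
      = 𝔼 q : (ι → V) × V, g (Function.update q.1 i q.2) := by
        rw [← univ_product_univ, expect_product]
    _ = 𝔼 q : (ι → V) × V, g q.1 :=
        Fintype.expect_equiv hinv.toPerm _ _ fun q => rfl
    _ = 𝔼 φ, g φ := by
        rw [← univ_product_univ, expect_product]
        simp only [Fintype.expect_const]

open scoped BigOperators in
/-- Two distinct values of a uniformly random function are independent and uniform. -/
theorem expect_apply_two {ι V : Type*} [Fintype ι] [DecidableEq ι] [Fintype V] [Nonempty V]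
    {i j : ι} (hij : i ≠ j) (f : V → V → ℝ) :
    𝔼 φ : ι → V, f (φ i) (φ j) = 𝔼 u, 𝔼 v, f u v := by
  rw [← expect_update j, ← expect_update i]
  simp [Function.update_of_ne hij]

open scoped BigOperators in
/-- Three distinct values of a uniformly random function are independent and uniform. -/
theorem expect_apply_three {ι V : Type*} [Fintype ι] [DecidableEq ι] [Fintype V] [Nonempty V]
    {i j l : ι} (hij : i ≠ j) (hil : i ≠ l) (hjl : j ≠ l) (f : V → V → V → ℝ) :
    𝔼 φ : ι → V, f (φ i) (φ j) (φ l) = 𝔼 u, 𝔼 v, 𝔼 w, f u v w := by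
  rw [← expect_update l, ← expect_update j, ← expect_update i]
  simp [Function.update_of_ne hij, Function.update_of_ne hil, Function.update_of_ne hjl]

open scoped BigOperators in
/-- If a symmetric weighting of the edges of a graph is at most `2` on edges and exceeds `3` on a
triangle by at most `3 * z`, then its total weight is at most about `n ^ 2` plus the
total of `z`, normalized by sampling `k` vertices. -/
theorem expect_le_of_triangle_le {V : Type*} [Fintype V] [Nonempty V] (G : SimpleGraph V)
    (f : V → V → ℝ) (z : V → V → V → ℝ) (hsymm : ∀ u v, f u v = f v u)
    (hsupp : ∀ u v, ¬ G.Adj u v → f u v = 0) (htwo : ∀ u v, f u v ≤ 2)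
    (hz : ∀ u v w, 0 ≤ z u v w)
    (hzsupp : ∀ u v w, ¬ (G.Adj u v ∧ G.Adj v w ∧ G.Adj u w) → z u v w = 0)
    (hz₁ : ∀ u v w, z u v w = z v u w) (hz₂ : ∀ u v w, z u v w = z u w v)
    (htri : ∀ u v w, G.Adj u v → G.Adj v w → G.Adj u w →
      f u v + f v w + f u w ≤ 3 + 3 * z u v w) (k : ℕ) :
    k * (k - 1) * 𝔼 u, 𝔼 v, f u v ≤ k ^ 2 + k ^ 3 * 𝔼 u, 𝔼 v, 𝔼 w, z u v w := by
  have key : ∀ φ : Fin k → V, ∑ i, ∑ j, f (φ i) (φ j) ≤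
      k ^ 2 + ∑ i, ∑ j, ∑ l, z (φ i) (φ j) (φ l) := by
    intro φ
    have h := sum_le_card_sq_of_triangle_le (G.comap φ)
      (fun i j => f (φ i) (φ j) - ∑ l, z (φ i) (φ j) (φ l))
      (fun i j => by simp only [hsymm (φ i), hz₁ (φ i)])
      (fun i j hij => by
        have hij : ¬ G.Adj (φ i) (φ j) := hij
        simp only [hsupp _ _ hij]
        rw [sum_eq_zero fun l _ => hzsupp _ _ _ fun h => hij h.1, sub_zero])
      (fun i j => by
        have := sum_nonneg fun l (_ : l ∈ (univ : Finset (Fin k))) => hz (φ i) (φ j) (φ l)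
        linarith [htwo (φ i) (φ j)])
      (fun i j l hij hjl hil => by
        have h₁ := single_le_sum (fun m _ => hz (φ i) (φ j) (φ m)) (mem_univ l)
        have h₂ := single_le_sum (fun m _ => hz (φ j) (φ l) (φ m)) (mem_univ i)
        have h₃ := single_le_sum (fun m _ => hz (φ i) (φ l) (φ m)) (mem_univ j)
        have h₄ := htri _ _ _ hij hjl hil
        have h₅ : z (φ j) (φ l) (φ i) = z (φ i) (φ j) (φ l) := by rw [hz₂, hz₁]
        have h₆ : z (φ i) (φ l) (φ j) = z (φ i) (φ j) (φ l) := by rw [hz₂]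
        linarith)
    simp only [sum_sub_distrib, Fintype.card_fin] at h
    linarith
  have hself : ∀ u, f u u = 0 := fun u => hsupp u u G.irrefl
  set a := 𝔼 u, 𝔼 v, f u v with ha
  set b := 𝔼 u, 𝔼 v, 𝔼 w, z u v w with hb
  have hb0 : 0 ≤ b := expect_nonneg fun u _ => expect_nonneg fun v _ => expect_nonneg
    fun w _ => hz u v w
  have hf : 𝔼 φ : Fin k → V, ∑ i, ∑ j, f (φ i) (φ j) = k * (k - 1) * a := by
    have h : ∀ i j : Fin k, 𝔼 φ : Fin k → V, f (φ i) (φ j) = a - if i = j then a else 0 := by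
      intro i j
      split_ifs with hij
      · simp [hij, hself]
      · rw [sub_zero, expect_apply_two hij]
    simp only [expect_sum_comm, h, sum_sub_distrib, sum_const, sum_ite_eq, mem_univ, if_true,
      card_univ, Fintype.card_fin, nsmul_eq_mul]
    ring
  have hz' : 𝔼 φ : Fin k → V, ∑ i, ∑ j, ∑ l, z (φ i) (φ j) (φ l) ≤ k ^ 3 * b := by
    have h : ∀ i j l : Fin k, 𝔼 φ : Fin k → V, z (φ i) (φ j) (φ l) ≤ b := by
      intro i j l
      by_cases hd : i ≠ j ∧ i ≠ l ∧ j ≠ l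
      · rw [expect_apply_three hd.1 hd.2.1 hd.2.2]
      · refine (le_of_eq (expect_eq_zero fun φ _ => hzsupp _ _ _ ?_)).trans hb0
        rintro ⟨h₁, h₂, h₃⟩
        exact hd ⟨fun h => h₁.ne (by rw [h]), fun h => h₃.ne (by rw [h]),
          fun h => h₂.ne (by rw [h])⟩
    simp only [expect_sum_comm]
    calc _ ≤ ∑ _i : Fin k, ∑ _j : Fin k, ∑ _l : Fin k, b :=
          sum_le_sum fun i _ => sum_le_sum fun j _ => sum_le_sum fun l _ => h i j l
      _ = k ^ 3 * b := by simp; ring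
  have := expect_le_expect fun (φ : Fin k → V) (_ : φ ∈ univ) => key φ
  rw [expect_add_distrib, Fintype.expect_const, hf] at this
  linarith

/-- The pairs of distinct elements of a finite set. -/
def pairsIn {V : Type*} [DecidableEq V] (s : Finset V) : Finset (Sym2 V) :=
  s.offDiag.image Sym2.mk.uncurry

theorem mk_mem_pairsIn {V : Type*} [DecidableEq V] {s : Finset V} {u v : V} :
    s(u, v) ∈ pairsIn s ↔ u ∈ s ∧ v ∈ s ∧ u ≠ v := by
  simp only [pairsIn, mem_image, mem_offDiag, Prod.exists, Function.uncurry_apply_pair, Sym2.eq_iff]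
  constructor
  · rintro ⟨a, b, ⟨ha, hb, hab⟩, ⟨rfl, rfl⟩ | ⟨rfl, rfl⟩⟩
    exacts [⟨ha, hb, hab⟩, ⟨hb, ha, hab.symm⟩]
  · exact fun h => ⟨u, v, h, Or.inl ⟨rfl, rfl⟩⟩

theorem card_pairsIn {V : Type*} [DecidableEq V] (s : Finset V) :
    (pairsIn s).card = s.card.choose 2 := Sym2.card_image_offDiag s

theorem pairsIn_inter {V : Type*} [DecidableEq V] (s t : Finset V) :
    pairsIn s ∩ pairsIn t = pairsIn (s ∩ t) := by
  ext e
  induction e with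
  | _ u v => simp only [mem_inter, mk_mem_pairsIn]; tauto

theorem card_pairsIn_inter_le_one {V : Type*} [DecidableEq V] {s t : Finset V}
    (hs : s.card = 3) (ht : t.card = 3) (hne : s ≠ t) : (pairsIn s ∩ pairsIn t).card ≤ 1 := by
  have h : (s ∩ t).card ≤ 2 := by
    by_contra! h
    have h₁ := eq_of_subset_of_card_le (inter_subset_left : s ∩ t ⊆ s) (by omega)
    have h₂ := eq_of_subset_of_card_le (inter_subset_right : s ∩ t ⊆ t) (by omega)
    exact hne (h₁.symm.trans h₂)
  rw [pairsIn_inter, card_pairsIn]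
  exact Nat.choose_le_choose 2 h

theorem sum_pairsIn_triple {V : Type*} [DecidableEq V] {u v w : V} (huv : u ≠ v) (hvw : v ≠ w)
    (huw : u ≠ w) (y : Sym2 V → ℝ) :
    ∑ x ∈ pairsIn {u, v, w}, y x = y s(u, v) + y s(v, w) + y s(u, w) := by
  have h : pairsIn {u, v, w} = {s(u, v), s(v, w), s(u, w)} := by
    ext e
    induction e with
    | _ a b =>
      simp only [mk_mem_pairsIn, mem_insert, mem_singleton, Sym2.eq_iff]
      grind
  rw [h, sum_insert, sum_insert, sum_singleton, add_assoc]
  · simp only [mem_singleton, Sym2.eq_iff]; grind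
  · simp only [mem_insert, mem_singleton, Sym2.eq_iff]; grind

/-- If every fibre of `g` in `s` has at most `c` elements, summing `h ∘ g` over `s` costs at most
`c` times the sum of `h` over the image. -/
theorem sum_comp_le_of_card_fiber_le {κ τ : Type*} [DecidableEq τ] {s : Finset κ}
    {t : Finset τ} {g : κ → τ} (hg : ∀ a ∈ s, g a ∈ t) {h : τ → ℝ} (hh : ∀ b ∈ t, 0 ≤ h b) {c : ℕ}
    (hc : ∀ b ∈ t, (s.filter fun a => g a = b).card ≤ c) :
    ∑ a ∈ s, h (g a) ≤ c * ∑ b ∈ t, h b := by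
  rw [← sum_fiberwise_of_maps_to hg, mul_sum]
  refine sum_le_sum fun b hb => ?_
  rw [sum_congr rfl fun a ha => by rw [(mem_filter.1 ha).2], sum_const, nsmul_eq_mul]
  exact mul_le_mul_of_nonneg_right (Nat.cast_le.2 (hc b hb)) (hh b hb)

theorem sum_sum_sym2_le {V : Type*} [Fintype V] [DecidableEq V] (y : Sym2 V → ℝ)
    (hy : ∀ x, 0 ≤ y x) : ∑ u, ∑ v, y s(u, v) ≤ 2 * ∑ x, y x := by
  rw [← sum_product' univ univ fun u v => y s(u, v)]
  refine sum_comp_le_of_card_fiber_le (g := fun q : V × V => s(q.1, q.2)) (h := y)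
    (fun a _ => mem_univ _) (fun b _ => hy b) (c := 2) fun b _ => ?_
  induction b with
  | _ a b =>
    refine (card_le_card (t := {(a, b), (b, a)}) fun q hq => ?_).trans card_le_two
    simp only [mem_filter, Sym2.eq_iff] at hq
    simp only [mem_insert, mem_singleton, Prod.ext_iff]
    exact hq.2

theorem sum_triples_le {V : Type*} [Fintype V] [DecidableEq V] (p : V → V → V → Prop)
    [∀ u v w, Decidable (p u v w)] (t : Finset (Finset V)) (hp : ∀ u v w, p u v w → {u, v, w} ∈ t)
    (ht : ∀ T ∈ t, T.card = 3) (h : Finset V → ℝ) (hh : ∀ T ∈ t, 0 ≤ h T) :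
    ∑ u, ∑ v, ∑ w, (if p u v w then h {u, v, w} else 0) ≤ 27 * ∑ T ∈ t, h T := by
  have h₁ : ∑ u, ∑ v, ∑ w, (if p u v w then h {u, v, w} else 0) =
      ∑ q ∈ (univ : Finset (V × V × V)).filter (fun q => p q.1 q.2.1 q.2.2),
        h {q.1, q.2.1, q.2.2} := by
    rw [sum_filter, ← univ_product_univ, sum_product]
    refine sum_congr rfl fun u _ => ?_
    rw [← univ_product_univ, sum_product]
  rw [h₁]
  refine sum_comp_le_of_card_fiber_le (g := fun q : V × V × V => ({q.1, q.2.1, q.2.2} : Finset V))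
    (h := h) (fun q hq => hp _ _ _ (mem_filter.1 hq).2) hh (c := 27) fun T hT => ?_
  refine (card_le_card (t := T ×ˢ T ×ˢ T) fun q hq => ?_).trans (by simp [ht T hT])
  rw [mem_filter] at hq
  simp [← hq.2]

/-- Dual feasibility for the fractional triangle packing problem with capped weights. -/
theorem triangle_packing_dual_le {V : Type*} [Fintype V] [DecidableEq V] [Nonempty V]
    (G : SimpleGraph V) [DecidableRel G.Adj] {k : ℕ} (hk : 2 ≤ k) {η : ℝ}
    (hη : 27 * (k : ℝ) ^ 2 / ((k - 1) * Fintype.card V) ≤ 6 * η) (y : Sym2 V → ℝ)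
    (hy : ∀ x, 0 ≤ y x) :
    (4 * G.edgeFinset.card - (Fintype.card V : ℝ) ^ 2 * (k / (k - 1))) / 6 ≤
      ∑ x, y x + η * ∑ T : {T // T ∈ G.cliqueFinset 3}, max 0 (1 - ∑ x ∈ pairsIn T.1, y x) := by
  set ζ : Finset V → ℝ := fun T => max 0 (1 - ∑ x ∈ pairsIn T, y x) with hζ
  have hζ0 : ∀ T, 0 ≤ ζ T := fun T => le_max_left _ _
  set n : ℝ := (Fintype.card V : ℝ) with hn
  have hn0 : 0 < n := Nat.cast_pos.2 Fintype.card_pos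
  have hk1 : (0 : ℝ) < k - 1 := by
    have : (2 : ℝ) ≤ k := by exact_mod_cast hk
    linarith
  set f : V → V → ℝ := fun u v => if G.Adj u v then 2 - 3 * y s(u, v) else 0 with hf
  set z : V → V → V → ℝ := fun u v w =>
    if G.Adj u v ∧ G.Adj v w ∧ G.Adj u w then ζ {u, v, w} else 0 with hz
  have havg := expect_le_of_triangle_le G f z
    (fun u v => by simp only [hf, G.adj_comm u v, Sym2.eq_swap (a := u)])
    (fun u v h => if_neg h)
    (fun u v => by
      simp only [hf]
      split_ifs <;> linarith [hy s(u, v)])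
    (fun u v w => by
      simp only [hz]
      split_ifs
      exacts [hζ0 _, le_rfl])
    (fun u v w h => if_neg h)
    (fun u v w => by
      simp only [hz, G.adj_comm v u, Finset.insert_comm v u]
      congr 1
      simp only [eq_iff_iff]; tauto)
    (fun u v w => by
      simp only [hz, G.adj_comm w v, Finset.pair_comm w v]
      congr 1
      simp only [eq_iff_iff]; tauto)
    (fun u v w huv hvw huw => by
      simp only [hf, hz, hζ, if_pos huv, if_pos hvw, if_pos huw, huv, hvw, huw, and_self, if_true]
      rw [sum_pairsIn_triple huv.ne hvw.ne huw.ne]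
      linarith [le_max_right 0 (1 - (y s(u, v) + y s(v, w) + y s(u, w)))]) k
  have hfsum : 4 * G.edgeFinset.card - 6 * ∑ x, y x ≤ ∑ u, ∑ v, f u v := by
    have hdeg : ∑ u, ∑ v, (if G.Adj u v then (1 : ℝ) else 0) = 2 * G.edgeFinset.card := by
      have := G.sum_degrees_eq_twice_card_edges
      rw [← Nat.cast_inj (R := ℝ)] at this
      push_cast at this
      rw [← this]
      refine sum_congr rfl fun u _ => ?_
      rw [sum_boole, ← SimpleGraph.card_neighborFinset_eq_degree,
        SimpleGraph.neighborFinset_eq_filter]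
    have hle : ∑ u, ∑ v, (2 * (if G.Adj u v then (1 : ℝ) else 0) - 3 * y s(u, v)) ≤
        ∑ u, ∑ v, f u v := by
      refine sum_le_sum fun u _ => sum_le_sum fun v _ => ?_
      simp only [hf]
      split_ifs <;> linarith [hy s(u, v)]
    simp only [sum_sub_distrib, ← mul_sum] at hle
    linarith [sum_sum_sym2_le y hy]
  have hzsum : ∑ u, ∑ v, ∑ w, z u v w ≤ 27 * ∑ T ∈ G.cliqueFinset 3, ζ T :=
    sum_triples_le (fun u v w => G.Adj u v ∧ G.Adj v w ∧ G.Adj u w) _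
      (fun u v w h => by
        rw [SimpleGraph.mem_cliqueFinset_iff, SimpleGraph.is3Clique_triple_iff]
        exact ⟨h.1, h.2.2, h.2.1⟩)
      (fun T hT => (SimpleGraph.mem_cliqueFinset_iff.1 hT).card_eq) ζ fun T _ => hζ0 T
  simp only [Fintype.expect_eq_sum_div_card, ← sum_div, ← hn] at havg
  rw [sum_coe_sort (G.cliqueFinset 3) ζ]
  set F := ∑ u, ∑ v, f u v
  set Z := ∑ u, ∑ v, ∑ w, z u v w
  set S := ∑ T ∈ G.cliqueFinset 3, ζ T
  have hS : 0 ≤ S := sum_nonneg fun T _ => hζ0 T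
  have hk0 : (0 : ℝ) < k := by linarith
  have h₁ : F ≤ n ^ 2 * (k / (k - 1)) + k ^ 2 / ((k - 1) * n) * Z := by
    have h := mul_le_mul_of_nonneg_left havg (show 0 ≤ n ^ 2 / (k * (k - 1)) by positivity)
    calc F = n ^ 2 / (k * (k - 1)) * (k * (k - 1) * (F / n / n)) := by field_simp
      _ ≤ _ := h
      _ = _ := by field_simp
  have h₂ : k ^ 2 / ((k - 1) * n) * Z ≤ k ^ 2 / ((k - 1) * n) * (27 * S) :=
    mul_le_mul_of_nonneg_left hzsum (by positivity)
  have h₃ := mul_le_mul_of_nonneg_right hη hS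
  have h₄ : k ^ 2 / ((k - 1) * n) * (27 * S) = 27 * k ^ 2 / ((k - 1) * n) * S := by ring
  linarith

/-- Completing an edge-disjoint family of triangles by single edges gives a clique decomposition. -/
theorem exists_cliqueDecomp_of_triangles {V : Type*} [Fintype V] [DecidableEq V]
    (G : SimpleGraph V) [DecidableRel G.Adj] (M : Finset (Finset V))
    (hM : ∀ T ∈ M, G.IsNClique 3 T)
    (hdisj : ∀ T ∈ M, ∀ T' ∈ M, T ≠ T' → Disjoint (pairsIn T) (pairsIn T')) :
    ∃ (ℓ : ℕ) (D : Fin ℓ → Finset V), IsCliqueDecomp G D ∧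
      (∀ i, (D i).card = 2 ∨ (D i).card = 3) ∧
      ∑ i, ((D i).card : ℝ) ≤ 2 * G.edgeFinset.card - 3 * M.card := by
  set E := G.edgeFinset \ M.biUnion pairsIn with hE
  set F := M ∪ E.image Sym2.toFinset with hF
  have hpair : ∀ C ∈ E.image Sym2.toFinset, ∃ u v, G.Adj u v ∧ C = {u, v} ∧ s(u, v) ∈ E := by
    intro C hC
    obtain ⟨e, he, rfl⟩ := mem_image.1 hC
    induction e with
    | _ u v =>
      refine ⟨u, v, ?_, Sym2.toFinset_mk_eq, he⟩
      simpa using (mem_sdiff.1 he).1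
  have hclique : ∀ C ∈ F, G.IsClique (C : Set V) ∧ (C.card = 2 ∨ C.card = 3) := by
    intro C hC
    rcases mem_union.1 hC with hC | hC
    · exact ⟨(hM C hC).isClique, Or.inr (hM C hC).card_eq⟩
    · obtain ⟨u, v, huv, rfl, -⟩ := hpair C hC
      exact ⟨by simpa [SimpleGraph.isClique_pair] using fun _ => huv,
        Or.inl (card_pair huv.ne)⟩
  have hcover : ∀ u v, G.Adj u v → ∃! C, C ∈ F ∧ u ∈ C ∧ v ∈ C := by
    intro u v huv
    have hnot : ∀ C ∈ E.image Sym2.toFinset, u ∈ C → v ∈ C → C = {u, v} ∧ s(u, v) ∈ E := by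
      intro C hC hu hv
      obtain ⟨a, b, -, rfl, hab⟩ := hpair C hC
      simp only [mem_insert, mem_singleton] at hu hv
      have hne := huv.ne
      rcases hu with rfl | rfl <;> rcases hv with rfl | rfl
      · exact absurd rfl hne
      · exact ⟨rfl, hab⟩
      · exact ⟨pair_comm _ _, Sym2.eq_swap ▸ hab⟩
      · exact absurd rfl hne
    have hmem : ∀ T ∈ M, u ∈ T → v ∈ T → s(u, v) ∉ E := fun T hT hu hv h =>
      (mem_sdiff.1 h).2 (mem_biUnion.2 ⟨T, hT, mk_mem_pairsIn.2 ⟨hu, hv, huv.ne⟩⟩)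
    by_cases h : s(u, v) ∈ E
    · refine ⟨{u, v}, ⟨mem_union_right _ (mem_image.2 ⟨_, h, Sym2.toFinset_mk_eq⟩), by simp,
        by simp⟩, ?_⟩
      rintro C ⟨hC, hu, hv⟩
      rcases mem_union.1 hC with hC | hC
      · exact absurd h (hmem C hC hu hv)
      · exact (hnot C hC hu hv).1
    · have h' : s(u, v) ∈ M.biUnion pairsIn := by
        by_contra h'
        exact h (mem_sdiff.2 ⟨by simpa using huv, h'⟩)
      obtain ⟨T, hT, hTuv⟩ := mem_biUnion.1 h'
      have hTuv' := mk_mem_pairsIn.1 hTuv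
      refine ⟨T, ⟨mem_union_left _ hT, hTuv'.1, hTuv'.2.1⟩, ?_⟩
      rintro C ⟨hC, hu, hv⟩
      rcases mem_union.1 hC with hC | hC
      · by_contra hne
        exact disjoint_left.1 (hdisj C hC T hT hne) (mk_mem_pairsIn.2 ⟨hu, hv, huv.ne⟩) hTuv
      · exact absurd (hnot C hC hu hv).2 h
  refine ⟨F.card, fun i => (F.equivFin.symm i).1, ⟨fun i => ?_, fun u v huv => ?_⟩, fun i => ?_, ?_⟩
  · have h := hclique _ (F.equivFin.symm i).2
    exact ⟨h.1, by rcases h.2 with h | h <;> simp [h]⟩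
  · obtain ⟨C, ⟨hC, hCuv⟩, huniq⟩ := hcover u v huv
    refine ⟨F.equivFin ⟨C, hC⟩, by simpa using hCuv, fun i hi => ?_⟩
    rw [← Equiv.symm_apply_eq]
    exact Subtype.ext (huniq _ ⟨(F.equivFin.symm i).2, hi⟩)
  · exact (hclique _ (F.equivFin.symm i).2).2
  · rw [Equiv.sum_comp F.equivFin.symm fun C : F => (C.1.card : ℝ),
      sum_coe_sort F fun C => (C.card : ℝ)]
    have hcard : E.card + 3 * M.card = G.edgeFinset.card := by
      have hsub : M.biUnion pairsIn ⊆ G.edgeFinset := by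
        refine biUnion_subset.2 fun T hT e he => ?_
        induction e with
        | _ u v =>
          have h := mk_mem_pairsIn.1 he
          simpa using (hM T hT).isClique h.1 h.2.1 h.2.2
      have hbi : (M.biUnion pairsIn).card = 3 * M.card := by
        rw [card_biUnion hdisj, sum_congr rfl fun T hT => by
          rw [card_pairsIn, (hM T hT).card_eq], sum_const, smul_eq_mul, mul_comm]
        rfl
      rw [← hbi, hE, card_sdiff_add_card_eq_card hsub]
    have h₁ : ∑ C ∈ F, C.card ≤ 3 * M.card + 2 * E.card := by
      calc ∑ C ∈ F, C.card ≤ ∑ C ∈ M, C.card + ∑ C ∈ E.image Sym2.toFinset, C.card := by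
            rw [hF, ← sum_union_inter]
            exact Nat.le_add_right _ _
        _ ≤ 3 * M.card + 2 * E.card := by
            gcongr
            · rw [sum_congr rfl fun T hT => (hM T hT).card_eq, sum_const, smul_eq_mul, mul_comm]
            · refine (sum_le_card_nsmul _ _ 2 fun C hC => ?_).trans ?_
              · obtain ⟨u, v, -, rfl, -⟩ := hpair C hC
                exact card_le_two
              · rw [smul_eq_mul, mul_comm]
                exact Nat.mul_le_mul_left 2 card_image_le
    have h₂ : ((∑ C ∈ F, C.card : ℕ) : ℝ) ≤ 3 * M.card + 2 * E.card := by exact_mod_cast h₁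
    have h₃ : (E.card + 3 * M.card : ℝ) = G.edgeFinset.card := by exact_mod_cast hcard
    push_cast at h₂
    linarith

end

/-- For every `ε > 0` there exists `N` such that for every `n ≥ N`, the edges of every
graph `G` on `n` vertices can be decomposed into complete subgraphs of orders two and
three whose orders sum to at most `(1/2 + ε) n²`. -/
theorem edge_triangle_decomposition :
    ∀ ε : ℝ, 0 < ε → ∃ N : ℕ, ∀ n : ℕ, N ≤ n → ∀ G : SimpleGraph (Fin n),
      ∃ (ℓ : ℕ) (D : Fin ℓ → Finset (Fin n)),
        IsCliqueDecomp G D ∧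
        (∀ i, (D i).card = 2 ∨ (D i).card = 3) ∧
        (∑ i, ((D i).card : ℝ)) ≤ (1 / 2 + ε) * (n : ℝ) ^ 2 := by
  classical
  intro ε hε
  obtain ⟨η, hη, hmatch⟩ := matchingRate_one (ε / 6) (by positivity)
  obtain ⟨m, hm⟩ := exists_nat_gt (1 / ε)
  have hm0 : (0 : ℝ) < m := (by positivity : (0 : ℝ) < 1 / ε).trans hm
  have hm1 : 1 ≤ m := by exact_mod_cast hm0
  obtain ⟨N, hN⟩ := exists_nat_gt (27 * ((m + 1 : ℕ) : ℝ) ^ 2 / (m * (6 * η)))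
  have hN0 : (0 : ℝ) < N := lt_of_le_of_lt (by positivity) hN
  refine ⟨N, fun n hn G => ?_⟩
  have hn' : (N : ℝ) ≤ n := by exact_mod_cast hn
  have hn0 : (0 : ℝ) < n := hN0.trans_le hn'
  have : Nonempty (Fin n) := ⟨⟨0, by exact_mod_cast hn0⟩⟩
  have hkη : 27 * ((m + 1 : ℕ) : ℝ) ^ 2 / ((((m + 1 : ℕ) : ℝ) - 1) * Fintype.card (Fin n)) ≤
      6 * η := by
    rw [div_lt_iff₀ (by positivity)] at hN
    rw [Fintype.card_fin, Nat.cast_succ, add_sub_cancel_right, div_le_iff₀ (by positivity)]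
    rw [Nat.cast_succ] at hN
    have := mul_le_mul_of_nonneg_right hn' (show 0 ≤ m * (6 * η) by positivity)
    linarith
  obtain ⟨w, hw0, hwη, hwx, hw⟩ := exists_fractional_matching
    (fun T : {T // T ∈ G.cliqueFinset 3} => pairsIn T.1) hη.le
    (triangle_packing_dual_le G (by omega : 2 ≤ m + 1) hkη)
  have hclique : ∀ T : {T // T ∈ G.cliqueFinset 3}, G.IsNClique 3 T.1 := fun T =>
    SimpleGraph.mem_cliqueFinset_iff.1 T.2
  obtain ⟨M, -, hMdisj, hM⟩ := hmatch _ _ (fun T : {T // T ∈ G.cliqueFinset 3} => pairsIn T.1)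
    (fun T => by rw [card_pairsIn, (hclique T).card_eq]; rfl)
    (fun T T' h => card_pairsIn_inter_le_one (hclique T).card_eq (hclique T').card_eq
      fun h' => h (Subtype.ext h'))
    w hw0 hwη hwx
  obtain ⟨ℓ, D, hD, hDcard, hDsum⟩ := exists_cliqueDecomp_of_triangles G
    (M.map (Function.Embedding.subtype _))
    (fun T hT => by
      obtain ⟨T, -, rfl⟩ := Finset.mem_map.1 hT
      exact hclique T)
    (fun T hT T' hT' hne => by
      obtain ⟨T, hT₁, rfl⟩ := Finset.mem_map.1 hT
      obtain ⟨T', hT₂, rfl⟩ := Finset.mem_map.1 hT'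
      exact hMdisj T hT₁ T' hT₂ fun h => hne (by rw [h]))
  refine ⟨ℓ, D, hD, hDcard, hDsum.trans ?_⟩
  rw [Finset.card_map]
  have hα : (Fintype.card (Sym2 (Fin n)) : ℝ) ≤ n ^ 2 := by
    have h : Fintype.card (Sym2 (Fin n)) ≤ n ^ 2 := by
      refine (Fintype.card_le_of_surjective _ Sym2.mk_surjective).trans ?_
      simp [sq]
    exact_mod_cast h
  have hratio : (((m + 1 : ℕ) : ℝ) / (((m + 1 : ℕ) : ℝ) - 1)) ≤ 1 + ε := by
    rw [div_lt_iff₀ hε] at hm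
    rw [Nat.cast_succ, add_sub_cancel_right, div_le_iff₀ hm0]
    linarith
  have h₁ := mul_le_mul_of_nonneg_left hratio (sq_nonneg (n : ℝ))
  have h₂ := mul_le_mul_of_nonneg_left hα (show 0 ≤ ε / 6 by positivity)
  rw [Fintype.card_fin] at hw
  linarith
end

section
/- For every ε > 0 there exists N such that for every n ≥ N, every simple graph G on n vertices with at least n²/4 + k edges contains at least (2/3)·k − ε·n² pairwise edge-disjoint triangles. Equivalently, every n-vertex graph with n²/4 + k edges contains 2k/3 − o(n²) edge-disjoint triangles. -/
open Finset

/-- Mantel's induction for weighted pairs: deleting a heavy pair `a, b` costs at most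
`2 (#S - 1)`, up to the total defect of the triples through `a, b`. -/
theorem sum_pair_weight_le {V : Type*} [DecidableEq V] {g : V → V → ℝ} {t : V → V → V → ℝ}
    (hsymm : ∀ a b, g a b = g b a) (hdiag : ∀ a, g a a = 0) (hone : ∀ a b, g a b ≤ 1)
    (ht : ∀ a b c, 0 ≤ t a b c)
    (hgt : ∀ a b c, 1 / 2 ≤ g a b → g a c + g b c ≤ 1 + t a b c)
    {U : Finset V} {r K : ℝ} (hK : 0 < K)
    (htot : ∑ a ∈ U, ∑ b ∈ U, ∑ c ∈ U, t a b c ≤ K * r) (S : Finset V) (hS : S ⊆ U) :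
    ∑ a ∈ S, ∑ b ∈ S, g a b ≤ (#S : ℝ) ^ 2 / 2 + r / 2 + #S * K := by
  induction S using Finset.strongInduction with
  | H S ih =>
  by_cases hex : ∃ a ∈ S, ∃ b ∈ S, 1 / 2 ≤ g a b ∧ ∑ c ∈ U, t a b c ≤ K
  · obtain ⟨a, ha, b, hb, hab, hcost⟩ := hex
    have hne : a ≠ b := by
      rintro rfl
      rw [hdiag] at hab
      norm_num at hab
    obtain ⟨S', haS', hS'⟩ : ∃ S', a ∉ S' ∧ insert a S' = S :=
      ⟨S.erase a, notMem_erase a S, insert_erase ha⟩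
    have hbS' : b ∈ S' := by
      rw [← hS', mem_insert] at hb
      exact hb.resolve_left hne.symm
    obtain ⟨R, hbR, rfl⟩ : ∃ R, b ∉ R ∧ insert b R = S' :=
      ⟨S'.erase b, notMem_erase b S', insert_erase hbS'⟩
    subst hS'
    have haR : a ∉ R := fun h => haS' (mem_insert_of_mem h)
    have hRS : R ⊆ insert a (insert b R) := (subset_insert _ _).trans (subset_insert _ _)
    have hRU : R ⊆ U := hRS.trans hS
    have hRlt : R ⊂ insert a (insert b R) :=
      ⟨hRS, fun h => haR (h (mem_insert_self _ _))⟩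
    have hrec := ih R hRlt hRU
    have hpair : ∑ c ∈ R, (g a c + g b c) ≤ #R + K := by
      calc ∑ c ∈ R, (g a c + g b c) ≤ ∑ c ∈ R, (1 + t a b c) :=
            sum_le_sum fun c _ => hgt a b c hab
        _ = #R + ∑ c ∈ R, t a b c := by simp [sum_add_distrib]
        _ ≤ #R + ∑ c ∈ U, t a b c := by
            have := sum_le_sum_of_subset_of_nonneg hRU fun c _ _ => ht a b c
            linarith
        _ ≤ #R + K := by gcongr
    have hsplit : ∑ x ∈ insert a (insert b R), ∑ y ∈ insert a (insert b R), g x y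
        = 2 * g a b + 2 * ∑ c ∈ R, (g a c + g b c) + ∑ x ∈ R, ∑ y ∈ R, g x y := by
      have h1 : ∀ x, ∑ y ∈ insert a (insert b R), g x y = g x a + (g x b + ∑ y ∈ R, g x y) :=
        fun x => by rw [sum_insert haS', sum_insert hbR]
      simp only [h1]
      rw [sum_insert haS', sum_insert hbR]
      have ha' : ∑ x ∈ R, g x a = ∑ x ∈ R, g a x := sum_congr rfl fun x _ => hsymm x a
      have hb' : ∑ x ∈ R, g x b = ∑ x ∈ R, g b x := sum_congr rfl fun x _ => hsymm x b
      rw [sum_add_distrib, sum_add_distrib, sum_add_distrib, hdiag, hdiag, hsymm b a, ha', hb']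
      ring
    have hcard : #(insert a (insert b R)) = #R + 2 := by
      rw [card_insert_of_notMem haS', card_insert_of_notMem hbR]
    rw [hsplit, hcard]
    push_cast
    nlinarith [hone a b]
  · push Not at hex
    set H := (S ×ˢ S).filter fun p => 1 / 2 ≤ g p.1 p.2 with hH
    have hcount : (#H : ℝ) ≤ r := by
      refine le_of_mul_le_mul_left ?_ hK
      calc K * #H = ∑ p ∈ H, K := by simp [mul_comm]
        _ ≤ ∑ p ∈ H, ∑ c ∈ U, t p.1 p.2 c := by
            refine sum_le_sum fun p hp => ?_
            simp only [hH, mem_filter, mem_product] at hp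
            exact (hex p.1 hp.1.1 p.2 hp.1.2 hp.2).le
        _ ≤ ∑ p ∈ U ×ˢ U, ∑ c ∈ U, t p.1 p.2 c :=
            sum_le_sum_of_subset_of_nonneg
              ((filter_subset _ _).trans (product_subset_product hS hS))
              fun p _ _ => sum_nonneg fun c _ => ht _ _ _
        _ = ∑ a ∈ U, ∑ b ∈ U, ∑ c ∈ U, t a b c := sum_product _ _ _
        _ ≤ K * r := htot
    have hsum : ∑ a ∈ S, ∑ b ∈ S, g a b ≤ (#S : ℝ) ^ 2 / 2 + #H / 2 := by
      calc ∑ a ∈ S, ∑ b ∈ S, g a b = ∑ p ∈ S ×ˢ S, g p.1 p.2 :=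
            (sum_product S S fun p => g p.1 p.2).symm
        _ ≤ ∑ p ∈ S ×ˢ S, (1 / 2 + if 1 / 2 ≤ g p.1 p.2 then 1 / 2 else 0) := by
            refine sum_le_sum fun p _ => ?_
            split_ifs with h
            · linarith [hone p.1 p.2]
            · linarith
        _ = (#S : ℝ) ^ 2 / 2 + #H / 2 := by
            rw [sum_add_distrib, ← sum_filter, ← hH]
            simp [card_product]
            ring
    have : 0 ≤ (#S : ℝ) * K := by positivity
    linarith

theorem nonpos_of_forall_mul_le_sq {A C h₀ : ℝ} (hC : 0 ≤ C) (h₀pos : 0 < h₀)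
    (H : ∀ h, 0 ≤ h → h ≤ h₀ → h * A ≤ C * h ^ 2) : A ≤ 0 := by
  by_contra! hA
  have hC' : 0 < 2 * (C + 1) := by linarith
  set h := min h₀ (A / (2 * (C + 1))) with hh
  have hpos : 0 < h := lt_min h₀pos (by positivity)
  have h1 := H h hpos.le (min_le_left _ _)
  have h2 : h * (2 * (C + 1)) ≤ A := (le_div_iff₀ hC').1 (min_le_right _ _)
  have h3 : A ≤ C * h := by
    refine le_of_mul_le_mul_left ?_ hpos
    nlinarith
  nlinarith

/-- An approximate strong duality for fractional packings with weights bounded by `δ`. The packing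
maximises total weight minus a quadratic penalty for overloaded vertices, and the cover is the
gradient of the penalty. -/
theorem exists_bounded_packing_and_cover {ι α : Type*} [DecidableEq ι] [DecidableEq α]
    (E : Finset ι) (e : ι → Finset α) (X : Finset α) (he : ∀ i ∈ E, e i ⊆ X)
    {δ L : ℝ} (hδ : 0 < δ) (hL : 0 < L) :
    ∃ (w : ι → ℝ) (y : α → ℝ), (∀ i, 0 ≤ w i) ∧ (∀ i, w i ≤ δ) ∧ (∀ v, 0 ≤ y v) ∧
      (∀ v ∈ X, ∑ i ∈ E with v ∈ e i, w i ≤ 1 + 1 / L) ∧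
      ∑ v ∈ X, y v + δ * ∑ i ∈ E, max 0 (1 - ∑ v ∈ e i, y v) ≤ ∑ i ∈ E, w i := by
  let load (w : ι → ℝ) (v : α) : ℝ := ∑ i ∈ E with v ∈ e i, w i
  let J (w : ι → ℝ) : ℝ := ∑ i ∈ E, w i - L / 2 * ∑ v ∈ X, (max 0 (load w v - 1)) ^ 2
  have hJ : Continuous J := by
    simp only [J, load]
    fun_prop
  obtain ⟨w, hwmem, hwmax⟩ := (isCompact_univ_pi fun _ : ι => isCompact_Icc (a := (0 : ℝ))
    (b := δ)).exists_isMaxOn ⟨fun _ => 0, fun i _ => ⟨le_rfl, hδ.le⟩⟩ hJ.continuousOn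
  have hw0 : ∀ i, 0 ≤ w i := fun i => (hwmem i trivial).1
  have hwδ : ∀ i, w i ≤ δ := fun i => (hwmem i trivial).2
  let y (v : α) : ℝ := L * max 0 (load w v - 1)
  have hy0 : ∀ v, 0 ≤ y v := fun v => mul_nonneg hL.le (le_max_left _ _)
  have hvar : ∀ i ∈ E, ∀ h, 0 ≤ w i + h → w i + h ≤ δ →
      h * (1 - ∑ v ∈ e i, y v) ≤ (L / 2 * #(e i)) * h ^ 2 := by
    intro i hi h hlo hhi
    let w' := Function.update w i (w i + h)
    have hw' : w' ∈ Set.pi Set.univ fun _ : ι => Set.Icc (0 : ℝ) δ := by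
      intro j _
      by_cases hj : j = i
      · subst hj
        simpa [w'] using ⟨hlo, hhi⟩
      · simpa [w', Function.update_of_ne hj] using hwmem j trivial
    have hw'eq : ∀ j, w' j = w j + if j = i then h else 0 := by
      intro j
      by_cases hj : j = i
      · subst hj
        simp [w']
      · simp [w', hj]
    have hmax : J w' ≤ J w := hwmax hw'
    have hsum : ∑ j ∈ E, w' j = ∑ j ∈ E, w j + h := by
      simp [hw'eq, sum_add_distrib, hi]
    have hload : ∀ v, load w' v = load w v + if v ∈ e i then h else 0 := by
      intro v
      simp only [load, hw'eq, sum_add_distrib]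
      congr 1
      rw [sum_ite_eq']
      simp [hi]
    have hpen : ∑ v ∈ X, (max 0 (load w' v - 1)) ^ 2 ≤ ∑ v ∈ X, (max 0 (load w v - 1)) ^ 2
        + ∑ v ∈ e i, (2 * max 0 (load w v - 1) * h + h ^ 2) := by
      rw [← inter_eq_right.2 (he i hi), ← filter_mem_eq_inter, sum_filter, ← sum_add_distrib]
      refine sum_le_sum fun v _ => ?_
      rw [hload]
      split_ifs with hv
      · have h1 : max 0 (load w v + h - 1) ≤ |max 0 (load w v - 1) + h| := by
          refine max_le (abs_nonneg _) (le_trans ?_ (le_abs_self _))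
          linarith [le_max_right 0 (load w v - 1)]
        have h2 := pow_le_pow_left₀ (le_max_left _ _) h1 2
        rw [sq_abs] at h2
        linarith
      · simp
    have hexp : ∑ v ∈ e i, (2 * max 0 (load w v - 1) * h + h ^ 2)
        = 2 / L * (h * ∑ v ∈ e i, y v) + #(e i) * h ^ 2 := by
      rw [sum_add_distrib, mul_sum, mul_sum]
      congr 1
      · refine sum_congr rfl fun v _ => ?_
        simp only [y]
        field_simp
      · simp
    rw [hexp] at hpen
    simp only [J, hsum] at hmax
    have := mul_le_mul_of_nonneg_left hpen (by positivity : 0 ≤ L / 2)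
    have hc : L / 2 * (2 / L * (h * ∑ v ∈ e i, y v)) = h * ∑ v ∈ e i, y v := by
      field_simp
    rw [mul_add, mul_add, hc] at this
    linarith
  have hlt : ∀ i ∈ E, w i < δ → 1 ≤ ∑ v ∈ e i, y v := by
    intro i hi hlt
    have := nonpos_of_forall_mul_le_sq (A := 1 - ∑ v ∈ e i, y v) (C := L / 2 * #(e i))
      (by positivity) (sub_pos.2 hlt) fun h h0 h1 =>
        hvar i hi h (by linarith [hw0 i]) (by linarith)
    linarith
  have hpos : ∀ i ∈ E, 0 < w i → ∑ v ∈ e i, y v ≤ 1 := by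
    intro i hi hlt
    have := nonpos_of_forall_mul_le_sq (A := ∑ v ∈ e i, y v - 1) (C := L / 2 * #(e i))
      (by positivity) hlt fun h h0 h1 => by
        have := hvar i hi (-h) (by linarith) (by linarith [hwδ i])
        nlinarith
    linarith
  refine ⟨w, y, hw0, hwδ, hy0, ?_, ?_⟩
  · intro v _
    by_contra! hv
    have hL' : 0 < 1 / L := by positivity
    obtain ⟨i, hi, hwi⟩ : ∃ i ∈ E.filter (v ∈ e ·), 0 < w i := by
      by_contra! hno
      linarith [sum_nonpos hno]
    rw [mem_filter] at hi
    have h1 : y v ≤ 1 := (single_le_sum (fun u _ => hy0 u) hi.2).trans (hpos i hi.1 hwi)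
    have h2 : L * (1 / L) < L * max 0 (load w v - 1) := by
      gcongr
      refine lt_of_lt_of_le ?_ (le_max_right _ _)
      change 1 + 1 / L < load w v at hv
      linarith
    rw [mul_one_div_cancel hL.ne'] at h2
    exact absurd h1 (not_le.2 h2)
  · have hswap : ∑ i ∈ E, w i * ∑ v ∈ e i, y v = ∑ v ∈ X, y v * load w v := by
      simp only [load, mul_sum]
      rw [sum_comm' (t' := X) (s' := fun v => E.filter (v ∈ e ·))]
      · exact sum_congr rfl fun v _ => sum_congr rfl fun i _ => mul_comm _ _
      · intro i v
        simp only [mem_filter]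
        exact ⟨fun h => ⟨h, he i h.1 h.2⟩, fun h => h.1⟩
    have h1 : ∑ v ∈ X, y v ≤ ∑ v ∈ X, y v * load w v := by
      refine sum_le_sum fun v _ => ?_
      rcases le_total (load w v) 1 with h | h
      · simp [y, max_eq_left (sub_nonpos.2 h)]
      · exact le_mul_of_one_le_right (hy0 v) h
    have h2 : ∀ i ∈ E, w i * ∑ v ∈ e i, y v + δ * max 0 (1 - ∑ v ∈ e i, y v) ≤ w i := by
      intro i hi
      rcases lt_or_ge (∑ v ∈ e i, y v) 1 with h | h
      · have : w i = δ := le_antisymm (hwδ i) (not_lt.1 fun hl => absurd (hlt i hi hl) (not_le.2 h))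
        rw [max_eq_right (by linarith), this]
        linarith
      · rw [max_eq_left (by linarith)]
        rcases (hw0 i).eq_or_lt with h0 | h0
        · simp [← h0]
        · rw [le_antisymm (hpos i hi h0) h]
          simp
    have h3 := sum_le_sum h2
    rw [sum_add_distrib, ← mul_sum, hswap] at h3
    linarith

/-- The expectation of `f A`, where `A ⊆ E` contains each `i ∈ E` independently with
probability `p i`. -/
def bernoulliMean {ι : Type*} [DecidableEq ι] (p : ι → ℝ) (E : Finset ι) (f : Finset ι → ℝ) : ℝ :=
  ∑ A ∈ E.powerset, ((∏ i ∈ A, p i) * ∏ i ∈ E \ A, (1 - p i)) * f A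

section BernoulliMean

variable {ι κ : Type*} [DecidableEq ι] {p : ι → ℝ} {E : Finset ι} {f g : Finset ι → ℝ}

theorem bernoulliMean_const (c : ℝ) : bernoulliMean p E (fun _ => c) = c := by
  rw [bernoulliMean, ← sum_mul, ← prod_add]
  simp

theorem bernoulliMean_add :
    bernoulliMean p E (fun A => f A + g A) = bernoulliMean p E f + bernoulliMean p E g := by
  simp only [bernoulliMean, mul_add, sum_add_distrib]

theorem bernoulliMean_const_mul (c : ℝ) :
    bernoulliMean p E (fun A => c * f A) = c * bernoulliMean p E f := by
  simp only [bernoulliMean, mul_sum]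
  exact sum_congr rfl fun A _ => by ring

theorem bernoulliMean_sum (s : Finset κ) (F : κ → Finset ι → ℝ) :
    bernoulliMean p E (fun A => ∑ k ∈ s, F k A) = ∑ k ∈ s, bernoulliMean p E (F k) := by
  simp only [bernoulliMean, mul_sum]
  exact sum_comm

theorem bernoulliMean_mono (hp0 : ∀ i, 0 ≤ p i) (hp1 : ∀ i, p i ≤ 1)
    (h : ∀ A ⊆ E, f A ≤ g A) : bernoulliMean p E f ≤ bernoulliMean p E g :=
  sum_le_sum fun A hA => mul_le_mul_of_nonneg_left (h A (mem_powerset.1 hA))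
    (mul_nonneg (prod_nonneg fun i _ => hp0 i) (prod_nonneg fun i _ => sub_nonneg.2 (hp1 i)))

theorem exists_bernoulliMean_le (hp0 : ∀ i, 0 ≤ p i) (hp1 : ∀ i, p i ≤ 1) :
    ∃ A ⊆ E, bernoulliMean p E f ≤ f A := by
  obtain ⟨A, hA, hmax⟩ := exists_max_image E.powerset f ⟨∅, empty_mem_powerset E⟩
  refine ⟨A, mem_powerset.1 hA, ?_⟩
  calc bernoulliMean p E f ≤ bernoulliMean p E fun _ => f A :=
        bernoulliMean_mono hp0 hp1 fun B hB => hmax B (mem_powerset.2 hB)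
    _ = f A := bernoulliMean_const _

theorem bernoulliMean_indicator {B C : Finset ι} (hB : B ⊆ E) (hC : C ⊆ E) (hBC : Disjoint B C) :
    bernoulliMean p E (fun A => if B ⊆ A ∧ Disjoint C A then 1 else 0)
      = (∏ i ∈ B, p i) * ∏ i ∈ C, (1 - p i) := by
  have h1 : ∀ A ∈ E.powerset,
      ((∏ i ∈ A, p i) * ∏ i ∈ E \ A, (1 - p i)) * (if B ⊆ A ∧ Disjoint C A then 1 else 0)
        = (∏ i ∈ A, if i ∈ C then 0 else p i) * ∏ i ∈ E \ A, if i ∈ B then 0 else 1 - p i := by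
    intro A hA
    split_ifs with h
    · rw [mul_one]
      congr 1
      · refine prod_congr rfl fun i hi => ?_
        rw [if_neg fun hiC => disjoint_left.1 h.2 hiC hi]
      · refine prod_congr rfl fun i hi => ?_
        rw [if_neg fun hiB => (mem_sdiff.1 hi).2 (h.1 hiB)]
    · rw [mul_zero, eq_comm, mul_eq_zero]
      rw [not_and_or] at h
      rcases h with h | h
      · obtain ⟨i, hiB, hiA⟩ := not_subset.1 h
        exact Or.inr (prod_eq_zero (mem_sdiff.2 ⟨hB hiB, hiA⟩) (if_pos hiB))
      · obtain ⟨i, hiC, hiA⟩ := not_disjoint_iff.1 h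
        exact Or.inl (prod_eq_zero hiA (if_pos hiC))
  rw [bernoulliMean, sum_congr rfl h1, ← prod_add]
  have h2 : ∀ i ∈ E, ((if i ∈ C then 0 else p i) + if i ∈ B then 0 else 1 - p i)
      = (if i ∈ B then p i else 1) * if i ∈ C then 1 - p i else 1 := by
    intro i _
    by_cases hiB : i ∈ B
    · have : i ∉ C := disjoint_left.1 hBC hiB
      simp [hiB, this]
    · by_cases hiC : i ∈ C <;> simp [hiB, hiC]
  rw [prod_congr rfl h2, prod_mul_distrib, prod_ite_mem, prod_ite_mem, inter_eq_right.2 hB,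
    inter_eq_right.2 hC]

end BernoulliMean

/-- The probability that no selected member of the hypergraph meets `U`. -/
def avoidProb {ι α : Type*} [DecidableEq α] (p : ι → ℝ) (E : Finset ι) (e : ι → Finset α)
    (U : Finset α) : ℝ :=
  ∏ i ∈ E with ¬Disjoint (e i) U, (1 - p i)

section AvoidProb

variable {ι α : Type*} [DecidableEq α] {p : ι → ℝ} {E : Finset ι}
  {e : ι → Finset α}

theorem avoidProb_nonneg (hp1 : ∀ i, p i ≤ 1) (U : Finset α) : 0 ≤ avoidProb p E e U :=
  prod_nonneg fun i _ => sub_nonneg.2 (hp1 i)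

theorem avoidProb_le_one (hp0 : ∀ i, 0 ≤ p i) (hp1 : ∀ i, p i ≤ 1) (U : Finset α) :
    avoidProb p E e U ≤ 1 :=
  prod_le_one (fun i _ => sub_nonneg.2 (hp1 i)) fun i _ => by linarith [hp0 i]

variable [DecidableEq ι]

theorem bernoulliMean_avoid (U : Finset α) :
    bernoulliMean p E (fun A => if ∀ i ∈ A, Disjoint (e i) U then 1 else 0)
      = avoidProb p E e U := by
  have h := bernoulliMean_indicator (p := p) (E := E) (empty_subset E)
    (filter_subset (fun i => ¬Disjoint (e i) U) E) (disjoint_empty_left _)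
  rw [prod_empty, one_mul] at h
  rw [avoidProb, ← h]
  refine sum_congr rfl fun A hA => ?_
  have : (∀ i ∈ A, Disjoint (e i) U) ↔
      (∅ ⊆ A ∧ Disjoint (E.filter fun i => ¬Disjoint (e i) U) A) := by
    simp only [empty_subset, true_and, disjoint_right, mem_filter, not_and, not_not]
    exact ⟨fun h i hi _ => h i hi, fun h i hi => h hi (mem_powerset.1 hA hi)⟩
  simp only [this]

theorem avoidProb_insert (u : α) (U : Finset α) :
    avoidProb p E e (insert u U) = avoidProb p E e U *
      ∏ i ∈ E with u ∈ e i ∧ Disjoint (e i) U, (1 - p i) := by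
  rw [avoidProb, avoidProb, ← prod_union]
  · congr 1
    ext i
    simp only [mem_filter, mem_union, disjoint_insert_right]
    tauto
  · rw [disjoint_filter]
    tauto

theorem avoidProb_singleton (u : α) :
    avoidProb p E e {u} = (∏ i ∈ E with u ∈ e i ∧ Disjoint (e i) U, (1 - p i)) *
      ∏ i ∈ E with u ∈ e i ∧ ¬Disjoint (e i) U, (1 - p i) := by
  rw [avoidProb, ← prod_union]
  · congr 1
    ext i
    simp only [mem_filter, mem_union, disjoint_singleton_right, not_not]
    tauto
  · rw [disjoint_filter]
    tauto

theorem prod_avoidProb_singleton_le (hp0 : ∀ i, 0 ≤ p i) (hp1 : ∀ i, p i ≤ 1) (U : Finset α) :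
    ∏ u ∈ U, avoidProb p E e {u} ≤ avoidProb p E e U := by
  induction U using Finset.induction_on with
  | empty => simp [avoidProb]
  | insert u U hu ih =>
    rw [prod_insert hu, avoidProb_insert, mul_comm, avoidProb_singleton (U := U)]
    refine mul_le_mul ih ?_ (mul_nonneg ?_ ?_) (avoidProb_nonneg hp1 U)
    · exact mul_le_of_le_one_right (prod_nonneg fun i _ => sub_nonneg.2 (hp1 i))
        (prod_le_one (fun i _ => sub_nonneg.2 (hp1 i)) fun i _ => by linarith [hp0 i])
    all_goals exact prod_nonneg fun i _ => sub_nonneg.2 (hp1 i)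

theorem avoidProb_mul_le_prod {β : ℝ} (hβ0 : 0 ≤ β) (hβ1 : β ≤ 1) (hpβ : ∀ i, p i ≤ β)
    (hlin : ∀ i ∈ E, ∀ j ∈ E, i ≠ j → #(e i ∩ e j) ≤ 1) (m : ℕ) (U : Finset α) (hU : #U ≤ m) :
    avoidProb p E e U * ((1 - β) ^ m) ^ #U ≤ ∏ u ∈ U, avoidProb p E e {u} := by
  have hp1 : ∀ i, p i ≤ 1 := fun i => (hpβ i).trans hβ1
  have h1β : 0 ≤ 1 - β := sub_nonneg.2 hβ1
  induction U using Finset.induction_on with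
  | empty => simp [avoidProb]
  | insert u U hu ih =>
    rw [card_insert_of_notMem hu] at hU
    have ih' := ih (by omega)
    rw [prod_insert hu, avoidProb_insert, avoidProb_singleton (U := U), card_insert_of_notMem hu,
      pow_succ]
    set a := ∏ i ∈ E with u ∈ e i ∧ Disjoint (e i) U, (1 - p i)
    have ha : 0 ≤ a := prod_nonneg fun i _ => sub_nonneg.2 (hp1 i)
    have hcard : #(E.filter fun i => u ∈ e i ∧ ¬Disjoint (e i) U) ≤ m := by
      have hsub : (E.filter fun i => u ∈ e i ∧ ¬Disjoint (e i) U)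
          ⊆ U.biUnion fun x => E.filter fun i => u ∈ e i ∧ x ∈ e i := by
        intro i hi
        rw [mem_filter] at hi
        obtain ⟨x, hx, hxU⟩ := not_disjoint_iff.1 hi.2.2
        exact mem_biUnion.2 ⟨x, hxU, mem_filter.2 ⟨hi.1, hi.2.1, hx⟩⟩
      refine (card_le_card hsub).trans ((card_biUnion_le_card_mul _ _ 1 ?_).trans (by omega))
      intro x hx
      refine card_le_one.2 fun i hi j hj => ?_
      rw [mem_filter] at hi hj
      by_contra hij
      have := card_le_one.1 (hlin i hi.1 j hj.1 hij) u (mem_inter.2 ⟨hi.2.1, hj.2.1⟩) x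
        (mem_inter.2 ⟨hi.2.2, hj.2.2⟩)
      exact hu (this ▸ hx)
    have hb : (1 - β) ^ m ≤ ∏ i ∈ E with u ∈ e i ∧ ¬Disjoint (e i) U, (1 - p i) := by
      calc (1 - β) ^ m ≤ (1 - β) ^ #(E.filter fun i => u ∈ e i ∧ ¬Disjoint (e i) U) := by
            exact pow_le_pow_of_le_one h1β (by linarith) hcard
        _ = ∏ i ∈ E with u ∈ e i ∧ ¬Disjoint (e i) U, (1 - β) := by simp
        _ ≤ _ := prod_le_prod (fun _ _ => h1β) fun i _ => by linarith [hpβ i]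
    calc avoidProb p E e U * a * (((1 - β) ^ m) ^ #U * (1 - β) ^ m)
        = a * (1 - β) ^ m * (avoidProb p E e U * ((1 - β) ^ m) ^ #U) := by ring
      _ ≤ a * (∏ i ∈ E with u ∈ e i ∧ ¬Disjoint (e i) U, (1 - p i)) *
          ∏ u ∈ U, avoidProb p E e {u} := by
        refine mul_le_mul (mul_le_mul_of_nonneg_left hb ha) ih'
          (mul_nonneg (avoidProb_nonneg hp1 U) (by positivity)) (mul_nonneg ha ?_)
        exact prod_nonneg fun i _ => sub_nonneg.2 (hp1 i)

/-- The probability that `i` is selected and no other selected member meets it. -/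
theorem le_bernoulliMean_isolated (hp0 : ∀ i, 0 ≤ p i) (hp1 : ∀ i, p i ≤ 1) {i : ι} (hi : i ∈ E) :
    p i * avoidProb p E e (e i) ≤
      bernoulliMean p E (fun A => if i ∈ A ∧ ∀ j ∈ A, j ≠ i → Disjoint (e j) (e i)
        then 1 else 0) := by
  set C := E.filter fun j => j ≠ i ∧ ¬Disjoint (e j) (e i) with hC
  have h := bernoulliMean_indicator (p := p) (E := E) (B := {i}) (C := C)
    (singleton_subset_iff.2 hi) (filter_subset _ _) (by simp [hC])
  rw [prod_singleton] at h
  have heq : bernoulliMean p E (fun A => if i ∈ A ∧ ∀ j ∈ A, j ≠ i → Disjoint (e j) (e i)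
        then 1 else 0) = bernoulliMean p E (fun A => if {i} ⊆ A ∧ Disjoint C A then 1 else 0) := by
    refine sum_congr rfl fun A hA => ?_
    have : (i ∈ A ∧ ∀ j ∈ A, j ≠ i → Disjoint (e j) (e i)) ↔ ({i} ⊆ A ∧ Disjoint C A) := by
      simp only [singleton_subset_iff, disjoint_right, hC, mem_filter, not_and, not_not]
      exact and_congr_right fun _ =>
        ⟨fun h j hj _ => h j hj, fun h j hj => h hj (mem_powerset.1 hA hj)⟩
    simp only [this]
  rw [heq, h]
  refine mul_le_mul_of_nonneg_left ?_ (hp0 i)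
  exact prod_le_prod_of_subset_of_le_one (monotone_filter_right E fun j _ hj => hj.2)
    (fun j _ => sub_nonneg.2 (hp1 j)) fun j _ _ => by linarith [hp0 j]

theorem one_sub_sum_le_avoidProb_singleton (hp0 : ∀ i, 0 ≤ p i) (hp1 : ∀ i, p i ≤ 1) (v : α) :
    1 - ∑ i ∈ E with v ∈ e i, p i ≤ avoidProb p E e {v} := by
  rw [avoidProb]
  simp only [disjoint_singleton_right, not_not]
  induction E.filter (v ∈ e ·) using Finset.induction_on with
  | empty => simp
  | insert i s hi ih =>
    rw [sum_insert hi, prod_insert hi]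
    have h1 : ∏ j ∈ s, (1 - p j) ≤ 1 :=
      prod_le_one (fun j _ => sub_nonneg.2 (hp1 j)) fun j _ => by linarith [hp0 j]
    nlinarith [hp0 i]

end AvoidProb

/-- Chebyshev-type bound for the weight of the pairs `B k` that avoid all selected members. -/
theorem bernoulliMean_sq_sub_le {ι α κ : Type*} [DecidableEq ι] [DecidableEq α] [DecidableEq κ]
    {p : ι → ℝ} {E : Finset ι} {e : ι → Finset α} {β : ℝ} (hβ0 : 0 ≤ β) (hβ1 : β ≤ 1)
    (hp0 : ∀ i, 0 ≤ p i) (hpβ : ∀ i, p i ≤ β)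
    (hlin : ∀ i ∈ E, ∀ j ∈ E, i ≠ j → #(e i ∩ e j) ≤ 1)
    {S : Finset κ} {B : κ → Finset α} {a : κ → ℝ} (ha : ∀ k, 0 ≤ a k) (hB : ∀ k ∈ S, #(B k) = 2)
    (hdisj : ∀ k ∈ S, ∀ l ∈ S, k ≠ l → Disjoint (B k) (B l))
    {m : ℝ} (hm : m = ∑ k ∈ S, a k * ∏ u ∈ B k, avoidProb p E e {u}) :
    (1 - β) ^ 16 * bernoulliMean p E (fun A =>
        (∑ k ∈ S, a k * (if ∀ i ∈ A, Disjoint (e i) (B k) then 1 else 0) - m) ^ 2)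
      ≤ m ^ 2 * (1 - (1 - β) ^ 16) + ∑ k ∈ S, a k ^ 2 := by
  have hp1 : ∀ i, p i ≤ 1 := fun i => (hpβ i).trans hβ1
  have hρ0 : 0 ≤ (1 - β) ^ 16 := pow_nonneg (sub_nonneg.2 hβ1) _
  have hρ1 : (1 - β) ^ 16 ≤ 1 := pow_le_one₀ (sub_nonneg.2 hβ1) (by linarith)
  obtain ⟨ρ, hρ⟩ : ∃ ρ, ρ = (1 - β) ^ 16 := ⟨_, rfl⟩
  rw [← hρ] at hρ0 hρ1 ⊢
  have hm0 : 0 ≤ m := by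
    rw [hm]
    exact sum_nonneg fun k _ => mul_nonneg (ha k) (prod_nonneg fun u _ => avoidProb_nonneg hp1 _)
  have hexp : bernoulliMean p E (fun A =>
        (∑ k ∈ S, a k * (if ∀ i ∈ A, Disjoint (e i) (B k) then 1 else 0) - m) ^ 2)
      = ∑ k ∈ S, ∑ l ∈ S, a k * a l * avoidProb p E e (B k ∪ B l)
        + -2 * m * ∑ k ∈ S, a k * avoidProb p E e (B k) + m ^ 2 := by
    have h1 : ∀ A : Finset ι,
        (∑ k ∈ S, a k * (if ∀ i ∈ A, Disjoint (e i) (B k) then (1 : ℝ) else 0) - m) ^ 2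
        = ∑ k ∈ S, ∑ l ∈ S, a k * a l * (if ∀ i ∈ A, Disjoint (e i) (B k ∪ B l) then 1 else 0)
          + -2 * m * ∑ k ∈ S, a k * (if ∀ i ∈ A, Disjoint (e i) (B k) then 1 else 0)
          + m ^ 2 := by
      intro A
      rw [sub_sq, sq (∑ k ∈ S, _), sum_mul_sum]
      have : ∀ k l, a k * (if ∀ i ∈ A, Disjoint (e i) (B k) then (1 : ℝ) else 0)
          * (a l * (if ∀ i ∈ A, Disjoint (e i) (B l) then (1 : ℝ) else 0))
          = a k * a l * (if ∀ i ∈ A, Disjoint (e i) (B k ∪ B l) then 1 else 0) := by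
        intro k l
        simp only [disjoint_union_right, forall_and]
        split_ifs <;> first | tauto | ring
      simp only [this]
      ring
    simp only [h1, bernoulliMean_add, bernoulliMean_const_mul, bernoulliMean_sum,
      bernoulliMean_const, bernoulliMean_avoid]
  have hfirst : ρ * ∑ k ∈ S, ∑ l ∈ S, a k * a l * avoidProb p E e (B k ∪ B l)
      ≤ m ^ 2 + ∑ k ∈ S, a k ^ 2 := by
    have hterm : ∀ k ∈ S, ∀ l ∈ S, ρ * (a k * a l * avoidProb p E e (B k ∪ B l))
        ≤ (a k * ∏ u ∈ B k, avoidProb p E e {u}) * (a l * ∏ u ∈ B l, avoidProb p E e {u})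
          + if k = l then a k ^ 2 else 0 := by
      intro k hk l hl
      split_ifs with hkl
      · subst hkl
        have h2 := mul_le_one₀ hρ1 (avoidProb_nonneg hp1 (B k ∪ B k))
          (avoidProb_le_one (E := E) (e := e) hp0 hp1 (B k ∪ B k))
        have h3 := mul_le_mul_of_nonneg_left h2 (sq_nonneg (a k))
        have h4 := mul_self_nonneg (a k * ∏ u ∈ B k, avoidProb p E e {u})
        linarith
      · have hd := hdisj k hk l hl hkl
        have hc : #(B k ∪ B l) = 4 := by rw [card_union_of_disjoint hd, hB k hk, hB l hl]
        have h2 := avoidProb_mul_le_prod hβ0 hβ1 hpβ hlin 4 (B k ∪ B l) hc.le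
        rw [hc, ← pow_mul, show 4 * 4 = 16 from rfl, ← hρ, prod_union hd] at h2
        have h3 := mul_le_mul_of_nonneg_left h2 (mul_nonneg (ha k) (ha l))
        linarith
    calc ρ * ∑ k ∈ S, ∑ l ∈ S, a k * a l * avoidProb p E e (B k ∪ B l)
        = ∑ k ∈ S, ∑ l ∈ S, ρ * (a k * a l * avoidProb p E e (B k ∪ B l)) := by
          simp only [mul_sum]
      _ ≤ ∑ k ∈ S, ∑ l ∈ S,
          ((a k * ∏ u ∈ B k, avoidProb p E e {u}) * (a l * ∏ u ∈ B l, avoidProb p E e {u})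
            + if k = l then a k ^ 2 else 0) :=
          sum_le_sum fun k hk => sum_le_sum fun l hl => hterm k hk l hl
      _ = m ^ 2 + ∑ k ∈ S, a k ^ 2 := by
          simp only [sum_add_distrib]
          congr 1
          · rw [hm, sq, sum_mul_sum]
          · exact sum_congr rfl fun k hk => by simp [hk]
  have hsecond : m ≤ ∑ k ∈ S, a k * avoidProb p E e (B k) := by
    rw [hm]
    exact sum_le_sum fun k _ =>
      mul_le_mul_of_nonneg_left (prod_avoidProb_singleton_le hp0 hp1 _) (ha k)
  rw [hexp]
  have := mul_le_mul_of_nonneg_left (mul_le_mul_of_nonneg_left hsecond hm0) hρ0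
  nlinarith

/-- Discarding the members through an overloaded vertex loses little weight when the loads `x v`
are close to their targets `m v`. -/
theorem sum_sub_le_sum_filter_of_load {ι α : Type*} [DecidableEq α] {X : Finset α} {D : Finset ι}
    {e : ι → Finset α} (he : ∀ i ∈ D, e i ⊆ X) {w : ι → ℝ} (hw : ∀ i, 0 ≤ w i) {x m : α → ℝ}
    {η : ℝ} (hη0 : 0 < η) (hη1 : η ≤ 1) (hm0 : ∀ v, m v ≤ 1 - η)
    (hx : ∀ v, ∑ i ∈ D with v ∈ e i, w i ≤ x v) :
    ∑ i ∈ D, w i - (∑ v ∈ X, (x v - m v) ^ 2) / η ^ 2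
      ≤ ∑ i ∈ D with ∀ v ∈ e i, x v ≤ 1, w i := by
  have h1 : ∑ i ∈ D, w i ≤ (∑ i ∈ D with ∀ v ∈ e i, x v ≤ 1, w i)
      + ∑ i ∈ D, ∑ v ∈ e i, if 1 < x v then w i else 0 := by
    rw [sum_filter, ← sum_add_distrib]
    refine sum_le_sum fun i _ => ?_
    have hnn : ∀ v ∈ e i, 0 ≤ if 1 < x v then w i else 0 := fun v _ => by
      split_ifs
      exacts [hw i, le_rfl]
    split_ifs with hgood
    · linarith [sum_nonneg hnn]
    · push Not at hgood
      obtain ⟨v, hv, hlt⟩ := hgood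
      have := single_le_sum hnn hv
      rw [if_pos hlt] at this
      linarith
  have h2 : ∑ i ∈ D, ∑ v ∈ e i, (if 1 < x v then w i else 0)
      = ∑ v ∈ X, ∑ i ∈ D with v ∈ e i, if 1 < x v then w i else 0 := by
    refine sum_comm' fun i v => ?_
    simp only [mem_filter]
    exact ⟨fun h => ⟨h, he i h.1 h.2⟩, fun h => h.1⟩
  have h3 : ∑ v ∈ X, ∑ i ∈ D with v ∈ e i, (if 1 < x v then w i else 0)
      ≤ (∑ v ∈ X, (x v - m v) ^ 2) / η ^ 2 := by
    rw [sum_div]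
    refine sum_le_sum fun v _ => ?_
    by_cases hv : 1 < x v
    · simp only [hv, if_true]
      refine (hx v).trans ?_
      rw [le_div_iff₀ (by positivity)]
      have hy : η ≤ x v - m v := by linarith [hm0 v]
      nlinarith [hm0 v, mul_nonneg (sub_nonneg.2 hy) hη0.le,
        mul_nonneg (sub_nonneg.2 hη1) hη0.le, mul_nonneg (sub_nonneg.2 hy) (sub_nonneg.2 hη1),
        sq_nonneg η, mul_le_mul_of_nonneg_right (hm0 v) (sq_nonneg η)]
    · simp only [hv, if_false, sum_const_zero]
      positivity
  linarith

/-- In linear 3-uniform hypergraphs, fractional matchings with small weights can be rounded to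
matchings of `a` times the size, up to a small multiple of the number of vertices. -/
def MatchingRatio (a : ℝ) : Prop :=
  ∀ b > 0, ∃ δ > 0, ∀ (ι α : Type) [DecidableEq ι] [DecidableEq α] (X : Finset α) (E : Finset ι)
    (e : ι → Finset α) (w : ι → ℝ), (∀ i ∈ E, e i ⊆ X) → (∀ i ∈ E, #(e i) = 3) →
    (∀ i ∈ E, ∀ j ∈ E, i ≠ j → #(e i ∩ e j) ≤ 1) → (∀ i, 0 ≤ w i) → (∀ i, w i ≤ δ) →
    (∀ v ∈ X, ∑ i ∈ E with v ∈ e i, w i ≤ 1) →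
    ∃ M ⊆ E, (∀ i ∈ M, ∀ j ∈ M, i ≠ j → Disjoint (e i) (e j)) ∧
      a * ∑ i ∈ E, w i - b * #X ≤ #M

theorem matchingRatio_zero : MatchingRatio 0 := fun b hb =>
  ⟨1, one_pos, fun ι α _ _ X E e w _ _ _ _ _ _ => ⟨∅, empty_subset _, by simp, by
    simp only [card_empty, Nat.cast_zero, zero_mul, zero_sub, Left.neg_nonpos_iff]
    positivity⟩⟩

theorem MatchingRatio.nibble {a γ : ℝ} (H : MatchingRatio a) (ha0 : 0 ≤ a) (ha1 : a ≤ 1)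
    (hγ0 : 0 < γ) (hγ1 : γ ≤ 1 / 2) :
    MatchingRatio (γ * (1 - γ) ^ 3 + a * ((1 - γ ^ 2) * (1 - γ))) := by
  intro b hb
  obtain ⟨δ', hδ', H⟩ := H (b / 2) (half_pos hb)
  set η := γ ^ 2 with hη
  have hη0 : 0 < η := by positivity
  have hη1 : η ≤ 1 := by nlinarith
  set q := 1 - γ with hq
  have hq2 : 1 / 2 ≤ q := by linarith
  have hq1 : q ≤ 1 := by linarith
  have hq0 : 0 < q := by linarith
  set c := (1 - η) / q ^ 2 with hc
  have hc0 : 0 ≤ c := div_nonneg (by linarith) (by positivity)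
  have hc4 : c ≤ 4 := by
    rw [hc, div_le_iff₀ (by positivity)]
    nlinarith
  have hcq : c * q ^ 2 = 1 - η := div_mul_cancel₀ _ (by positivity)
  set δ := min (δ' / 4) (min (1 / 32) (b * η ^ 2 / 128)) with hδ
  have hδ0 : 0 < δ := by positivity
  have hδ1 : δ ≤ δ' / 4 := min_le_left _ _
  have hδ2 : δ ≤ 1 / 32 := (min_le_right _ _).trans (min_le_left _ _)
  have hδ3 : δ ≤ b * η ^ 2 / 128 := (min_le_right _ _).trans (min_le_right _ _)
  refine ⟨δ, hδ0, fun ι α _ _ X E e w heX hcard hlin hw0 hwδ hdeg => ?_⟩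
  have hdeg' : ∀ v, ∑ i ∈ E with v ∈ e i, w i ≤ 1 := by
    intro v
    by_cases hv : v ∈ X
    · exact hdeg v hv
    · rw [filter_false_of_mem fun i hi hvi => hv (heX i hi hvi)]
      simp
  let p (i : ι) : ℝ := γ * w i
  have hp0 : ∀ i, 0 ≤ p i := fun i => mul_nonneg hγ0.le (hw0 i)
  have hpδ : ∀ i, p i ≤ δ := fun i => by
    have := hwδ i
    have := hw0 i
    simp only [p]
    nlinarith
  have hp1 : ∀ i, p i ≤ 1 := fun i => by linarith [hpδ i]
  let s (v : α) : ℝ := avoidProb p E e {v}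
  have hsq : ∀ v, q ≤ s v := by
    intro v
    refine le_trans ?_ (one_sub_sum_le_avoidProb_singleton hp0 hp1 v)
    rw [← mul_sum]
    nlinarith [hdeg' v]
  have hs0 : ∀ v, 0 < s v := fun v => hq0.trans_le (hsq v)
  let σ (v : α) : ℝ := q / s v
  have hσ0 : ∀ v, 0 ≤ σ v := fun v => div_nonneg hq0.le (hs0 v).le
  have hσ1 : ∀ v, σ v ≤ 1 := fun v => (div_le_one (hs0 v)).2 (hsq v)
  have hσs : ∀ U : Finset α, (∏ u ∈ U, σ u) * ∏ u ∈ U, s u = q ^ #U := by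
    intro U
    rw [← prod_mul_distrib, ← prod_const]
    exact prod_congr rfl fun u _ => div_mul_cancel₀ _ (hs0 u).ne'
  have hσprod0 : ∀ U : Finset α, 0 ≤ ∏ u ∈ U, σ u := fun U => prod_nonneg fun u _ => hσ0 u
  have hσprod1 : ∀ U : Finset α, ∏ u ∈ U, σ u ≤ 1 := fun U =>
    prod_le_one (fun u _ => hσ0 u) fun u _ => hσ1 u
  let w' (i : ι) : ℝ := c * w i * ∏ u ∈ e i, σ u
  have hw'0 : ∀ i, 0 ≤ w' i := fun i => mul_nonneg (mul_nonneg hc0 (hw0 i)) (hσprod0 _)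
  have hw'δ : ∀ i, w' i ≤ δ' := by
    intro i
    have h1 : c * w i ≤ 4 * δ := mul_le_mul hc4 (hwδ i) (hw0 i) (by norm_num)
    have h2 : w' i ≤ c * w i := mul_le_of_le_one_right (mul_nonneg hc0 (hw0 i)) (hσprod1 _)
    linarith
  let coef (v : α) (i : ι) : ℝ := c * w i * ∏ u ∈ (e i).erase v, σ u
  have hcoef0 : ∀ v i, 0 ≤ coef v i := fun v i =>
    mul_nonneg (mul_nonneg hc0 (hw0 i)) (hσprod0 _)
  let x (A : Finset ι) (v : α) : ℝ := ∑ i ∈ E with v ∈ e i,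
    coef v i * (if ∀ j ∈ A, Disjoint (e j) ((e i).erase v) then 1 else 0)
  let m (v : α) : ℝ := ∑ i ∈ E with v ∈ e i, coef v i * ∏ u ∈ (e i).erase v, s u
  have hm : ∀ v, m v = (1 - η) * ∑ i ∈ E with v ∈ e i, w i := by
    intro v
    simp only [m, coef, mul_sum]
    refine sum_congr rfl fun i hi => ?_
    rw [mem_filter] at hi
    rw [mul_assoc, hσs, card_erase_of_mem hi.2, hcard i hi.1, ← hcq]
    ring
  have hmη : ∀ v, m v ≤ 1 - η := fun v => by
    rw [hm]
    exact mul_le_of_le_one_right (by linarith) (hdeg' v)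
  have hm0 : ∀ v, 0 ≤ m v := fun v => by
    rw [hm]
    exact mul_nonneg (by linarith) (sum_nonneg fun i _ => hw0 i)
  let F (A : Finset ι) : ℝ :=
    ∑ i ∈ E, (if i ∈ A ∧ ∀ j ∈ A, j ≠ i → Disjoint (e j) (e i) then 1 else 0)
    + (a * (∑ i ∈ E, w' i * (if ∀ j ∈ A, Disjoint (e j) (e i) then 1 else 0)
      + -(1 / η ^ 2) * ∑ v ∈ X, (x A v - m v) ^ 2) + -(b / 2 * #X))
  have hround : ∀ A ⊆ E, ∃ M ⊆ E, (∀ i ∈ M, ∀ j ∈ M, i ≠ j → Disjoint (e i) (e j)) ∧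
      F A ≤ #M := by
    intro A hA
    set I := A.filter fun i => ∀ j ∈ A, j ≠ i → Disjoint (e j) (e i) with hI
    set D := E.filter fun i => ∀ j ∈ A, Disjoint (e j) (e i) with hD
    have hDE : D ⊆ E := filter_subset _ _
    set E' := D.filter fun i => ∀ v ∈ e i, x A v ≤ 1 with hE'
    have hE'E : E' ⊆ E := (filter_subset _ _).trans hDE
    have hload : ∀ v, ∑ i ∈ D with v ∈ e i, w' i ≤ x A v := by
      intro v
      simp only [x, hD, filter_filter, mul_ite, mul_one, mul_zero]
      rw [← sum_filter, filter_filter]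
      refine (sum_le_sum (g := coef v) fun i hi => ?_).trans
        (sum_le_sum_of_subset_of_nonneg ?_ fun i _ _ => hcoef0 v i)
      · rw [mem_filter] at hi
        simp only [w', coef]
        rw [← mul_prod_erase (e i) σ hi.2.2]
        exact mul_le_mul_of_nonneg_left (mul_le_of_le_one_left (hσprod0 _) (hσ1 v))
          (mul_nonneg hc0 (hw0 i))
      · refine monotone_filter_right E fun i _ hi => ⟨hi.2, fun j hj => ?_⟩
        exact (hi.1 j hj).mono_right (erase_subset _ _)
    have hkeep := sum_sub_le_sum_filter_of_load (X := X) (fun i hi => heX i (hDE hi)) hw'0 hη0 hη1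
      hmη hload
    obtain ⟨M, hME, hMdisj, hMcard⟩ := H ι α X E' e w' (fun i hi => heX i (hE'E hi))
      (fun i hi => hcard i (hE'E hi)) (fun i hi j hj => hlin i (hE'E hi) j (hE'E hj)) hw'0 hw'δ
      (by
        intro v _
        rcases (E'.filter (v ∈ e ·)).eq_empty_or_nonempty with h | ⟨i, hi⟩
        · simp [h]
        · rw [hE', mem_filter, mem_filter] at hi
          refine le_trans (le_trans ?_ (hload v)) (hi.1.2 v hi.2)
          exact sum_le_sum_of_subset_of_nonneg (filter_subset_filter _ (filter_subset _ _))
            fun i _ _ => hw'0 i)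
    have hMI : ∀ i ∈ M, ∀ j ∈ A, Disjoint (e j) (e i) := fun i hi j hj => by
      have := hME hi
      rw [hE', mem_filter, hD, mem_filter] at this
      exact this.1.2 j hj
    have hIA : I ⊆ A := filter_subset _ _
    have hdisj : Disjoint I M := by
      rw [disjoint_left]
      intro i hiI hiM
      have := hMI i hiM i (hIA hiI)
      rw [disjoint_self, bot_eq_empty, ← card_eq_zero, hcard i (hA (hIA hiI))] at this
      norm_num at this
    refine ⟨I ∪ M, union_subset (hIA.trans hA) (hME.trans hE'E), ?_, ?_⟩
    · intro i hi j hj hij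
      rcases mem_union.1 hi with hi | hi <;> rcases mem_union.1 hj with hj | hj
      · exact (mem_filter.1 hj).2 i (hIA hi) hij
      · exact hMI j hj i (hIA hi)
      · exact (hMI i hi j (hIA hj)).symm
      · exact hMdisj i hi j hj hij
    · have h1 : ∑ i ∈ E, (if i ∈ A ∧ ∀ j ∈ A, j ≠ i → Disjoint (e j) (e i) then (1 : ℝ) else 0)
          = #I := by
        rw [sum_boole]
        congr 2
        ext i
        simp only [hI, mem_filter]
        exact ⟨fun h => h.2, fun h => ⟨hA h.1, h⟩⟩
      have h2 : ∑ i ∈ E, w' i * (if ∀ j ∈ A, Disjoint (e j) (e i) then (1 : ℝ) else 0)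
          = ∑ i ∈ D, w' i := by
        simp only [mul_ite, mul_one, mul_zero]
        rw [hD, sum_filter]
      simp only [F, h1, h2]
      rw [card_union_of_disjoint hdisj]
      push_cast
      have h3 := mul_le_mul_of_nonneg_left hkeep ha0
      rw [div_eq_mul_one_div] at h3
      linarith
  have hvar : ∀ v, bernoulliMean p E (fun A => (x A v - m v) ^ 2) ≤ b * η ^ 2 / 2 := by
    intro v
    have h1 := bernoulliMean_sq_sub_le (S := E.filter (v ∈ e ·)) (B := fun i => (e i).erase v)
      hδ0.le (by linarith) hp0 hpδ hlin (hcoef0 v)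
      (fun i hi => by
        rw [mem_filter] at hi
        rw [card_erase_of_mem hi.2, hcard i hi.1])
      (fun i hi j hj hij => by
        rw [mem_filter] at hi hj
        rw [disjoint_left]
        intro u hui huj
        rw [mem_erase] at hui huj
        exact hui.1 (card_le_one.1 (hlin i hi.1 j hj.1 hij) u (mem_inter.2 ⟨hui.2, huj.2⟩) v
          (mem_inter.2 ⟨hi.2, hj.2⟩)))
      (m := m v) rfl
    have hρ : 1 - 16 * δ ≤ (1 - δ) ^ 16 := by
      have := one_add_mul_le_pow (a := -δ) (by linarith) 16
      norm_num at this
      rw [sub_eq_add_neg 1 δ]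
      linarith
    have hsq : ∑ i ∈ E with v ∈ e i, coef v i ^ 2 ≤ 16 * δ := by
      calc ∑ i ∈ E with v ∈ e i, coef v i ^ 2 ≤ ∑ i ∈ E with v ∈ e i, 16 * δ * w i := by
            refine sum_le_sum fun i _ => ?_
            have h2 : coef v i ≤ 4 * w i :=
              (mul_le_of_le_one_right (mul_nonneg hc0 (hw0 i)) (hσprod1 _)).trans
                (mul_le_mul_of_nonneg_right hc4 (hw0 i))
            have h3 := pow_le_pow_left₀ (hcoef0 v i) h2 2
            nlinarith [mul_le_mul_of_nonneg_right (hwδ i) (hw0 i)]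
        _ = 16 * δ * ∑ i ∈ E with v ∈ e i, w i := by rw [mul_sum]
        _ ≤ 16 * δ := mul_le_of_le_one_right (by positivity) (hdeg' v)
    have hnn : 0 ≤ bernoulliMean p E (fun A => (x A v - m v) ^ 2) := by
      rw [← bernoulliMean_const (p := p) (E := E) 0]
      exact bernoulliMean_mono hp0 hp1 fun A _ => sq_nonneg _
    have hm1 : m v ^ 2 ≤ 1 := pow_le_one₀ (hm0 v) ((hmη v).trans (by linarith))
    change (1 - δ) ^ 16 * bernoulliMean p E (fun A => (x A v - m v) ^ 2) ≤ _ at h1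
    generalize bernoulliMean p E (fun A => (x A v - m v) ^ 2) = μ at h1 hnn ⊢
    generalize (1 - δ) ^ 16 = ρ at h1 hρ
    have h4 : (1 - 16 * δ) * μ ≤ ρ * μ := mul_le_mul_of_nonneg_right hρ hnn
    have h5 : m v ^ 2 * (1 - ρ) ≤ m v ^ 2 * (16 * δ) :=
      mul_le_mul_of_nonneg_left (by linarith) (sq_nonneg _)
    have h6 : m v ^ 2 * (16 * δ) ≤ 16 * δ := mul_le_of_le_one_left (by positivity) hm1
    have h7 : 1 / 2 * μ ≤ (1 - 16 * δ) * μ := mul_le_mul_of_nonneg_right (by linarith) hnn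
    linarith
  have hcube : ∀ i ∈ E, q ^ 3 ≤ avoidProb p E e (e i) := by
    intro i hi
    refine le_trans ?_ (prod_avoidProb_singleton_le hp0 hp1 _)
    rw [← hcard i hi, ← prod_const]
    exact prod_le_prod (fun _ _ => hq0.le) fun u _ => hsq u
  have hmean : (γ * q ^ 3 + a * ((1 - η) * q)) * ∑ i ∈ E, w i - b * #X ≤ bernoulliMean p E F := by
    simp only [F, bernoulliMean_add, bernoulliMean_const_mul, bernoulliMean_sum,
      bernoulliMean_const, bernoulliMean_avoid]
    have h1 : γ * q ^ 3 * ∑ i ∈ E, w i ≤ ∑ i ∈ E, bernoulliMean p E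
        (fun A => if i ∈ A ∧ ∀ j ∈ A, j ≠ i → Disjoint (e j) (e i) then 1 else 0) := by
      rw [mul_sum]
      refine sum_le_sum fun i hi => le_trans ?_ (le_bernoulliMean_isolated hp0 hp1 hi)
      have := mul_le_mul_of_nonneg_left (hcube i hi) (hp0 i)
      simp only [p] at this ⊢
      linarith
    have h2 : (1 - η) * q * ∑ i ∈ E, w i ≤ ∑ i ∈ E, w' i * avoidProb p E e (e i) := by
      rw [mul_sum]
      refine sum_le_sum fun i hi => ?_
      have h3 := mul_le_mul_of_nonneg_left (prod_avoidProb_singleton_le (E := E) (e := e) hp0 hp1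
        (e i)) (hw'0 i)
      refine le_trans (le_of_eq ?_) h3
      change _ = c * w i * (∏ u ∈ e i, σ u) * ∏ u ∈ e i, s u
      rw [mul_assoc (c * w i), hσs, hcard i hi, ← hcq]
      ring
    have h3 : 1 / η ^ 2 * ∑ v ∈ X, bernoulliMean p E (fun A => (x A v - m v) ^ 2)
        ≤ b / 2 * #X := by
      calc 1 / η ^ 2 * ∑ v ∈ X, bernoulliMean p E (fun A => (x A v - m v) ^ 2)
          ≤ 1 / η ^ 2 * ∑ v ∈ X, b * η ^ 2 / 2 := by
            refine mul_le_mul_of_nonneg_left (sum_le_sum fun v _ => hvar v) (by positivity)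
        _ = b / 2 * #X := by
            rw [sum_const, nsmul_eq_mul]
            field_simp
    have h4 : a * (1 / η ^ 2 * ∑ v ∈ X, bernoulliMean p E (fun A => (x A v - m v) ^ 2))
        ≤ b / 2 * #X :=
      (mul_le_mul_of_nonneg_left h3 ha0).trans (mul_le_of_le_one_left (by positivity) ha1)
    have h5 := mul_le_mul_of_nonneg_left h2 ha0
    linarith
  obtain ⟨A, hA, hAF⟩ := exists_bernoulliMean_le (E := E) (f := F) hp0 hp1
  obtain ⟨M, hM, hMd, hMc⟩ := hround A hA
  exact ⟨M, hM, hMd, hmean.trans (hAF.trans hMc)⟩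

theorem sum_le_card_of_load {ι α : Type*} [DecidableEq α] {X : Finset α} {E : Finset ι}
    {e : ι → Finset α} (heX : ∀ i ∈ E, e i ⊆ X) (hcard : ∀ i ∈ E, #(e i) = 3) {w : ι → ℝ}
    (hw0 : ∀ i, 0 ≤ w i) (hdeg : ∀ v ∈ X, ∑ i ∈ E with v ∈ e i, w i ≤ 1) :
    ∑ i ∈ E, w i ≤ #X := by
  calc ∑ i ∈ E, w i ≤ ∑ i ∈ E, ∑ v ∈ e i, w i := by
        refine sum_le_sum fun i hi => ?_
        rw [sum_const, hcard i hi, nsmul_eq_mul]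
        push_cast
        linarith [hw0 i]
    _ = ∑ v ∈ X, ∑ i ∈ E with v ∈ e i, w i := by
        refine sum_comm' fun i v => ?_
        simp only [mem_filter]
        exact ⟨fun h => ⟨h, heX i h.1 h.2⟩, fun h => h.1⟩
    _ ≤ ∑ v ∈ X, 1 := sum_le_sum hdeg
    _ = #X := by simp

theorem matchingRatio_one : MatchingRatio 1 := by
  set R := {a : ℝ | 0 ≤ a ∧ a ≤ 1 ∧ MatchingRatio a} with hR
  have h0R : (0 : ℝ) ∈ R := ⟨le_rfl, zero_le_one, matchingRatio_zero⟩
  have hbdd : BddAbove R := ⟨1, fun a ha => ha.2.1⟩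
  set t := sSup R with ht
  have ht0 : 0 ≤ t := le_csSup hbdd h0R
  have ht1 : t ≤ 1 := csSup_le ⟨0, h0R⟩ fun a ha => ha.2.1
  have htR : MatchingRatio t := by
    intro b hb
    obtain ⟨a, haR, hat⟩ := exists_lt_of_lt_csSup ⟨0, h0R⟩ (sub_lt_self t (half_pos hb))
    obtain ⟨δ, hδ, h⟩ := haR.2.2 (b / 2) (half_pos hb)
    refine ⟨δ, hδ, fun ι α _ _ X E e w heX hcard hlin hw0 hwδ hdeg => ?_⟩
    obtain ⟨M, hME, hMd, hMc⟩ := h ι α X E e w heX hcard hlin hw0 hwδ hdeg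
    refine ⟨M, hME, hMd, ?_⟩
    have hle := sum_le_card_of_load heX hcard hw0 hdeg
    have hs0 : 0 ≤ ∑ i ∈ E, w i := sum_nonneg fun i _ => hw0 i
    nlinarith
  rcases ht1.eq_or_lt with h1 | h1
  · rwa [← h1]
  · exfalso
    set γ := (1 - t) / 8 with hγ
    have hγ0 : 0 < γ := by
      rw [hγ]
      linarith
    have hγ1 : γ ≤ 1 / 8 := by
      rw [hγ]
      linarith
    have htγ : t = 1 - 8 * γ := by
      rw [hγ]
      ring
    have hstep := htR.nibble ht0 ht1 hγ0 (by linarith)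
    set t' := γ * (1 - γ) ^ 3 + t * ((1 - γ ^ 2) * (1 - γ)) with ht'
    have hlt : t < t' := by
      have hg : 0 < γ ^ 2 := by positivity
      have hexp : t' - t = γ ^ 2 * (4 + 12 * γ - 9 * γ ^ 2) := by
        rw [ht', htγ]
        ring
      nlinarith [mul_pos hg hγ0]
    have hle1 : t' ≤ 1 := by
      have h2 : (1 - γ) ^ 3 ≤ 1 := pow_le_one₀ (by linarith) (by linarith)
      have h3 : (1 - γ ^ 2) * (1 - γ) ≤ 1 - γ :=
        mul_le_of_le_one_left (by linarith) (by nlinarith)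
      have h4 := mul_le_mul_of_nonneg_left h3 ht0
      have h5 := mul_le_mul_of_nonneg_left h2 hγ0.le
      have h6 : t * (1 - γ) ≤ 1 - γ := mul_le_of_le_one_left (by linarith) ht1
      linarith
    exact absurd (le_csSup hbdd ⟨ht0.trans hlt.le, hle1, hstep⟩) (not_le.2 hlt)

/-- A nonnegative weighting of pairs that covers the triangles of a graph with
`n ^ 2 / 4 + k` edges has weight at least `2 k / 3`, up to its defects on the triangles. -/
theorem le_sum_pair_weight_add_defect {V : Type*} [Fintype V] [DecidableEq V] [Nonempty V]
    (G : SimpleGraph V) [DecidableRel G.Adj] {y : Finset V → ℝ} (hy : ∀ s, 0 ≤ y s)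
    {θ : ℝ} (hθ : 0 < θ) :
    2 / 3 * (#G.edgeFinset - (Fintype.card V : ℝ) ^ 2 / 4) ≤
      ∑ s ∈ powersetCard 2 univ, y s
      + 27 / (4 * (θ * Fintype.card V)) *
        ∑ T ∈ G.cliqueFinset 3, max 0 (1 - ∑ s ∈ powersetCard 2 T, y s)
      + θ * (Fintype.card V : ℝ) ^ 2 / 3 := by
  set n : ℝ := (Fintype.card V : ℝ) with hn
  have hn0 : 0 < n := by
    rw [hn]
    exact_mod_cast Fintype.card_pos
  let d (T : Finset V) : ℝ := max 0 (1 - ∑ s ∈ powersetCard 2 T, y s)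
  have hd : ∀ T, 0 ≤ d T := fun T => le_max_left _ _
  let g (a b : V) : ℝ := if G.Adj a b then 1 - 3 / 2 * y {a, b} else 0
  let t (a b c : V) : ℝ := if {a, b, c} ∈ G.cliqueFinset 3 then 3 / 2 * d {a, b, c} else 0
  have ht : ∀ a b c, 0 ≤ t a b c := fun a b c => by
    simp only [t]
    split_ifs
    · exact mul_nonneg (by norm_num) (hd _)
    · exact le_rfl
  have hone : ∀ a b, g a b ≤ 1 := fun a b => by
    simp only [g]
    split_ifs
    · linarith [hy {a, b}]
    · exact zero_le_one
  have hgt : ∀ a b c, 1 / 2 ≤ g a b → g a c + g b c ≤ 1 + t a b c := by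
    intro a b c hab
    have hadj : G.Adj a b := by
      by_contra h
      simp only [g, h, if_false] at hab
      norm_num at hab
    by_cases hac : G.Adj a c
    · by_cases hbc : G.Adj b c
      · have hT : {a, b, c} ∈ G.cliqueFinset 3 := by
          rw [SimpleGraph.mem_cliqueFinset_iff, SimpleGraph.is3Clique_triple_iff]
          exact ⟨hadj, hac, hbc⟩
        have h₁ : ({a, b} : Finset V) ≠ {a, c} := fun h => by
          have := Finset.ext_iff.1 h b
          simp [hadj.ne', hbc.ne] at this
        have h₂ : ({a, b} : Finset V) ≠ {b, c} := fun h => by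
          have := Finset.ext_iff.1 h a
          simp [hadj.ne, hac.ne] at this
        have h₃ : ({a, c} : Finset V) ≠ {b, c} := fun h => by
          have := Finset.ext_iff.1 h a
          simp [hadj.ne, hac.ne] at this
        have hpc : powersetCard 2 {a, b, c} = {{a, b}, {a, c}, {b, c}} := by
          symm
          refine eq_of_subset_of_card_le ?_ ?_
          · intro s hs
            simp only [mem_insert, mem_singleton] at hs
            rw [mem_powersetCard]
            rcases hs with rfl | rfl | rfl
            · exact ⟨by grind, card_pair hadj.ne⟩
            · exact ⟨by grind, card_pair hac.ne⟩
            · exact ⟨by grind, card_pair hbc.ne⟩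
          · rw [card_powersetCard, card_eq_three.2 ⟨a, b, c, hadj.ne, hac.ne, hbc.ne, rfl⟩,
              card_eq_three.2 ⟨_, _, _, ?_, ?_, ?_, rfl⟩]
            · decide
            exacts [h₁, h₂, h₃]
        have hsum : ∑ s ∈ powersetCard 2 {a, b, c}, y s = y {a, b} + y {a, c} + y {b, c} := by
          rw [hpc, sum_insert, sum_pair, add_assoc]
          · exact h₃
          · simp only [mem_insert, mem_singleton, not_or]
            exact ⟨h₁, h₂⟩
        have hdef : 1 - (y {a, b} + y {a, c} + y {b, c}) ≤ d {a, b, c} := by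
          rw [← hsum]
          exact le_max_right _ _
        simp only [g, t, hadj, hac, hbc, hT, if_true] at hab ⊢
        linarith
      · have : g b c = 0 := if_neg hbc
        linarith [hone a c, ht a b c]
    · have : g a c = 0 := if_neg hac
      linarith [hone b c, ht a b c]
  have htot : ∑ a, ∑ b, ∑ c, t a b c ≤ 81 / 2 * ∑ T ∈ G.cliqueFinset 3, d T := by
    have hle : ∀ a b c, t a b c ≤ ∑ T ∈ G.cliqueFinset 3,
        (if a ∈ T then 1 else 0) * ((if b ∈ T then 1 else 0) * ((if c ∈ T then 1 else 0) *
          (3 / 2 * d T))) := by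
      intro a b c
      have hnn : ∀ T ∈ G.cliqueFinset 3, 0 ≤
          (if a ∈ T then (1 : ℝ) else 0) * ((if b ∈ T then 1 else 0) *
            ((if c ∈ T then 1 else 0) * (3 / 2 * d T))) := fun T _ => by
        have := hd T
        positivity
      by_cases hT : {a, b, c} ∈ G.cliqueFinset 3
      · refine le_trans (le_of_eq ?_) (single_le_sum hnn hT)
        simp only [t, hT, if_true]
        simp
      · simp only [t, hT, if_false]
        exact sum_nonneg hnn
    refine (sum_le_sum fun a _ => sum_le_sum fun b _ => sum_le_sum fun c _ => hle a b c).trans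
      (le_of_eq ?_)
    have hcount : ∀ (T : Finset V) (z : ℝ), ∑ a, (if a ∈ T then 1 else 0) * z = #T * z := by
      intro T z
      rw [← sum_mul]
      simp
    have h1 : ∀ a b : V, ∑ c, ∑ T ∈ G.cliqueFinset 3,
        (if a ∈ T then (1 : ℝ) else 0) * ((if b ∈ T then 1 else 0) *
          ((if c ∈ T then 1 else 0) * (3 / 2 * d T)))
        = ∑ T ∈ G.cliqueFinset 3,
        (if a ∈ T then (1 : ℝ) else 0) * ((if b ∈ T then 1 else 0) * (#T * (3 / 2 * d T))) := by
      intro a b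
      rw [sum_comm]
      simp only [← mul_sum, hcount]
    have h2 : ∀ a : V, ∑ b, ∑ T ∈ G.cliqueFinset 3,
        (if a ∈ T then (1 : ℝ) else 0) * ((if b ∈ T then 1 else 0) * (#T * (3 / 2 * d T)))
        = ∑ T ∈ G.cliqueFinset 3,
        (if a ∈ T then (1 : ℝ) else 0) * (#T * (#T * (3 / 2 * d T))) := by
      intro a
      rw [sum_comm]
      simp only [← mul_sum, hcount]
    simp only [h1, h2]
    rw [sum_comm, mul_sum]
    refine sum_congr rfl fun T hT => ?_
    rw [hcount, (SimpleGraph.mem_cliqueFinset_iff.1 hT).card_eq]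
    push_cast
    ring
  have hupper := sum_pair_weight_le (U := univ) (g := g) (t := t) (K := θ * n)
    (r := 81 / 2 * (∑ T ∈ G.cliqueFinset 3, d T) / (θ * n))
    (fun a b => by simp only [g, G.adj_comm a b, pair_comm a b]) (fun a => by simp [g]) hone ht
    hgt (by positivity) (htot.trans (le_of_eq (by field_simp))) univ (subset_univ _)
  have hlower : 2 * (#G.edgeFinset : ℝ) - 3 * ∑ s ∈ powersetCard 2 univ, y s
      ≤ ∑ a, ∑ b, g a b := by
    have hpairs : ∑ a, ∑ b, (if G.Adj a b then y {a, b} else 0)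
        ≤ 2 * ∑ s ∈ powersetCard 2 univ, y s := by
      calc ∑ a, ∑ b, (if G.Adj a b then y {a, b} else 0)
          = ∑ p : V × V with G.Adj p.1 p.2, y {p.1, p.2} := by
            rw [sum_filter, Fintype.sum_prod_type]
        _ = ∑ s ∈ powersetCard 2 univ,
            ∑ p ∈ univ.filter (fun p : V × V => G.Adj p.1 p.2) with {p.1, p.2} = s,
              y {p.1, p.2} := by
            refine (sum_fiberwise_of_maps_to (fun p hp => ?_) _).symm
            rw [mem_powersetCard]
            exact ⟨subset_univ _, card_pair (mem_filter.1 hp).2.ne⟩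
        _ ≤ ∑ s ∈ powersetCard 2 univ, 2 * y s := by
            refine sum_le_sum fun s hs => ?_
            have hcard := (mem_powersetCard.1 hs).2
            have hsub : (univ.filter (fun p : V × V => G.Adj p.1 p.2)).filter
                (fun p => {p.1, p.2} = s) ⊆ s.offDiag := by
              intro p hp
              simp only [mem_filter, mem_univ, true_and] at hp
              rw [mem_offDiag, ← hp.2]
              exact ⟨by simp, by simp, hp.1.ne⟩
            have hle := card_le_card hsub
            rw [offDiag_card, hcard] at hle
            calc _ = ∑ p ∈ (univ.filter (fun p : V × V => G.Adj p.1 p.2)).filter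
                  (fun p => {p.1, p.2} = s), y s :=
                  sum_congr rfl fun p hp => by rw [(mem_filter.1 hp).2]
              _ ≤ 2 * y s := by
                  rw [sum_const, nsmul_eq_mul]
                  exact mul_le_mul_of_nonneg_right (by exact_mod_cast hle) (hy s)
        _ = 2 * ∑ s ∈ powersetCard 2 univ, y s := by rw [mul_sum]
    have hdeg : ∑ a, ∑ b, (if G.Adj a b then (1 : ℝ) else 0) = 2 * #G.edgeFinset := by
      have h := G.sum_degrees_eq_twice_card_edges
      have h' : (∑ a, (G.degree a : ℝ)) = 2 * #G.edgeFinset := by exact_mod_cast h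
      rw [← h']
      refine sum_congr rfl fun a _ => ?_
      rw [sum_boole, ← G.card_neighborFinset_eq_degree, G.neighborFinset_eq_filter]
    have hg : ∑ a, ∑ b, g a b = ∑ a, ∑ b, (if G.Adj a b then (1 : ℝ) else 0)
        - 3 / 2 * ∑ a, ∑ b, (if G.Adj a b then y {a, b} else 0) := by
      simp only [mul_sum, ← sum_sub_distrib]
      refine sum_congr rfl fun a _ => sum_congr rfl fun b _ => ?_
      simp only [g]
      split_ifs <;> ring
    rw [hg, hdeg]
    linarith
  rw [card_univ, ← hn] at hupper
  have hcoef : 27 / (4 * (θ * n)) * ∑ T ∈ G.cliqueFinset 3, d T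
      = 1 / 3 * (81 / 2 * (∑ T ∈ G.cliqueFinset 3, d T) / (θ * n) / 2) := by
    field_simp
    ring
  change _ ≤ _ + 27 / (4 * (θ * n)) * ∑ T ∈ G.cliqueFinset 3, d T + _
  rw [hcoef]
  linarith

/-- For every `ε > 0` there exists `N` such that for every `n ≥ N`, every graph `G`
on `n` vertices with at least `n²/4 + k` edges contains at least `(2/3)k - εn²`
pairwise edge-disjoint triangles. -/
theorem edge_disjoint_triangles_in_dense_graphs :
    ∀ ε : ℝ, 0 < ε → ∃ N : ℕ, ∀ n : ℕ, N ≤ n → ∀ G : SimpleGraph (Fin n), ∀ k : ℝ,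
      (n : ℝ) ^ 2 / 4 + k ≤ (G.edgeSet.ncard : ℝ) →
      ∃ T : Finset (Finset (Fin n)),
        (∀ t ∈ T, t.card = 3 ∧ G.IsClique (t : Set (Fin n))) ∧
        (∀ t₁ ∈ T, ∀ t₂ ∈ T, t₁ ≠ t₂ → (t₁ ∩ t₂).card ≤ 1) ∧
        2 / 3 * k - ε * (n : ℝ) ^ 2 ≤ (T.card : ℝ) := by
  intro ε hε
  obtain ⟨δ, hδ, hmatch⟩ := matchingRatio_one (ε / 3) (by positivity)
  refine ⟨⌈27 / (4 * ε * δ)⌉₊ + 1, fun n hn G k hk => ?_⟩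
  classical
  have hn0 : 0 < n := by omega
  have : Nonempty (Fin n) := ⟨⟨0, hn0⟩⟩
  have hnδ : 27 / (4 * (ε * n)) ≤ δ := by
    have h1 : 27 / (4 * ε * δ) ≤ n := by
      refine (Nat.le_ceil _).trans ?_
      exact_mod_cast (Nat.le_succ _).trans hn
    have hn0' : (0 : ℝ) < n := by exact_mod_cast hn0
    rw [div_le_iff₀ (by positivity)] at h1 ⊢
    linarith
  set X : Finset (Finset (Fin n)) := powersetCard 2 univ with hX
  have heX : ∀ T ∈ G.cliqueFinset 3, powersetCard 2 T ⊆ X := fun T _ =>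
    powersetCard_mono (subset_univ T)
  have hcard : ∀ T ∈ G.cliqueFinset 3, #(powersetCard 2 T) = 3 := fun T hT => by
    rw [card_powersetCard, (SimpleGraph.mem_cliqueFinset_iff.1 hT).card_eq]
    decide
  have hlin : ∀ T ∈ G.cliqueFinset 3, ∀ T' ∈ G.cliqueFinset 3, T ≠ T' →
      #(powersetCard 2 T ∩ powersetCard 2 T') ≤ 1 := by
    intro T hT T' hT' hne
    have h3 := (SimpleGraph.mem_cliqueFinset_iff.1 hT).card_eq
    have h3' := (SimpleGraph.mem_cliqueFinset_iff.1 hT').card_eq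
    have hlt : #(T ∩ T') < 3 := by
      rw [← h3]
      refine card_lt_card ⟨inter_subset_left, fun h => hne ?_⟩
      exact eq_of_subset_of_card_le (h.trans inter_subset_right) (by omega)
    have hsub : powersetCard 2 T ∩ powersetCard 2 T' ⊆ powersetCard 2 (T ∩ T') := fun s hs => by
      simp only [mem_inter, mem_powersetCard] at hs ⊢
      exact ⟨subset_inter hs.1.1 hs.2.1, hs.1.2⟩
    refine (card_le_card hsub).trans ?_
    rw [card_powersetCard]
    exact (Nat.choose_le_choose 2 (Nat.le_of_lt_succ hlt)).trans (by decide)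
  obtain ⟨w, y, hw0, hwδ, hy0, hload, hdual⟩ := exists_bounded_packing_and_cover
    (G.cliqueFinset 3) (powersetCard 2) X heX hδ (L := 3 / ε) (by positivity)
  have hL : 1 + 1 / (3 / ε) = 1 + ε / 3 := by rw [one_div_div]
  rw [hL] at hload
  have hw'0 : ∀ T, 0 ≤ w T / (1 + ε / 3) := fun T => div_nonneg (hw0 T) (by positivity)
  have hload' : ∀ s ∈ X, ∑ T ∈ G.cliqueFinset 3 with s ∈ powersetCard 2 T, w T / (1 + ε / 3)
      ≤ 1 := fun s hs => by
    rw [← sum_div, div_le_one (by positivity)]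
    exact hload s hs
  obtain ⟨M, hM, hdisj, hMcard⟩ := hmatch _ _ X (G.cliqueFinset 3) (powersetCard 2)
    (fun T => w T / (1 + ε / 3)) heX hcard hlin hw'0
    (fun T => (div_le_self (hw0 T) (by linarith)).trans (hwδ T)) hload'
  have hclique : ∀ T ∈ M, G.IsNClique 3 T := fun T hT =>
    SimpleGraph.mem_cliqueFinset_iff.1 (hM hT)
  refine ⟨M, fun T hT => ⟨(hclique T hT).card_eq, (hclique T hT).isClique⟩, ?_, ?_⟩
  · intro T hT T' hT' hne
    by_contra! h
    obtain ⟨s, hs, hs2⟩ := exists_subset_card_eq h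
    exact disjoint_left.1 (hdisj T hT T' hT' hne)
      (mem_powersetCard.2 ⟨hs.trans inter_subset_left, hs2⟩)
      (mem_powersetCard.2 ⟨hs.trans inter_subset_right, hs2⟩)
  · have hXcard : (#X : ℝ) ≤ n ^ 2 / 2 := by
      rw [hX, card_powersetCard, card_univ, Fintype.card_fin, Nat.cast_choose_two]
      nlinarith [(Nat.cast_nonneg n : (0 : ℝ) ≤ n)]
    have hsum := sum_le_card_of_load heX hcard hw'0 hload'
    have hcover := le_sum_pair_weight_add_defect G hy0 hε
    rw [Fintype.card_fin] at hcover
    have hedges : (G.edgeSet.ncard : ℝ) = #G.edgeFinset := by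
      rw [← G.coe_edgeFinset, Set.ncard_coe_finset]
    rw [hedges] at hk
    have hdefect : 27 / (4 * (ε * n)) *
        ∑ T ∈ G.cliqueFinset 3, max 0 (1 - ∑ s ∈ powersetCard 2 T, y s)
        ≤ δ * ∑ T ∈ G.cliqueFinset 3, max 0 (1 - ∑ s ∈ powersetCard 2 T, y s) :=
      mul_le_mul_of_nonneg_right hnδ (sum_nonneg fun T _ => le_max_left _ _)
    have hscale : ∑ T ∈ G.cliqueFinset 3, w T
        = (1 + ε / 3) * ∑ T ∈ G.cliqueFinset 3, w T / (1 + ε / 3) := by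
      rw [← sum_div]
      field_simp
    have hεX := mul_le_mul_of_nonneg_left hXcard hε.le
    have hεsum := mul_le_mul_of_nonneg_left hsum hε.le
    have hsq : 0 ≤ ε * (n : ℝ) ^ 2 := by positivity
    linarith
end

section
/- The edges of every simple graph on n vertices can be decomposed into at most ⌊n²/4⌋ complete graphs; that is, there exist complete subgraphs C₁, …, C_ℓ with ℓ ≤ ⌊n²/4⌋ such that every edge of the graph lies in exactly one Cᵢ. -/
/-- If every vertex of `N` has many neighbours in `N`, then `N` splits into at most `m` cliques. -/
theorem exists_clique_partition {V : Type*} [DecidableEq V] (G : SimpleGraph V)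
    [DecidableRel G.Adj] (m : ℕ) : ∀ N : Finset V, N.card ≤ 2 * m →
      (∀ y ∈ N, 2 * N.card ≤ (N.filter (G.Adj y)).card + (2 * m + 1)) →
      ∃ P : Finset (Finset V), P.card ≤ m ∧
        (∀ C ∈ P, G.IsClique (C : Set V) ∧ C.Nonempty ∧ C ⊆ N) ∧
        ∀ v ∈ N, ∃! C, C ∈ P ∧ v ∈ C := by
  induction m with
  | zero =>
    intro N hN _
    obtain rfl : N = ∅ := by simpa using hN
    exact ⟨∅, by simp⟩
  | succ m ih =>
    intro N hN hdeg
    by_cases hc : N.card ≤ m + 1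
    · refine ⟨N.image (fun v => {v}), Finset.card_image_le.trans hc, ?_, ?_⟩
      · intro C hC
        obtain ⟨v, hv, rfl⟩ := Finset.mem_image.1 hC
        simpa using hv
      · intro v hv
        refine ⟨{v}, by simpa using hv, ?_⟩
        rintro C ⟨hC, hvC⟩
        obtain ⟨w, -, rfl⟩ := Finset.mem_image.1 hC
        rw [Finset.mem_singleton.1 hvC]
    · obtain ⟨y, hy⟩ : N.Nonempty := Finset.card_pos.1 (by omega)
      obtain ⟨z, hz⟩ : (N.filter (G.Adj y)).Nonempty :=
        Finset.card_pos.1 (by have := hdeg y hy; omega)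
      obtain ⟨hzN, hyz⟩ := Finset.mem_filter.1 hz
      have hpair : ({y, z} : Finset V) ⊆ N := by
        simp [Finset.insert_subset_iff, hy, hzN]
      have hpc : ({y, z} : Finset V).card = 2 := Finset.card_pair hyz.ne
      have hsd := Finset.card_sdiff_add_card_eq_card hpair
      obtain ⟨P, hPm, hPc, hPu⟩ := ih (N \ {y, z}) (by omega) (by
        intro w hw
        have h₁ := hdeg w (Finset.mem_sdiff.1 hw).1
        have h₂ : N.filter (G.Adj w) ⊆ (N \ {y, z}).filter (G.Adj w) ∪ {y, z} := by
          intro a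
          simp only [Finset.mem_filter, Finset.mem_union, Finset.mem_sdiff]
          tauto
        have h₃ := (Finset.card_le_card h₂).trans (Finset.card_union_le _ _)
        omega)
      refine ⟨insert {y, z} P, (Finset.card_insert_le _ _).trans (by omega), ?_, ?_⟩
      · intro C hC
        rcases Finset.mem_insert.1 hC with rfl | hC
        · exact ⟨by simpa using fun _ => hyz, by simp, hpair⟩
        · exact ⟨(hPc C hC).1, (hPc C hC).2.1, (hPc C hC).2.2.trans Finset.sdiff_subset⟩
      · intro v hv
        by_cases hvp : v ∈ ({y, z} : Finset V)
        · refine ⟨{y, z}, ⟨Finset.mem_insert_self _ _, hvp⟩, ?_⟩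
          rintro C ⟨hC, hvC⟩
          rcases Finset.mem_insert.1 hC with rfl | hC
          · rfl
          · exact absurd hvp (Finset.mem_sdiff.1 ((hPc C hC).2.2 hvC)).2
        · obtain ⟨C, ⟨hC, hvC⟩, hu⟩ := hPu v (Finset.mem_sdiff.2 ⟨hv, hvp⟩)
          refine ⟨C, ⟨Finset.mem_insert_of_mem hC, hvC⟩, ?_⟩
          rintro E ⟨hE, hvE⟩
          rcases Finset.mem_insert.1 hE with rfl | hE
          · exact absurd hvE hvp
          · exact hu E ⟨hE, hvE⟩

/-- The neighbours of a vertex of minimum degree split into at most `⌊k/2⌋` cliques, where `k`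
is the number of vertices. -/
theorem exists_clique_partition_neighbors {V : Type*} [DecidableEq V] (G : SimpleGraph V)
    [DecidableRel G.Adj] (s : Finset V) (hG : ∀ u v, G.Adj u v → u ∈ s) (x : V) (hx : x ∈ s)
    (hmin : ∀ y ∈ s, (s.filter (G.Adj x)).card ≤ (s.filter (G.Adj y)).card) :
    ∃ P : Finset (Finset V), P.card ≤ s.card / 2 ∧
      (∀ C ∈ P, G.IsClique (C : Set V) ∧ C.Nonempty ∧ ∀ v ∈ C, G.Adj x v) ∧
      ∀ v, G.Adj x v → ∃! C, C ∈ P ∧ v ∈ C := by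
  have hlt : (s.filter (G.Adj x)).card < s.card :=
    Finset.card_lt_card (Finset.filter_ssubset.2 ⟨x, hx, G.irrefl⟩)
  obtain ⟨P, hPm, hPc, hPu⟩ := exists_clique_partition G (s.card / 2) (s.filter (G.Adj x))
    (by omega) (by
      intro y hy
      have h₁ := hmin y (Finset.mem_filter.1 hy).1
      have h₂ : s.filter (G.Adj y) ⊆
          (s.filter (G.Adj x)).filter (G.Adj y) ∪ s \ s.filter (G.Adj x) := by
        intro a
        simp only [Finset.mem_filter, Finset.mem_union, Finset.mem_sdiff]
        tauto
      have h₃ := (Finset.card_le_card h₂).trans (Finset.card_union_le _ _)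
      have h₄ := Finset.card_sdiff_add_card_eq_card (Finset.filter_subset (G.Adj x) s)
      omega)
  exact ⟨P, hPm, fun C hC => ⟨(hPc C hC).1, (hPc C hC).2.1,
      fun v hv => (Finset.mem_filter.1 ((hPc C hC).2.2 hv)).2⟩,
    fun v hv => hPu v (Finset.mem_filter.2 ⟨hG v x hv.symm, hv⟩)⟩

/-- A graph whose edges lie within a set of `k` vertices decomposes into at most `⌊k²/4⌋`
cliques. -/
theorem exists_finset_clique_decomp {V : Type*} [DecidableEq V] (k : ℕ) :
    ∀ (s : Finset V) (G : SimpleGraph V), s.card = k → (∀ u v, G.Adj u v → u ∈ s) →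
      ∃ D : Finset (Finset V), D.card ≤ k ^ 2 / 4 ∧
        (∀ C ∈ D, G.IsClique (C : Set V) ∧ 2 ≤ C.card) ∧
        ∀ u v, G.Adj u v → ∃! C, C ∈ D ∧ u ∈ C ∧ v ∈ C := by
  classical
  induction k with
  | zero =>
    intro s G hs hG
    obtain rfl := Finset.card_eq_zero.1 hs
    exact ⟨∅, by simp, by simp, fun u v h => absurd (hG u v h) (by simp)⟩
  | succ k ih =>
    intro s G hs hG
    obtain ⟨x, hx, hmin⟩ := Finset.exists_min_image s (fun y => (s.filter (G.Adj y)).card)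
      (Finset.card_pos.1 (by omega))
    obtain ⟨P, hPm, hPc, hPu⟩ := exists_clique_partition_neighbors G s hG x hx hmin
    have hxP : ∀ C ∈ P, x ∉ C := fun C hC h => G.irrefl ((hPc C hC).2.2 x h)
    let G' : SimpleGraph V :=
      { Adj := fun u v => G.Adj u v ∧ u ≠ x ∧ v ≠ x ∧ ∀ C ∈ P, ¬ (u ∈ C ∧ v ∈ C)
        symm := ⟨fun u v h => ⟨h.1.symm, h.2.2.1, h.2.1, fun C hC hh => h.2.2.2 C hC hh.symm⟩⟩
        loopless := ⟨fun u h => G.irrefl h.1⟩ }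
    obtain ⟨D, hDk, hDc, hDu⟩ := ih (s.erase x) G'
      (by rw [Finset.card_erase_of_mem hx]; omega)
      (fun u v h => Finset.mem_erase.2 ⟨h.2.1, hG u v h.1⟩)
    refine ⟨D ∪ P.image (insert x), ?_, ?_, ?_⟩
    · have h₁ := (Finset.card_union_le D (P.image (insert x))).trans
        (Nat.add_le_add_left Finset.card_image_le _)
      have h₂ : k ^ 2 / 4 + (k + 1) / 2 ≤ (k + 1) ^ 2 / 4 := by
        obtain ⟨a, rfl | rfl⟩ := Nat.even_or_odd' k <;> ring_nf <;> omega
      rw [hs] at hPm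
      omega
    · intro C hC
      rcases Finset.mem_union.1 hC with hC | hC
      · exact ⟨(hDc C hC).1.mono (show G' ≤ G from fun _ _ h => h.1), (hDc C hC).2⟩
      · obtain ⟨E, hE, rfl⟩ := Finset.mem_image.1 hC
        obtain ⟨hcl, hne, hadj⟩ := hPc E hE
        refine ⟨?_, ?_⟩
        · rw [Finset.coe_insert]
          exact hcl.insert fun b hb _ => hadj b hb
        · rw [Finset.card_insert_of_notMem (hxP E hE)]
          have := hne.card_pos
          omega
    · have hux : ∀ v, G.Adj x v → ∃! C, C ∈ D ∪ P.image (insert x) ∧ x ∈ C ∧ v ∈ C := by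
        intro v hv
        obtain ⟨C, ⟨hC, hvC⟩, hu⟩ := hPu v hv
        refine ⟨insert x C, ⟨Finset.mem_union_right _ (Finset.mem_image_of_mem _ hC),
          Finset.mem_insert_self _ _, Finset.mem_insert_of_mem hvC⟩, ?_⟩
        rintro E ⟨hE, hxE, hvE⟩
        rcases Finset.mem_union.1 hE with hE | hE
        · exact absurd rfl ((hDc E hE).1 hxE hvE hv.ne).2.1
        · obtain ⟨F, hF, rfl⟩ := Finset.mem_image.1 hE
          rw [hu F ⟨hF, Finset.mem_of_mem_insert_of_ne hvE hv.ne'⟩]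
      intro u v huv
      by_cases hu : u = x
      · subst hu
        exact hux v huv
      by_cases hv : v = x
      · subst hv
        simpa only [and_comm (a := u ∈ _)] using hux u huv.symm
      by_cases hP : ∃ C ∈ P, u ∈ C ∧ v ∈ C
      · obtain ⟨C, hC, huC, hvC⟩ := hP
        refine ⟨insert x C, ⟨Finset.mem_union_right _ (Finset.mem_image_of_mem _ hC),
          Finset.mem_insert_of_mem huC, Finset.mem_insert_of_mem hvC⟩, ?_⟩
        rintro E ⟨hE, huE, hvE⟩
        rcases Finset.mem_union.1 hE with hE | hE
        · exact absurd ⟨huC, hvC⟩ (((hDc E hE).1 huE hvE huv.ne).2.2.2 C hC)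
        · obtain ⟨F, hF, rfl⟩ := Finset.mem_image.1 hE
          rw [(hPu u ((hPc C hC).2.2 u huC)).unique
            ⟨hF, Finset.mem_of_mem_insert_of_ne huE hu⟩ ⟨hC, huC⟩]
      · push Not at hP
        obtain ⟨C, ⟨hC, huC, hvC⟩, huniq⟩ :=
          hDu u v ⟨huv, hu, hv, fun C hC h => hP C hC h.1 h.2⟩
        refine ⟨C, ⟨Finset.mem_union_left _ hC, huC, hvC⟩, ?_⟩
        rintro E ⟨hE, huE, hvE⟩
        rcases Finset.mem_union.1 hE with hE | hE
        · exact huniq E ⟨hE, huE, hvE⟩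
        · obtain ⟨F, hF, rfl⟩ := Finset.mem_image.1 hE
          exact absurd (Finset.mem_of_mem_insert_of_ne hvE hv)
            (hP F hF (Finset.mem_of_mem_insert_of_ne huE hu))

/-- The edges of every graph on `n` vertices can be decomposed into at most `⌊n²/4⌋`
complete graphs. -/
theorem erdos_goodman_posa :
    ∀ (n : ℕ) (G : SimpleGraph (Fin n)),
      ∃ (ℓ : ℕ) (D : Fin ℓ → Finset (Fin n)), ℓ ≤ n ^ 2 / 4 ∧ IsCliqueDecomp G D := by
  intro n G
  obtain ⟨D, hDn, hDc, hDu⟩ := exists_finset_clique_decomp n Finset.univ G (by simp) (by simp)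
  refine ⟨D.card, fun i => (D.equivFin.symm i : Finset (Fin n)), hDn,
    fun i => hDc _ (D.equivFin.symm i).2, fun u v huv => ?_⟩
  obtain ⟨C, ⟨hC, hmem⟩, hu⟩ := hDu u v huv
  refine ⟨D.equivFin ⟨C, hC⟩, by simpa using hmem, fun j hj => ?_⟩
  rw [← Equiv.symm_apply_eq]
  exact Subtype.ext (hu _ ⟨(D.equivFin.symm j).2, hj⟩)
end

section
/- The edges of every simple graph on n vertices can be decomposed into at most ⌊n²/4⌋ parts, each of which is a copy of K₂ (a single edge) or a copy of K₃ (a triangle); that is, there exist complete subgraphs C₁, …, C_ℓ, each with two or three vertices, with ℓ ≤ ⌊n²/4⌋, such that every edge of the graph lies in exactly one Cᵢ. -/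
open Finset in
/-- If every vertex of `N` has at least `2 * j - 1` neighbours inside `N` and `2 * j ≤ #N`, then `N`
can be partitioned into at most `#N - j` cliques with one or two vertices. -/
theorem SimpleGraph.exists_partition_singletons_edges {V : Type*} [DecidableEq V]
    (G : SimpleGraph V) [DecidableRel G.Adj] (j : ℕ) (N : Finset V) (hN : 2 * j ≤ #N)
    (hdeg : ∀ u ∈ N, 2 * j ≤ #(N.filter (G.Adj u)) + 1) :
    ∃ Q : Finset (Finset V), #Q + j ≤ #N ∧
      (∀ q ∈ Q, q ⊆ N ∧ G.IsClique (q : Set V) ∧ (#q = 1 ∨ #q = 2)) ∧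
      ∀ x ∈ N, ∃! q, q ∈ Q ∧ x ∈ q := by
  induction j generalizing N with
  | zero =>
    refine ⟨N.image (fun x => {x}), by simpa using card_image_le, ?_, ?_⟩
    · simp
    · intro x hx
      refine ⟨{x}, by simpa using hx, ?_⟩
      rintro q ⟨hq, hxq⟩
      obtain ⟨y, -, rfl⟩ := mem_image.1 hq
      rw [mem_singleton.1 hxq]
  | succ j ih =>
    obtain ⟨u, hu⟩ : N.Nonempty := card_pos.1 (by omega)
    obtain ⟨w, hw⟩ : (N.filter (G.Adj u)).Nonempty := card_pos.1 (by have := hdeg u hu; omega)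
    obtain ⟨hw, huw⟩ := mem_filter.1 hw
    have hpair : #({u, w} : Finset V) = 2 := card_pair huw.ne
    have hsub : ({u, w} : Finset V) ⊆ N := by
      simp [insert_subset_iff, hu, hw]
    have hcard : #(N \ {u, w}) + 2 = #N := by
      rw [← hpair]; exact card_sdiff_add_card_eq_card hsub
    obtain ⟨Q, hQ, hQc, hQu⟩ := ih (N \ {u, w}) (by omega) (by
      intro x hx
      have h1 := hdeg x (mem_sdiff.1 hx).1
      have h2 : N.filter (G.Adj x) ⊆ (N \ {u, w}).filter (G.Adj x) ∪ {u, w} := by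
        intro y hy
        simp only [mem_union, mem_filter, mem_sdiff] at hy ⊢
        tauto
      have h3 := (card_le_card h2).trans (card_union_le _ _)
      omega)
    refine ⟨insert {u, w} Q, by have := card_insert_le {u, w} Q; omega, ?_, ?_⟩
    · intro q hq
      rcases mem_insert.1 hq with rfl | hq
      · refine ⟨hsub, ?_, Or.inr hpair⟩
        simpa [SimpleGraph.isClique_pair] using fun _ => huw
      · exact ⟨(hQc q hq).1.trans sdiff_subset, (hQc q hq).2⟩
    · intro x hx
      by_cases hxp : x ∈ ({u, w} : Finset V)
      · refine ⟨{u, w}, ⟨mem_insert_self _ _, hxp⟩, ?_⟩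
        rintro q ⟨hq, hxq⟩
        rcases mem_insert.1 hq with rfl | hq
        · rfl
        · exact absurd hxp (mem_sdiff.1 ((hQc q hq).1 hxq)).2
      · obtain ⟨q, ⟨hq, hxq⟩, huniq⟩ := hQu x (mem_sdiff.2 ⟨hx, hxp⟩)
        refine ⟨q, ⟨mem_insert_of_mem hq, hxq⟩, ?_⟩
        rintro r ⟨hr, hxr⟩
        rcases mem_insert.1 hr with rfl | hr
        · exact absurd hxr hxp
        · exact huniq r ⟨hr, hxr⟩

open Finset in
/-- A vertex of minimum degree has a neighbourhood that can be partitioned into at most `#S / 2`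
cliques with one or two vertices. -/
theorem SimpleGraph.exists_partition_neighbors_of_min_degree {V : Type*} [DecidableEq V]
    (G : SimpleGraph V) [DecidableRel G.Adj] {S : Finset V} {v : V} (hv : v ∈ S)
    (hmin : ∀ u ∈ S, #(S.filter (G.Adj v)) ≤ #(S.filter (G.Adj u))) :
    ∃ Q : Finset (Finset V), #Q ≤ #S / 2 ∧
      (∀ q ∈ Q, q ⊆ S.filter (G.Adj v) ∧ G.IsClique (q : Set V) ∧ (#q = 1 ∨ #q = 2)) ∧
      ∀ x ∈ S.filter (G.Adj v), ∃! q, q ∈ Q ∧ x ∈ q := by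
  set N := S.filter (G.Adj v) with hN
  have hlt : #N < #S := card_lt_card (filter_ssubset.2 ⟨v, hv, G.irrefl⟩)
  obtain ⟨Q, hQ, h⟩ := G.exists_partition_singletons_edges (#N - #S / 2) N (by omega) (by
    intro u hu
    have h1 := hmin u (mem_filter.1 hu).1
    have h2 : S.filter (G.Adj u) ⊆ N.filter (G.Adj u) ∪ (S \ N) := by
      intro y hy
      simp only [mem_union, mem_filter, mem_sdiff] at hy ⊢
      tauto
    have h3 := (card_le_card h2).trans (card_union_le _ _)
    have h4 : #(S \ N) + #N = #S := card_sdiff_add_card_eq_card (filter_subset _ _)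
    omega)
  exact ⟨Q, by omega, h⟩

open Finset in
/-- The edges of a graph supported on a finite set `S` can be decomposed into at most `#S ^ 2 / 4`
edges and triangles. -/
theorem SimpleGraph.exists_decomp_edges_triangles {V : Type*} [DecidableEq V]
    (S : Finset V) (G : SimpleGraph V) (hG : ∀ u v, G.Adj u v → u ∈ S) :
    ∃ P : Finset (Finset V), #P ≤ #S ^ 2 / 4 ∧
      (∀ p ∈ P, G.IsClique (p : Set V) ∧ (#p = 2 ∨ #p = 3)) ∧
      ∀ u v, G.Adj u v → ∃! p, p ∈ P ∧ u ∈ p ∧ v ∈ p := by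
  classical
  induction hs : #S generalizing S G with
  | zero =>
    obtain rfl := card_eq_zero.1 hs
    exact ⟨∅, by simp, by simp, fun u v h => absurd (hG u v h) (notMem_empty u)⟩
  | succ s ih =>
    obtain ⟨v, hv, hmin⟩ := S.exists_min_image (fun u => #(S.filter (G.Adj u)))
      (card_pos.1 (by omega))
    obtain ⟨Q, hQ, hQc, hQu⟩ := G.exists_partition_neighbors_of_min_degree hv hmin
    have hQv : ∀ q ∈ Q, ∀ x ∈ q, G.Adj v x := fun q hq x hx =>
      (mem_filter.1 ((hQc q hq).1 hx)).2
    let G' : SimpleGraph V :=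
      { Adj := fun u w => G.Adj u w ∧ u ≠ v ∧ w ≠ v ∧ ∀ q ∈ Q, u ∈ q → w ∉ q
        symm := ⟨fun u w h => ⟨h.1.symm, h.2.2.1, h.2.1, fun q hq hw hu => h.2.2.2 q hq hu hw⟩⟩
        loopless := ⟨fun u h => G.irrefl h.1⟩ }
    obtain ⟨P, hP, hPc, hPu⟩ := ih (S.erase v) G'
      (fun u w h => mem_erase.2 ⟨h.2.1, hG u w h.1⟩) (by rw [card_erase_of_mem hv]; omega)
    have hvP : ∀ p ∈ P, v ∉ p := by
      intro p hp hvp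
      obtain ⟨w, hw, hwv⟩ := exists_mem_ne (show 1 < #p by have := (hPc p hp).2; omega) v
      exact ((hPc p hp).1 hvp hw hwv.symm).2.1 rfl
    refine ⟨P ∪ Q.image (insert v), ?_, ?_, ?_⟩
    · have h1 := card_union_le P (Q.image (insert v))
      have h2 : #(Q.image (insert v)) ≤ #Q := card_image_le
      have h3 : s ^ 2 / 4 + (s + 1) / 2 ≤ (s + 1) ^ 2 / 4 := by
        rcases Nat.even_or_odd' s with ⟨a, rfl | rfl⟩ <;> ring_nf <;> omega
      rw [hs] at hQ
      omega
    · intro p hp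
      rcases mem_union.1 hp with hp | hp
      · exact ⟨fun x hx y hy hxy => ((hPc p hp).1 hx hy hxy).1, (hPc p hp).2⟩
      · obtain ⟨q, hq, rfl⟩ := mem_image.1 hp
        have hvq : v ∉ q := fun h => G.irrefl (hQv q hq v h)
        refine ⟨?_, ?_⟩
        · rw [coe_insert]
          exact (hQc q hq).2.1.insert fun x hx _ => hQv q hq x hx
        · rw [card_insert_of_notMem hvq]
          have := (hQc q hq).2.2
          omega
    · have star : ∀ w, G.Adj v w → ∃! p, p ∈ P ∪ Q.image (insert v) ∧ v ∈ p ∧ w ∈ p := by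
        intro w hvw
        obtain ⟨q, ⟨hq, hwq⟩, huniq⟩ := hQu w (mem_filter.2 ⟨hG w v hvw.symm, hvw⟩)
        refine ⟨insert v q, ⟨mem_union_right _ (mem_image_of_mem _ hq), by simp, by simp [hwq]⟩, ?_⟩
        rintro p ⟨hp, hvp, hwp⟩
        rcases mem_union.1 hp with hp | hp
        · exact absurd hvp (hvP p hp)
        · obtain ⟨r, hr, rfl⟩ := mem_image.1 hp
          rw [huniq r ⟨hr, (mem_insert.1 hwp).resolve_left hvw.ne'⟩]
      intro u w huw
      by_cases hu : u = v
      · subst hu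
        exact star w huw
      by_cases hw : w = v
      · subst hw
        simpa only [and_comm] using star u huw.symm
      by_cases hq : ∃ q ∈ Q, u ∈ q ∧ w ∈ q
      · obtain ⟨q, hq, huq, hwq⟩ := hq
        refine ⟨insert v q, ⟨mem_union_right _ (mem_image_of_mem _ hq), by simp [huq],
          by simp [hwq]⟩, ?_⟩
        rintro p ⟨hp, hup, hwp⟩
        rcases mem_union.1 hp with hp | hp
        · exact absurd hwq (((hPc p hp).1 hup hwp huw.ne).2.2.2 q hq huq)
        · obtain ⟨r, hr, rfl⟩ := mem_image.1 hp
          rw [(hQu u ((hQc q hq).1 huq)).unique ⟨hr, (mem_insert.1 hup).resolve_left hu⟩ ⟨hq, huq⟩]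
      · obtain ⟨p, ⟨hp, hup, hwp⟩, huniq⟩ :=
          hPu u w ⟨huw, hu, hw, fun q hqQ huq hwq => hq ⟨q, hqQ, huq, hwq⟩⟩
        refine ⟨p, ⟨mem_union_left _ hp, hup, hwp⟩, ?_⟩
        rintro r ⟨hr, hur, hwr⟩
        rcases mem_union.1 hr with hr | hr
        · exact huniq r ⟨hr, hur, hwr⟩
        · obtain ⟨q, hqQ, rfl⟩ := mem_image.1 hr
          exact absurd ⟨q, hqQ, (mem_insert.1 hur).resolve_left hu,
            (mem_insert.1 hwr).resolve_left hw⟩ hq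

/-- The edges of every graph on `n` vertices can be decomposed into at most `⌊n²/4⌋`
copies of `K₂` and `K₃`. -/
theorem erdos_goodman_posa_edges_triangles :
    ∀ (n : ℕ) (G : SimpleGraph (Fin n)),
      ∃ (ℓ : ℕ) (D : Fin ℓ → Finset (Fin n)), ℓ ≤ n ^ 2 / 4 ∧ IsCliqueDecomp G D ∧
        ∀ i, (D i).card = 2 ∨ (D i).card = 3 := by
  intro n G
  obtain ⟨P, hP, hPc, hPu⟩ :=
    G.exists_decomp_edges_triangles Finset.univ fun u _ _ => Finset.mem_univ u
  have hD : ∀ i, (P.equivFin.symm i : Finset (Fin n)) ∈ P := fun i => (P.equivFin.symm i).2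
  refine ⟨P.card, fun i => P.equivFin.symm i, by simpa using hP, ⟨fun i => ?_, ?_⟩,
    fun i => (hPc _ (hD i)).2⟩
  · refine ⟨(hPc _ (hD i)).1, ?_⟩
    rcases (hPc _ (hD i)).2 with h | h <;> simp [h]
  · intro u v huv
    obtain ⟨p, ⟨hp, hup, hvp⟩, huniq⟩ := hPu u v huv
    refine ⟨P.equivFin ⟨p, hp⟩, by simpa using ⟨hup, hvp⟩, fun i hi => ?_⟩
    rw [← Equiv.symm_apply_eq]
    exact Subtype.ext (huniq _ ⟨hD i, hi⟩)
end

section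
/- Every simple graph G on n vertices satisfies π(G) ≤ n²/2; that is, the edges of G can be decomposed into complete subgraphs C₁, …, C_ℓ such that the sum of their orders satisfies |C₁| + ⋯ + |C_ℓ| ≤ n²/2. -/
open Finset

section

variable {V : Type*}

/-- `G` has a decomposition of its edges into cliques whose orders sum to at most `k`. -/
def HasCliqueDecompLE (G : SimpleGraph V) (k : ℕ) : Prop :=
  ∃ P : Finset (Finset V), (∀ C ∈ P, G.IsClique (C : Set V) ∧ 2 ≤ #C) ∧
    (∀ u v, G.Adj u v → ∃! C, C ∈ P ∧ u ∈ C ∧ v ∈ C) ∧ ∑ C ∈ P, #C ≤ k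

/-- `G` without the edges at `v` and without the edges joining two neighbours of `v` of the
same colour. -/
def SimpleGraph.peel (G : SimpleGraph V) (v : V) (c : V → ℕ) : SimpleGraph V where
  Adj a b := G.Adj a b ∧ a ≠ v ∧ b ≠ v ∧ ¬(G.Adj v a ∧ G.Adj v b ∧ c a = c b)
  symm := ⟨fun _ _ h => ⟨h.1.symm, h.2.2.1, h.2.1, fun h' => h.2.2.2 ⟨h'.2.1, h'.1, h'.2.2.symm⟩⟩⟩
  loopless := ⟨fun _ h => G.loopless.irrefl _ h.1⟩

open Classical in
/-- If the colour classes in the neighbourhood of `v` are cliques, then adding `v` to each of them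
extends a decomposition of `G.peel v c` to one of `G`. -/
theorem HasCliqueDecompLE.of_peel [Fintype V] {G : SimpleGraph V} {v : V} {c : V → ℕ} {k : ℕ}
    (h : HasCliqueDecompLE (G.peel v c) k) (I : Finset ℕ)
    (hI : ∀ u ∈ G.neighborFinset v, c u ∈ I)
    (hc : ∀ u ∈ G.neighborFinset v, ∀ x ∈ G.neighborFinset v, Gᶜ.Adj u x → c u ≠ c x) :
    HasCliqueDecompLE G (k + (G.degree v + #I)) := by
  obtain ⟨P, hP, hex, hk⟩ := h
  simp only [SimpleGraph.mem_neighborFinset, SimpleGraph.compl_adj] at hI hc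
  set A : ℕ → Finset V := fun i => {u ∈ G.neighborFinset v | c u = i} with hA
  set J : Finset ℕ := {i ∈ I | (A i).Nonempty} with hJ
  have mA : ∀ i u, u ∈ A i ↔ G.Adj v u ∧ c u = i := by simp [hA]
  have hvA : ∀ i, v ∉ A i := by simp [mA]
  have key : ∀ C ∈ P, ∀ a ∈ C, ∀ b ∈ C, a ≠ b → (G.peel v c).Adj a b :=
    fun C hC a ha b hb hab => (hP C hC).1 ha hb hab
  refine ⟨P ∪ J.image (fun i => insert v (A i)), ?_, ?_, ?_⟩
  · intro C hC
    rcases mem_union.1 hC with hC | hC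
    · exact ⟨fun a ha b hb hab => (key C hC a ha b hb hab).1, (hP C hC).2⟩
    · obtain ⟨i, hi, rfl⟩ := mem_image.1 hC
      refine ⟨?_, ?_⟩
      · intro a ha b hb hab
        simp only [coe_insert, Set.mem_insert_iff, mem_coe, mA] at ha hb
        rcases ha with rfl | ha
        · rcases hb with rfl | hb
          · exact absurd rfl hab
          · exact hb.1
        · rcases hb with rfl | hb
          · exact ha.1.symm
          · by_contra hn
            exact hc a ha.1 b hb.1 ⟨hab, hn⟩ (ha.2.trans hb.2.symm)
      · rw [card_insert_of_notMem (hvA i)]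
        have := (mem_filter.1 hi).2.card_pos
        omega
  · intro a b hab
    by_cases hp : (G.peel v c).Adj a b
    · obtain ⟨C, ⟨hC, haC, hbC⟩, huniq⟩ := hex a b hp
      refine ⟨C, ⟨mem_union_left _ hC, haC, hbC⟩, ?_⟩
      rintro C' ⟨hC', ha, hb⟩
      rcases mem_union.1 hC' with hC' | hC'
      · exact huniq C' ⟨hC', ha, hb⟩
      · obtain ⟨i, hi, rfl⟩ := mem_image.1 hC'
        obtain ⟨-, hav, hbv, hn⟩ := hp
        simp only [mem_insert, hav, hbv, false_or, mA] at ha hb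
        exact absurd ⟨ha.1, hb.1, ha.2.trans hb.2.symm⟩ hn
    · have hnP : ∀ C ∈ P, a ∈ C → b ∈ C → False :=
        fun C hC ha hb => hp (key C hC a ha b hb hab.ne)
      obtain ⟨i, hi, hmem⟩ : ∃ i ∈ J, ∀ j, a ∈ insert v (A j) ∧ b ∈ insert v (A j) ↔ j = i := by
        have mJ : ∀ x, G.Adj v x → c x ∈ J := fun x hx =>
          mem_filter.2 ⟨hI x hx, x, (mA _ _).2 ⟨hx, rfl⟩⟩
        by_cases hav : a = v
        · subst hav
          refine ⟨c b, mJ b hab, fun j => ?_⟩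
          simp [mA, hab, hab.ne', eq_comm]
        by_cases hbv : b = v
        · subst hbv
          refine ⟨c a, mJ a hab.symm, fun j => ?_⟩
          simp [mA, hab.symm, hab.ne, eq_comm]
        have hs : G.Adj v a ∧ G.Adj v b ∧ c a = c b := by
          by_contra hn
          exact hp ⟨hab, hav, hbv, hn⟩
        refine ⟨c a, mJ a hs.1, fun j => ?_⟩
        simp [mA, hav, hbv, hs.1, hs.2.1, ← hs.2.2, eq_comm]
      refine ⟨insert v (A i), ⟨mem_union_right _ (mem_image_of_mem _ hi), (hmem i).2 rfl⟩, ?_⟩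
      rintro C ⟨hC, ha, hb⟩
      rcases mem_union.1 hC with hC | hC
      · exact (hnP C hC ha hb).elim
      · obtain ⟨j, hj, rfl⟩ := mem_image.1 hC
        rw [(hmem j).1 ⟨ha, hb⟩]
  · have h1 : ∑ C ∈ J.image (fun i => insert v (A i)), #C ≤ ∑ i ∈ J, #(insert v (A i)) :=
      sum_image_le_of_nonneg fun _ _ => Nat.zero_le _
    have h2 : ∑ i ∈ J, #(insert v (A i)) ≤ ∑ i ∈ I, (#(A i) + 1) :=
      (sum_le_sum fun i _ => card_insert_le _ _).trans
        (sum_le_sum_of_subset (filter_subset _ _))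
    have h3 : ∑ i ∈ I, #(A i) = G.degree v :=
      (card_eq_sum_card_fiberwise (by simpa [Set.MapsTo] using hI)).symm
    have h4 := sum_union_inter (s₁ := P) (s₂ := J.image (fun i => insert v (A i)))
      (f := fun C => #C)
    rw [sum_add_distrib, h3, sum_const, smul_eq_mul, mul_one] at h2
    omega

/-- Greedy colouring of the subgraph induced on a finite set. -/
theorem SimpleGraph.exists_coloring_of_degree_lt (H : SimpleGraph V) [DecidableRel H.Adj] (m : ℕ)
    (T : Finset V) (hT : ∀ u ∈ T, #{x ∈ T | H.Adj u x} < m) :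
    ∃ c : V → ℕ, (∀ u ∈ T, c u ∈ range m) ∧ ∀ u ∈ T, ∀ x ∈ T, H.Adj u x → c u ≠ c x := by
  classical
  induction T using Finset.induction_on with
  | empty => exact ⟨fun _ => 0, by simp, by simp⟩
  | insert a T ha ih =>
    obtain ⟨c, hc, hp⟩ := ih fun u hu =>
      (card_le_card (filter_subset_filter _ (subset_insert a T))).trans_lt
        (hT u (mem_insert_of_mem hu))
    have hlt : #(image c {x ∈ T | H.Adj a x}) < #(range m) := by
      rw [card_range]
      exact (card_image_le.trans (card_le_card (filter_subset_filter _ (subset_insert a T)))).trans_lt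
        (hT a (mem_insert_self a T))
    obtain ⟨i, hi, hni⟩ := exists_mem_notMem_of_card_lt_card hlt
    simp only [mem_image, mem_filter, not_exists, not_and, and_imp] at hni
    have hne : ∀ x ∈ T, x ≠ a := fun x hx h => ha (h ▸ hx)
    refine ⟨Function.update c a i, ?_, ?_⟩
    · intro u hu
      rcases mem_insert.1 hu with rfl | hu
      · simpa using hi
      · simpa [Function.update_of_ne (hne u hu)] using hc u hu
    · intro u hu x hx hux
      rcases mem_insert.1 hu with rfl | hu' <;> rcases mem_insert.1 hx with rfl | hx'
      · exact absurd hux (H.loopless.irrefl _)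
      · rw [Function.update_self, Function.update_of_ne (hne x hx')]
        exact fun h => hni x hx' hux h.symm
      · rw [Function.update_self, Function.update_of_ne (hne u hu')]
        exact hni u hu' hux.symm
      · rw [Function.update_of_ne (hne u hu'), Function.update_of_ne (hne x hx')]
        exact hp u hu' x hx' hux

/-- In a proper colouring, either the colour `i` can be eliminated, or some vertex of colour `i`
has neighbours of all other colours. -/
theorem SimpleGraph.exists_coloring_erase_or (H : SimpleGraph V) (T : Finset V) (I : Finset ℕ)
    (c : V → ℕ) (hI : ∀ u ∈ T, c u ∈ I) (hp : ∀ u ∈ T, ∀ x ∈ T, H.Adj u x → c u ≠ c x) (i : ℕ) :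
    (∃ c' : V → ℕ, (∀ u ∈ T, c' u ∈ I.erase i) ∧ ∀ u ∈ T, ∀ x ∈ T, H.Adj u x → c' u ≠ c' x) ∨
      ∃ w ∈ T, c w = i ∧ ∀ j ∈ I.erase i, ∃ x ∈ T, c x = j ∧ H.Adj w x := by
  classical
  by_cases h : ∃ w ∈ T, c w = i ∧ ∀ j ∈ I.erase i, ∃ x ∈ T, c x = j ∧ H.Adj w x
  · exact .inr h
  left
  have h' : ∀ w, ∃ j, w ∈ T → c w = i → j ∈ I.erase i ∧ ∀ x ∈ T, c x = j → ¬ H.Adj w x := by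
    intro w
    by_contra! hw
    have h0 := hw 0
    refine h ⟨w, h0.1, h0.2.1, fun j hj => ?_⟩
    obtain ⟨x, hx, hxj, hwx⟩ := (hw j).2.2 hj
    exact ⟨x, hx, hxj, hwx⟩
  choose f hf using h'
  refine ⟨fun u => if c u = i then f u else c u, ?_, ?_⟩
  · intro u hu
    by_cases hc : c u = i
    · simpa only [hc, if_true] using (hf u hu hc).1
    · simpa only [hc, if_false] using mem_erase.2 ⟨hc, hI u hu⟩
  · intro u hu x hx hux
    have hne := hp u hu x hx hux
    by_cases hcu : c u = i <;> by_cases hcx : c x = i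
    · exact absurd (hcu.trans hcx.symm) hne
    · simp only [hcu, hcx, if_true, if_false]
      exact fun h => (hf u hu hcu).2 x hx h.symm hux
    · simp only [hcu, hcx, if_true, if_false]
      exact fun h => (hf x hx hcx).2 u hu h hux.symm
    · simpa only [hcu, hcx, if_false] using hne

open Classical in
theorem exists_hasCliqueDecompLE [Fintype V] (S : Finset V) (G : SimpleGraph V)
    (hS : ∀ a b, G.Adj a b → a ∈ S) : ∃ k, HasCliqueDecompLE G k ∧ 2 * k ≤ #S ^ 2 := by
  induction hn : #S using Nat.strong_induction_on generalizing S G with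
  | _ n ih =>
  subst hn
  rcases S.eq_empty_or_nonempty with rfl | hne
  · refine ⟨0, ⟨∅, by simp, fun a b hab => ?_, by simp⟩, by simp⟩
    simpa using hS a b hab
  obtain ⟨v, hvS, hmin⟩ := exists_min_image S (fun u => G.degree u) hne
  have hS' : ∀ a b, G.Adj a b → b ∈ S := fun a b h => hS b a h.symm
  have hcompl : ∀ u ∈ S, #{x ∈ S | Gᶜ.Adj u x} + G.degree u + 1 = #S := by
    intro u hu
    have h1 : {x ∈ S | ¬ Gᶜ.Adj u x} = insert u (G.neighborFinset u) := by
      ext x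
      simp only [mem_filter, SimpleGraph.compl_adj, mem_insert, SimpleGraph.mem_neighborFinset]
      constructor
      · rintro ⟨-, h⟩
        by_contra! h2
        exact h ⟨h2.1.symm, h2.2⟩
      · rintro (rfl | h)
        · simp [hu]
        · exact ⟨hS' _ _ h, fun h2 => h2.2 h⟩
    have h2 := card_filter_add_card_filter_not (s := S) (fun x => Gᶜ.Adj u x)
    rw [h1, card_insert_of_notMem (by simp), SimpleGraph.card_neighborFinset_eq_degree] at h2
    omega
  have hv := hcompl v hvS
  obtain ⟨k, hk⟩ : ∃ k, k = #{x ∈ S | Gᶜ.Adj v x} + 1 := ⟨_, rfl⟩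
  have hdeg : ∀ u ∈ S, #{x ∈ S | Gᶜ.Adj u x} < k := by
    intro u hu
    have := hcompl u hu
    have := hmin u hu
    omega
  have hpeel : ∀ c, ∀ a b, (G.peel v c).Adj a b → a ∈ S.erase v := fun c a b h =>
    mem_erase.2 ⟨h.2.1, hS a b h.1⟩
  have hSv : #(S.erase v) + 1 = #S := card_erase_add_one hvS
  obtain ⟨c, hcI, hcp⟩ := Gᶜ.exists_coloring_of_degree_lt k (G.neighborFinset v) (by
    intro u hu
    have hu' := (SimpleGraph.mem_neighborFinset _ _ _).1 hu
    refine (card_le_card (filter_subset_filter _ ?_)).trans_lt (hdeg u (hS' _ _ hu'))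
    exact fun x hx => hS' _ _ ((SimpleGraph.mem_neighborFinset _ _ _).1 hx))
  obtain ⟨i, hi, hmax⟩ := exists_max_image (range k)
    (fun i => #{u ∈ G.neighborFinset v | c u = i}) ⟨0, by simp [hk]⟩
  have hIi : #((range k).erase i) + 1 = k := by rw [card_erase_add_one hi, card_range]
  rcases Gᶜ.exists_coloring_erase_or _ _ c hcI hcp i with ⟨c', hcI', hcp'⟩ | ⟨w, hw, hwi, hwn⟩
  · obtain ⟨K, hK, hK2⟩ := ih _ (by omega) (S.erase v) (G.peel v c') (hpeel c') rfl
    refine ⟨_, hK.of_peel _ hcI' hcp', ?_⟩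
    have : G.degree v + #((range k).erase i) = #(S.erase v) := by omega
    rw [this, ← hSv]
    nlinarith
  have hvw := (SimpleGraph.mem_neighborFinset _ _ _).1 hw
  have hwS := hS' _ _ hvw
  set A : ℕ → Finset V := fun i => {u ∈ G.neighborFinset v | c u = i} with hA
  have mA : ∀ i u, u ∈ A i ↔ G.Adj v u ∧ c u = i := by simp [hA]
  have hwA : w ∈ A i := (mA _ _).2 ⟨hvw, hwi⟩
  have hApos : 0 < #(A i) := card_pos.2 ⟨w, hwA⟩
  have hw1 : k ≤ #{x ∈ S | Gᶜ.Adj w x} + 1 := by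
    have : (range k).erase i ⊆ image c {x ∈ S | Gᶜ.Adj w x} := by
      intro j hj
      obtain ⟨x, hx, hxj, hwx⟩ := hwn j hj
      exact mem_image.2 ⟨x, mem_filter.2
        ⟨hS' _ _ ((SimpleGraph.mem_neighborFinset _ _ _).1 hx), hwx⟩, hxj⟩
    have := (card_le_card this).trans card_image_le
    omega
  have hw2 := hcompl w hwS
  set G' := G.peel v c with hG'
  have hdeg' : G'.degree w + #(A i) ≤ G.degree w := by
    rw [← SimpleGraph.card_neighborFinset_eq_degree, ← SimpleGraph.card_neighborFinset_eq_degree]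
    have hd : Disjoint (G'.neighborFinset w) (insert v ((A i).erase w)) := by
      rw [disjoint_left]
      intro x hx hx'
      have hx := (SimpleGraph.mem_neighborFinset _ _ _).1 hx
      rcases mem_insert.1 hx' with rfl | hx'
      · exact hx.2.2.1 rfl
      · have := (mA _ _).1 (mem_of_mem_erase hx')
        exact hx.2.2.2 ⟨hvw, this.1, hwi.trans this.2.symm⟩
    have hcard : #(insert v ((A i).erase w)) = #(A i) := by
      rw [card_insert_of_notMem (by simp [mA]), card_erase_add_one hwA]
    rw [← hcard, ← card_union_of_disjoint hd]
    refine card_le_card (union_subset ?_ ?_)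
    · intro x hx
      simp only [SimpleGraph.mem_neighborFinset] at hx ⊢
      exact hx.1
    · intro x hx
      rw [SimpleGraph.mem_neighborFinset]
      rcases mem_insert.1 hx with rfl | hx
      · exact hvw.symm
      · obtain ⟨hxw, hx⟩ := mem_erase.1 hx
        have hx := (mA _ _).1 hx
        by_contra hn
        exact hcp w hw x (by simpa using hx.1) ⟨Ne.symm hxw, hn⟩ (hwi.trans hx.2.symm)
  obtain ⟨c', hcI', hcp'⟩ := G'ᶜ.exists_coloring_of_degree_lt (k + #(A i) - 2)
    (G'.neighborFinset w) (by
    intro u hu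
    have hu := (SimpleGraph.mem_neighborFinset _ _ _).1 hu
    have huS : u ∈ S := hS' _ _ hu.1
    have hud := hdeg u huS
    by_cases huv : G.Adj v u
    · have hui : c u ∈ (range k).erase i :=
        mem_erase.2 ⟨fun h => hu.2.2.2 ⟨hvw, huv, hwi.trans h.symm⟩, hcI u (by simpa using huv)⟩
      obtain ⟨y, hy, hyu, hwy⟩ := hwn _ hui
      have hyA : y ∈ A (c u) := (mA _ _).2 ⟨by simpa using hy, hyu⟩
      have huA : u ∈ A (c u) := (mA _ _).2 ⟨huv, rfl⟩
      have hyne : y ≠ u := by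
        rintro rfl
        exact hwy.2 hu.1
      have hsub : {x ∈ G'.neighborFinset w | G'ᶜ.Adj u x} ⊆
          {x ∈ S | Gᶜ.Adj u x} ∪ ((A (c u)).erase u).erase y := by
        intro x hx
        obtain ⟨hx, hux⟩ := mem_filter.1 hx
        have hx := (SimpleGraph.mem_neighborFinset _ _ _).1 hx
        by_cases hG : G.Adj u x
        · have hs : G.Adj v u ∧ G.Adj v x ∧ c u = c x := by
            by_contra hn
            exact hux.2 ⟨hG, hu.2.2.1, hx.2.2.1, hn⟩
          refine mem_union_right _ (mem_erase.2 ⟨?_, mem_erase.2 ⟨hux.1.symm, ?_⟩⟩)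
          · rintro rfl
            exact hwy.2 hx.1
          · exact (mA _ _).2 ⟨hs.2.1, hs.2.2.symm⟩
        · exact mem_union_left _ (mem_filter.2 ⟨hS' _ _ hx.1, hux.1, hG⟩)
      have h1 := (card_le_card hsub).trans (card_union_le _ _)
      have h2 := card_erase_add_one (mem_erase.2 ⟨hyne, hyA⟩)
      have h3 := card_erase_add_one huA
      have h4 : #(A (c u)) ≤ #(A i) := hmax _ (mem_of_mem_erase hui)
      omega
    · have hvm : v ∈ ({x ∈ S | Gᶜ.Adj u x} : Finset V) :=
        mem_filter.2 ⟨hvS, hu.2.2.1, fun h => huv h.symm⟩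
      have hsub : {x ∈ G'.neighborFinset w | G'ᶜ.Adj u x} ⊆
          ({x ∈ S | Gᶜ.Adj u x} : Finset V).erase v := by
        intro x hx
        obtain ⟨hx, hux⟩ := mem_filter.1 hx
        have hx := (SimpleGraph.mem_neighborFinset _ _ _).1 hx
        exact mem_erase.2 ⟨hx.2.2.1, mem_filter.2 ⟨hS' _ _ hx.1, hux.1, fun hG =>
          hux.2 ⟨hG, hu.2.2.1, hx.2.2.1, fun h => huv h.1⟩⟩⟩
      have h1 := card_le_card hsub
      have h2 := card_erase_add_one hvm
      omega)
  have hSw : #((S.erase v).erase w) + 1 = #(S.erase v) :=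
    card_erase_add_one (mem_erase.2 ⟨hvw.ne', hwS⟩)
  obtain ⟨K, hK, hK2⟩ := ih _ (by omega) ((S.erase v).erase w) (G'.peel w c')
    (fun a b h => mem_erase.2 ⟨h.2.1, hpeel c a b h.1⟩) rfl
  refine ⟨_, (hK.of_peel _ hcI' hcp').of_peel _ hcI hcp, ?_⟩
  rw [card_range, card_range]
  have h1 : G'.degree w + (k + #(A i) - 2) ≤ #((S.erase v).erase w) := by omega
  have h2 : G.degree v + k = #((S.erase v).erase w) + 2 := by omega
  have h3 : #S = #((S.erase v).erase w) + 2 := by omega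
  rw [h2, h3]
  nlinarith

end

/-- Every graph `G` on `n` vertices satisfies `π(G) ≤ n²/2`: the edges of `G` can be
decomposed into complete subgraphs whose orders sum to at most `n²/2`. -/
theorem chung_gyori_kostochka :
    ∀ (n : ℕ) (G : SimpleGraph (Fin n)),
      ∃ (ℓ : ℕ) (D : Fin ℓ → Finset (Fin n)), IsCliqueDecomp G D ∧
        (∑ i, ((D i).card : ℝ)) ≤ (n : ℝ) ^ 2 / 2 := by
  intro n G
  obtain ⟨k, ⟨P, hP, hex, hk⟩, hkn⟩ :=
    exists_hasCliqueDecompLE (univ : Finset (Fin n)) G fun _ _ _ => mem_univ _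
  refine ⟨#P, fun i => (P.equivFin.symm i : Finset (Fin n)), ⟨fun i => hP _ (P.equivFin.symm i).2,
    fun u v huv => ?_⟩, ?_⟩
  · obtain ⟨C, ⟨hC, hu, hv⟩, huniq⟩ := hex u v huv
    refine ⟨P.equivFin ⟨C, hC⟩, by simpa using ⟨hu, hv⟩, fun i hi => ?_⟩
    rw [← Equiv.symm_apply_eq]
    exact Subtype.ext (huniq _ ⟨(P.equivFin.symm i).2, hi⟩)
  · have hsum : ∑ i, #(P.equivFin.symm i : Finset (Fin n)) = ∑ C ∈ P, #C := by
      rw [Equiv.sum_comp P.equivFin.symm (fun C => #(C : Finset (Fin n))), ← sum_coe_sort P]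
    rw [card_univ, Fintype.card_fin] at hkn
    have h2 : 2 * ∑ i, #(P.equivFin.symm i : Finset (Fin n)) ≤ n ^ 2 := by omega
    have h3 : (2 : ℝ) * ∑ i, (#(P.equivFin.symm i : Finset (Fin n)) : ℝ) ≤ (n : ℝ) ^ 2 := by
      exact_mod_cast h2
    linarith
end
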